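/- Consider the RGV ensemble of rate R and rational composition Q_X over a DMC W with GLD decoding metric g, with distance function d(P_{XX'}) = −I_P(X;X') and threshold Δ = −(R+2δ) for sufficiently small δ > 0. Then the error exponent of the random code converges in probability to the typical error exponent: for every η > 0, P[ |−(1/n)·log P_e(C_n) − E_trc^rgv(R,Q_X,d,Δ)| > η ] → 0 as n → ∞. -/

import Mathlib

open Filter Finset
open scoped Classical

noncomputable section

namespace RGV

/-- A probability distribution on a finite type. -/
def IsDist {α : Type} [Fintype α] (p : α → ℝ) : Prop :=
  (∀ a, 0 ≤ p a) ∧ ∑ a, p a = 1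

/-- `p` is an `n`-type: all probabilities are integer multiples of `1/n`. -/
def IsTypeDist {α : Type} (n : ℕ) (p : α → ℝ) : Prop :=
  ∀ a, ∃ k : ℕ, p a * n = k

/-- Empirical distribution of a sequence. -/
def emp {α : Type} [Fintype α] (n : ℕ) (x : Fin n → α) : α → ℝ :=
  fun a => ((Finset.univ.filter fun i => x i = a).card : ℝ) / n

/-- Joint empirical distribution of a pair of sequences. -/
def emp2 {α β : Type} [Fintype α] [Fintype β] (n : ℕ) (x : Fin n → α) (y : Fin n → β) :
    α × β → ℝ :=
  fun ab => ((Finset.univ.filter fun i => x i = ab.1 ∧ y i = ab.2).card : ℝ) / n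

/-- The type class of a composition `Q`. -/
def typeClass {α : Type} [Fintype α] (n : ℕ) (Q : α → ℝ) : Finset (Fin n → α) :=
  Finset.univ.filter fun x => emp n x = Q

/-- The pair type class of a joint type `P`. -/
def typeClass2 {α : Type} [Fintype α] (n : ℕ) (P : α × α → ℝ) :
    Finset ((Fin n → α) × (Fin n → α)) :=
  Finset.univ.filter fun xx => emp2 n xx.1 xx.2 = P

/-- `P` is a joint distribution on `α × α` with both marginals equal to `Q`. -/
def Joint {α : Type} [Fintype α] (Q : α → ℝ) (P : α × α → ℝ) : Prop :=
  IsDist P ∧ (∀ a, ∑ b, P (a, b) = Q a) ∧ (∀ b, ∑ a, P (a, b) = Q b)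

/-- `d` is a distance function: continuous and symmetric. -/
def IsDistance {α : Type} [Fintype α] (d : (α × α → ℝ) → ℝ) : Prop :=
  Continuous d ∧ ∀ P : α × α → ℝ, d (fun p => P (p.2, p.1)) = d P

/-- Mutual information of a joint distribution (natural logarithms). -/
def mutInf {α β : Type} [Fintype α] [Fintype β] (P : α × β → ℝ) : ℝ :=
  ∑ p : α × β, P p * Real.log (P p / ((∑ b, P (p.1, b)) * (∑ a, P (a, p.2))))

/-- Positive part `[t]₊`. -/
def pos (t : ℝ) : ℝ := max t 0

/-- Number of codewords at blocklength `n` and rate `R`. -/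
def Mof (R : ℝ) (n : ℕ) : ℕ := ⌈Real.exp (n * R)⌉₊

/-- The feasible set for the `i`-th codeword given the previous ones. -/
def feasible {α : Type} [Fintype α] (n : ℕ) (Q : α → ℝ) (d : (α × α → ℝ) → ℝ) (Δ : ℝ)
    {M : ℕ} (c : Fin M → Fin n → α) (i : Fin M) : Finset (Fin n → α) :=
  (typeClass n Q).filter fun z => ∀ j, j < i → Δ < d (emp2 n z (c j))

/-- The probability that the RGV construction outputs the codebook `c`. -/
def rgvProb {α : Type} [Fintype α] (n : ℕ) (Q : α → ℝ) (d : (α × α → ℝ) → ℝ) (Δ : ℝ)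
    {M : ℕ} (c : Fin M → Fin n → α) : ℝ :=
  ∏ i : Fin M,
    if c i ∈ feasible n Q d Δ c i then ((feasible n Q d Δ c i).card : ℝ)⁻¹ else 0

/-- Expectation over the RGV ensemble. -/
def expect {α : Type} [Fintype α] (n : ℕ) (Q : α → ℝ) (d : (α × α → ℝ) → ℝ) (Δ : ℝ)
    (M : ℕ) (f : (Fin M → Fin n → α) → ℝ) : ℝ :=
  ∑ c : Fin M → Fin n → α, rgvProb n Q d Δ c * f c

/-- Probability of an event over the RGV ensemble. -/
def prob {α : Type} [Fintype α] (n : ℕ) (Q : α → ℝ) (d : (α × α → ℝ) → ℝ) (Δ : ℝ)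
    (M : ℕ) (S : (Fin M → Fin n → α) → Prop) : ℝ :=
  ∑ c : Fin M → Fin n → α, if S c then rgvProb n Q d Δ c else 0

/-- `W` is a (discrete memoryless) channel. -/
def IsChannel {α β : Type} [Fintype β] (W : α → β → ℝ) : Prop := ∀ a, IsDist (W a)

/-- The product (memoryless) extension of the channel. -/
def Wn {α β : Type} (n : ℕ) (W : α → β → ℝ) (x : Fin n → α) (y : Fin n → β) : ℝ :=
  ∏ i, W (x i) (y i)

/-- GLD error probability of a codebook. -/
def Pe {α β : Type} [Fintype α] [Fintype β] (n : ℕ) (W : α → β → ℝ)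
    (g : (α × β → ℝ) → ℝ) {M : ℕ} (c : Fin M → Fin n → α) : ℝ :=
  (M : ℝ)⁻¹ * ∑ m : Fin M, ∑ m' ∈ Finset.univ.erase m, ∑ y : Fin n → β,
    Wn n W (c m) y * Real.exp ((n : ℝ) * g (emp2 n (c m') y)) /
      ∑ m'' : Fin M, Real.exp ((n : ℝ) * g (emp2 n (c m'') y))

/-- Marginal `P_{XY}` induced by `P_{XX'}` and the conditional law `V = P_{Y|XX'}`. -/
def PXY {α β : Type} [Fintype α] [Fintype β] (P : α × α → ℝ) (V : α × α → β → ℝ) :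
    α × β → ℝ :=
  fun ay => ∑ b, P (ay.1, b) * V (ay.1, b) ay.2

/-- Marginal `P_{X'Y}`. -/
def PXpY {α β : Type} [Fintype α] [Fintype β] (P : α × α → ℝ) (V : α × α → β → ℝ) :
    α × β → ℝ :=
  fun bY => ∑ a, P (a, bY.1) * V (a, bY.1) bY.2

/-- Output marginal `P_Y`. -/
def PYof {α β : Type} [Fintype α] [Fintype β] (P : α × α → ℝ) (V : α × α → β → ℝ) :
    β → ℝ :=
  fun y => ∑ p : α × α, P p * V p y

/-- Conditional divergence `D(P_{Y|X} ‖ W | Q)`. -/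
def condDiv {α β : Type} [Fintype α] [Fintype β] (Q : α → ℝ) (W : α → β → ℝ)
    (P : α × α → ℝ) (V : α × α → β → ℝ) : ℝ :=
  ∑ a, ∑ y, PXY P V (a, y) * Real.log (PXY P V (a, y) / (Q a * W a y))

/-- Conditional mutual information `I(X';Y|X)`. -/
def cmi {α β : Type} [Fintype α] [Fintype β] (P : α × α → ℝ) (V : α × α → β → ℝ) : ℝ :=
  ∑ a, ∑ b, ∑ y, P (a, b) * V (a, b) y *
    Real.log (P (a, b) * V (a, b) y * (∑ b', P (a, b')) /
      (P (a, b) * PXY P V (a, y)))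

/-- The joint distribution on `α × β` induced by `P_Y` and a reverse channel `V'`. -/
def jointOf {α β : Type} (PY : β → ℝ) (V' : β → α → ℝ) : α × β → ℝ :=
  fun ay => PY ay.2 * V' ay.2 ay.1

/-- The quantity `α(R, P_Y)`. -/
def alphaF {α β : Type} [Fintype α] [Fintype β] (Q : α → ℝ) (g : (α × β → ℝ) → ℝ)
    (R : ℝ) (PY : β → ℝ) : ℝ :=
  sSup { v | ∃ V' : β → α → ℝ, (∀ y, IsDist (V' y)) ∧
    (∀ a, ∑ y, PY y * V' y a = Q a) ∧ mutInf (jointOf PY V') ≤ R ∧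
    v = g (jointOf PY V') - mutInf (jointOf PY V') } + R

/-- The exponent `Γ(P_{XX'}, R)`. -/
def Gamma {α β : Type} [Fintype α] [Fintype β] (Q : α → ℝ) (W : α → β → ℝ)
    (g : (α × β → ℝ) → ℝ) (P : α × α → ℝ) (R : ℝ) : ℝ :=
  sInf { v | ∃ V : α × α → β → ℝ, (∀ p, IsDist (V p)) ∧
    v = condDiv Q W P V + cmi P V +
      pos (max (g (PXY P V)) (alphaF Q g R (PYof P V)) - g (PXpY P V)) }

/-- The quantity `β(R, P_Y)`. -/
def betaF {α β : Type} [Fintype α] [Fintype β] (Q : α → ℝ) (g : (α × β → ℝ) → ℝ)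
    (R : ℝ) (PY : β → ℝ) : ℝ :=
  sSup { v | ∃ V' : β → α → ℝ, (∀ y, IsDist (V' y)) ∧
    (∀ a, ∑ y, PY y * V' y a = Q a) ∧
    v = g (jointOf PY V') + pos (R - mutInf (jointOf PY V')) }

/-- The exponent `Λ(P_{XX'}, R)`. -/
def Lambda {α β : Type} [Fintype α] [Fintype β] (Q : α → ℝ) (W : α → β → ℝ)
    (g : (α × β → ℝ) → ℝ) (P : α × α → ℝ) (R : ℝ) : ℝ :=
  sInf { v | ∃ V : α × α → β → ℝ, (∀ p, IsDist (V p)) ∧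
    v = condDiv Q W P V + cmi P V + betaF Q g R (PYof P V) - g (PXpY P V) }

/-- The candidate value of the typical random coding exponent of the RGV ensemble. -/
def EtrcVal {α β : Type} [Fintype α] [Fintype β] (Q : α → ℝ) (W : α → β → ℝ)
    (g : (α × β → ℝ) → ℝ) (d : (α × α → ℝ) → ℝ) (Δ R : ℝ) : ℝ :=
  sInf { v | ∃ P : α × α → ℝ, Joint Q P ∧ mutInf P ≤ 2 * R ∧ Δ < d P ∧
    v = Gamma Q W g P R + mutInf P - R }

/-- The expurgated exponent. -/
def Eex {α β : Type} [Fintype α] [Fintype β] (Q : α → ℝ) (W : α → β → ℝ)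
    (g : (α × β → ℝ) → ℝ) (R : ℝ) : ℝ :=
  sInf { v | ∃ P : α × α → ℝ, Joint Q P ∧ mutInf P ≤ R ∧
    v = Gamma Q W g P R + mutInf P - R }

/-- The expurgated exponent of the RGV ensemble. -/
def EexRgv {α β : Type} [Fintype α] [Fintype β] (Q : α → ℝ) (W : α → β → ℝ)
    (g : (α × β → ℝ) → ℝ) (d : (α × α → ℝ) → ℝ) (Δ R : ℝ) : ℝ :=
  sInf { v | ∃ P : α × α → ℝ, Joint Q P ∧ Δ < d P ∧ mutInf P ≤ R ∧
    v = Gamma Q W g P R + mutInf P - R }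

/-- The rate condition at blocklength `n` with parameter `δ`
(the minimum over an empty collection of joint types being `+∞`). -/
def RateCond {α : Type} [Fintype α] (n : ℕ) (Q : α → ℝ) (d : (α × α → ℝ) → ℝ)
    (Δ R δ : ℝ) : Prop :=
  ((R : ℝ) : EReal) ≤
    sInf { v : EReal | ∃ P : α × α → ℝ, Joint Q P ∧ IsTypeDist n P ∧ d P ≤ Δ ∧
      v = ((mutInf P : ℝ) : EReal) } - (((2 * δ : ℝ)) : EReal)

/-- Type enumerator: the number of ordered pairs of distinct codewords
with joint empirical distribution `P`. -/
def Nenum {α : Type} [Fintype α] (n : ℕ) (P : α × α → ℝ) {M : ℕ}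
    (c : Fin M → Fin n → α) : ℕ :=
  ((Finset.univ : Finset (Fin M × Fin M)).filter fun mm =>
    mm.1 ≠ mm.2 ∧ emp2 n (c mm.1) (c mm.2) = P).card

/-- Normalized log of a probability (exponential rate), valued in `EReal`. -/
def lrate (n : ℕ) (p : ℝ) : EReal :=
  if p ≤ 0 then ⊥ else ((Real.log p / n : ℝ) : EReal)

/-- Normalized iterated-log rate (double-exponential decay rate), valued in `EReal`. -/
def drate (n : ℕ) (p : ℝ) : EReal :=
  if p ≤ 0 then ⊤ else if 1 ≤ p then ⊥
  else ((Real.log (-Real.log p) / n : ℝ) : EReal)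

/-- `δ_n = e^{-nδ}/(1-e^{-nδ})`. -/
def deltan (n : ℕ) (δ : ℝ) : ℝ := Real.exp (-(n * δ)) / (1 - Real.exp (-(n * δ)))


/-- Blocklength sequence: the multiples of the denominator `D` of the composition. -/
def nseq (D t : ℕ) : ℕ := D * (t + 1)

/-- The normalized expected log error probability `-(1/n) E[log P_e(C_n)]`. -/
def Expnt {α β : Type} [Fintype α] [Fintype β] (n : ℕ) (Q : α → ℝ)
    (d : (α × α → ℝ) → ℝ) (Δ : ℝ) (W : α → β → ℝ) (g : (α × β → ℝ) → ℝ) (R : ℝ) : ℝ :=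
  -(expect n Q d Δ (Mof R n) (fun c => Real.log (Pe n W g c)) / n)

/-- Ratio of type class sizes `|T(P)| / |T(Q)|²`. -/
def Lsize {α : Type} [Fintype α] (n : ℕ) (Q : α → ℝ) (P : α × α → ℝ) : ℝ :=
  ((typeClass2 n P).card : ℝ) / ((typeClass n Q).card : ℝ) ^ 2

end RGV

set_option linter.unusedSectionVars false

namespace RGV

/-! ### Sequential sampling from a finite set under a pairwise constraint -/

/-- Points of `T` compatible with every entry of `c`. -/
def adm {A : Type} (T : Finset A) (ok : A → A → Prop) {M : ℕ} (c : Fin M → A) : Finset A :=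
  T.filter fun z => ∀ j, ok z (c j)

/-- Probability of the tuple `c` when each entry is uniform on the points of `T` compatible with
the previous entries. -/
def wt {A : Type} (T : Finset A) (ok : A → A → Prop) {M : ℕ} (c : Fin M → A) : ℝ :=
  ∏ i : Fin M, if c i ∈ T.filter (fun z => ∀ j, j < i → ok z (c j)) then
    ((T.filter fun z => ∀ j, j < i → ok z (c j)).card : ℝ)⁻¹ else 0

/-- Expectation with respect to `wt`. -/
def ens {A : Type} [Fintype A] (T : Finset A) (ok : A → A → Prop) (M : ℕ)
    (f : (Fin M → A) → ℝ) : ℝ :=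
  ∑ c, wt T ok c * f c

/-- Probability with respect to `wt`. -/
def pr {A : Type} [Fintype A] (T : Finset A) (ok : A → A → Prop) (M : ℕ)
    (p : (Fin M → A) → Prop) : ℝ :=
  ens T ok M fun c => if p c then 1 else 0

/-- Average over a finite set. -/
def avg {A : Type} (S : Finset A) (f : A → ℝ) : ℝ := (S.card : ℝ)⁻¹ * ∑ x ∈ S, f x

section Ensemble

variable {A : Type} [Fintype A] {T : Finset A} {ok : A → A → Prop} {M : ℕ}

lemma adm_subset (c : Fin M → A) : adm T ok c ⊆ T := Finset.filter_subset _ _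

lemma wt_nonneg (c : Fin M → A) : 0 ≤ wt T ok c := by
  unfold wt
  refine Finset.prod_nonneg fun i _ => ?_
  split_ifs
  · positivity
  · exact le_rfl

lemma wt_snoc (c : Fin M → A) (x : A) :
    wt T ok (Fin.snoc c x : Fin (M + 1) → A) =
      wt T ok c * if x ∈ adm T ok c then ((adm T ok c).card : ℝ)⁻¹ else 0 := by
  have h1 : ∀ i : Fin M, (T.filter fun z => ∀ j : Fin (M + 1), j < i.castSucc →
      ok z ((Fin.snoc c x : Fin (M + 1) → A) j)) =
      T.filter fun z => ∀ j, j < i → ok z (c j) := by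
    intro i
    refine Finset.filter_congr fun z _ => ⟨fun h j hj => ?_, fun h j => ?_⟩
    · simpa using h j.castSucc (by simpa using hj)
    · refine Fin.lastCases (fun hj => ?_) (fun j hj => ?_) j
      · exact absurd hj (not_lt.2 (Fin.le_last _))
      · simpa using h j (by simpa using hj)
  have h2 : (T.filter fun z => ∀ j : Fin (M + 1), j < Fin.last M →
      ok z ((Fin.snoc c x : Fin (M + 1) → A) j)) = adm T ok c := by
    refine Finset.filter_congr fun z _ => ⟨fun h j => ?_, fun h j => ?_⟩
    · simpa using h j.castSucc (Fin.castSucc_lt_last j)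
    · refine Fin.lastCases (fun hj => absurd hj (lt_irrefl _)) (fun j hj => ?_) j
      simpa using h j
  unfold wt
  rw [Fin.prod_univ_castSucc]
  simp only [h1, h2, Fin.snoc_castSucc, Fin.snoc_last]

lemma ens_succ (f : (Fin (M + 1) → A) → ℝ) :
    ens T ok (M + 1) f = ens T ok M fun c => avg (adm T ok c) fun x => f (Fin.snoc c x) := by
  unfold ens avg
  rw [← (Fin.snocEquiv fun _ => A).sum_comp, Fintype.sum_prod_type_right]
  refine Finset.sum_congr rfl fun c _ => ?_
  have : ∀ x : A, (Fin.snocEquiv fun _ : Fin (M + 1) => A) (x, c) = Fin.snoc c x := fun x => rfl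
  simp only [this, wt_snoc, Finset.mul_sum, mul_assoc]
  rw [← Finset.sum_filter_add_sum_filter_not Finset.univ (· ∈ adm T ok c)]
  rw [Finset.sum_eq_zero (s := Finset.filter (fun x => ¬ x ∈ adm T ok c) Finset.univ), add_zero]
  · refine Finset.sum_congr (by ext; simp) fun x hx => ?_
    rw [if_pos hx]
  · intro x hx
    rw [if_neg (Finset.mem_filter.1 hx).2]
    simp

lemma ens_zero (f : (Fin 0 → A) → ℝ) : ens T ok 0 f = f Fin.elim0 := by
  unfold ens wt
  rw [Fintype.sum_unique]
  simp only [Finset.univ_eq_empty, Finset.prod_empty, one_mul]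
  congr 1

lemma ens_mono_of_wt {f g : (Fin M → A) → ℝ} (h : ∀ c, wt T ok c ≠ 0 → f c ≤ g c) :
    ens T ok M f ≤ ens T ok M g := by
  refine Finset.sum_le_sum fun c _ => ?_
  by_cases hc : wt T ok c = 0
  · simp [hc]
  · exact mul_le_mul_of_nonneg_left (h c hc) (wt_nonneg c)

lemma ens_mono {f g : (Fin M → A) → ℝ} (h : ∀ c, f c ≤ g c) : ens T ok M f ≤ ens T ok M g :=
  ens_mono_of_wt fun c _ => h c

lemma ens_nonneg {f : (Fin M → A) → ℝ} (h : ∀ c, 0 ≤ f c) : 0 ≤ ens T ok M f :=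
  Finset.sum_nonneg fun c _ => mul_nonneg (wt_nonneg c) (h c)

lemma ens_add (f g : (Fin M → A) → ℝ) :
    ens T ok M (fun c => f c + g c) = ens T ok M f + ens T ok M g := by
  simp only [ens, mul_add, Finset.sum_add_distrib]

lemma ens_sub (f g : (Fin M → A) → ℝ) :
    ens T ok M (fun c => f c - g c) = ens T ok M f - ens T ok M g := by
  simp only [ens, mul_sub, Finset.sum_sub_distrib]

lemma ens_const_mul (a : ℝ) (f : (Fin M → A) → ℝ) :
    ens T ok M (fun c => a * f c) = a * ens T ok M f := by
  simp only [ens, Finset.mul_sum]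
  exact Finset.sum_congr rfl fun c _ => by ring

lemma ens_sum {ι : Type*} (s : Finset ι) (f : ι → (Fin M → A) → ℝ) :
    ens T ok M (fun c => ∑ i ∈ s, f i c) = ∑ i ∈ s, ens T ok M (f i) := by
  simp only [ens, Finset.mul_sum]
  exact Finset.sum_comm

lemma avg_mono {S : Finset A} {f g : A → ℝ} (h : ∀ x ∈ S, f x ≤ g x) : avg S f ≤ avg S g :=
  mul_le_mul_of_nonneg_left (Finset.sum_le_sum h) (by positivity)

lemma avg_const {S : Finset A} (hS : S.Nonempty) (a : ℝ) : avg S (fun _ => a) = a := by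
  have : (S.card : ℝ) ≠ 0 := by exact_mod_cast hS.card_pos.ne'
  simp only [avg, Finset.sum_const, nsmul_eq_mul]
  field_simp

lemma avg_const_le (S : Finset A) {a : ℝ} (ha : 0 ≤ a) : avg S (fun _ => a) ≤ a := by
  rcases S.eq_empty_or_nonempty with rfl | hS
  · simpa [avg] using ha
  · exact (avg_const hS a).le

lemma avg_add (S : Finset A) (f g : A → ℝ) :
    avg S (fun x => f x + g x) = avg S f + avg S g := by
  simp only [avg, Finset.sum_add_distrib, mul_add]

lemma avg_const_mul (S : Finset A) (a : ℝ) (f : A → ℝ) :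
    avg S (fun x => a * f x) = a * avg S f := by
  simp only [avg, ← Finset.mul_sum]
  ring

lemma ens_le_pow (F : ∀ m, (Fin m → A) → ℝ) (r : ℝ) (hr : 0 ≤ r)
    (h : ∀ m < M, ∀ c : Fin m → A,
      avg (adm T ok c) (fun x => F (m + 1) (Fin.snoc c x)) ≤ r * F m c) :
    ens T ok M (F M) ≤ r ^ M * F 0 Fin.elim0 := by
  induction M with
  | zero => simp [ens_zero]
  | succ M ih =>
    rw [ens_succ]
    calc _ ≤ ens T ok M (fun c => r * F M c) := ens_mono fun c => h M (Nat.lt_succ_self M) c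
      _ = r * ens T ok M (F M) := ens_const_mul _ _
      _ ≤ r * (r ^ M * F 0 Fin.elim0) :=
        mul_le_mul_of_nonneg_left (ih fun m hm => h m (hm.trans (Nat.lt_succ_self M))) hr
      _ = _ := by ring

lemma ens_one_le : ens T ok M (fun _ => 1) ≤ 1 := by
  have := ens_le_pow (T := T) (ok := ok) (M := M) (fun _ _ => 1) 1 zero_le_one
    (fun m _ c => by simpa using avg_const_le (adm T ok c) zero_le_one)
  simpa using this

/-- Markov's inequality. -/
lemma pr_le_of_le {f : (Fin M → A) → ℝ} (hf : ∀ c, 0 ≤ f c) {a : ℝ} (ha : 0 < a)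
    {p : (Fin M → A) → Prop} (hp : ∀ c, wt T ok c ≠ 0 → p c → a ≤ f c) :
    pr T ok M p ≤ a⁻¹ * ens T ok M f := by
  rw [← ens_const_mul]
  refine ens_mono_of_wt fun c hc => ?_
  split_ifs with h
  · rw [inv_mul_eq_div, one_le_div ha]
    exact hp c hc h
  · exact mul_nonneg (inv_nonneg.2 ha.le) (hf c)

lemma pr_or_le (p q : (Fin M → A) → Prop) :
    pr T ok M (fun c => p c ∨ q c) ≤ pr T ok M p + pr T ok M q := by
  unfold pr
  rw [← ens_add]
  refine ens_mono fun c => ?_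
  by_cases h1 : p c <;> by_cases h2 : q c <;> simp [h1, h2]

lemma pr_mono {p q : (Fin M → A) → Prop} (h : ∀ c, wt T ok c ≠ 0 → p c → q c) :
    pr T ok M p ≤ pr T ok M q := by
  refine ens_mono_of_wt fun c hc => ?_
  by_cases hp : p c
  · simp [hp, h c hc hp]
  · simp only [hp, if_false]
    split_ifs <;> norm_num

lemma pr_nonneg (p : (Fin M → A) → Prop) : 0 ≤ pr T ok M p :=
  ens_nonneg fun c => by split_ifs <;> norm_num

lemma pr_exists_le {ι : Type*} [Fintype ι] (p : ι → (Fin M → A) → Prop) :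
    pr T ok M (fun c => ∃ i, p i c) ≤ ∑ i, pr T ok M (p i) := by
  unfold pr
  rw [← ens_sum]
  refine ens_mono fun c => ?_
  have h0 : ∀ i ∈ Finset.univ, (0 : ℝ) ≤ if p i c then 1 else 0 := fun i _ => by
    split_ifs <;> norm_num
  split_ifs with h
  · obtain ⟨i, hi⟩ := h
    refine le_trans ?_ (Finset.single_le_sum h0 (Finset.mem_univ i))
    rw [if_pos hi]
  · exact Finset.sum_nonneg h0

lemma mem_of_wt_ne_zero {c : Fin M → A} (hc : wt T ok c ≠ 0) (i : Fin M) : c i ∈ T := by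
  by_contra h
  refine hc (Finset.prod_eq_zero (Finset.mem_univ i) ?_)
  rw [if_neg]
  exact fun h' => h (Finset.mem_filter.1 h').1

lemma ok_of_wt_ne_zero (hs : ∀ x z, ok x z → ok z x) {c : Fin M → A} (hc : wt T ok c ≠ 0)
    {i j : Fin M} (hij : i ≠ j) : ok (c i) (c j) := by
  have key : ∀ i j : Fin M, j < i → ok (c i) (c j) := by
    intro i j hij
    by_contra h
    refine hc (Finset.prod_eq_zero (Finset.mem_univ i) ?_)
    rw [if_neg]
    exact fun h' => h ((Finset.mem_filter.1 h').2 j hij)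
  rcases lt_or_gt_of_ne hij with h | h
  · exact hs _ _ (key _ _ h)
  · exact key _ _ h

section Bounds

variable {b θ : ℝ} (hT : T.Nonempty)
  (hb : ∀ z, ((T.filter fun x => ¬ ok x z).card : ℝ) ≤ b * T.card)

include hb in
lemma card_adm_ge (c : Fin M → A) (hθ : M * b ≤ θ) :
    (1 - θ) * T.card ≤ (adm T ok c).card := by
  have h1 : T ⊆ adm T ok c ∪ Finset.univ.biUnion fun j => T.filter fun x => ¬ ok x (c j) := by
    intro x hx
    by_cases h : ∀ j, ok x (c j)
    · exact Finset.mem_union_left _ (Finset.mem_filter.2 ⟨hx, h⟩)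
    · push Not at h
      obtain ⟨j, hj⟩ := h
      exact Finset.mem_union_right _
        (Finset.mem_biUnion.2 ⟨j, Finset.mem_univ _, Finset.mem_filter.2 ⟨hx, hj⟩⟩)
  have h2 : (T.card : ℝ) ≤ (adm T ok c).card + ∑ j, ((T.filter fun x => ¬ ok x (c j)).card : ℝ) := by
    exact_mod_cast (Finset.card_le_card h1).trans
      ((Finset.card_union_le _ _).trans (Nat.add_le_add_left Finset.card_biUnion_le _))
  have h3 : ∑ j : Fin M, ((T.filter fun x => ¬ ok x (c j)).card : ℝ) ≤ M * (b * T.card) := by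
    refine (Finset.sum_le_sum fun j _ => hb (c j)).trans ?_
    simp
  have h4 : (M * b) * T.card ≤ θ * T.card := mul_le_mul_of_nonneg_right hθ (by positivity)
  nlinarith

include hT hb in
lemma adm_nonempty (c : Fin M → A) (hθ : M * b ≤ θ) (hθ1 : θ ≤ 1 / 2) :
    (adm T ok c).Nonempty := by
  have h := card_adm_ge hb c hθ
  have h2 : (0 : ℝ) < T.card := by exact_mod_cast hT.card_pos
  have : (0 : ℝ) < (adm T ok c).card := by nlinarith
  exact Finset.card_pos.1 (by exact_mod_cast this)

include hT hb in
lemma avg_adm_le (c : Fin M → A) (hθ : M * b ≤ θ) (hθ0 : 0 ≤ θ) (hθ1 : θ ≤ 1 / 2)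
    {f : A → ℝ} (hf : ∀ x ∈ T, 0 ≤ f x) :
    avg (adm T ok c) f ≤ (1 + 2 * θ) / T.card * ∑ x ∈ T, f x := by
  have h := card_adm_ge hb c hθ
  have h2 : (0 : ℝ) < T.card := by exact_mod_cast hT.card_pos
  have h3 : (0 : ℝ) < (1 - θ) * T.card := by nlinarith
  have h4 : ((adm T ok c).card : ℝ)⁻¹ ≤ (1 + 2 * θ) / T.card := by
    rw [inv_eq_one_div, div_le_div_iff₀ (h3.trans_le h) h2]
    nlinarith [mul_nonneg hθ0 (by linarith : (0 : ℝ) ≤ 1 - 2 * θ)]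
  unfold avg
  refine mul_le_mul h4 (Finset.sum_le_sum_of_subset_of_nonneg (adm_subset c) fun x hx _ => hf x hx)
    (Finset.sum_nonneg fun x hx => hf x (adm_subset c hx)) (by positivity)

include hT hb in
lemma ens_one (hb0 : 0 ≤ b) (hθ : M * b ≤ 1 / 2) : ens T ok M (fun _ => 1) = 1 := by
  induction M with
  | zero => simp [ens_zero]
  | succ M ih =>
    have hle : (M : ℝ) * b ≤ 1 / 2 := by push_cast at hθ; nlinarith
    rw [ens_succ]
    simp only [avg_const (adm_nonempty hT hb _ hle le_rfl), ih hle]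

include hT hb in
lemma ens_eq_on_le (hb0 : 0 ≤ b) (hθ : M * b ≤ θ) (hθ0 : 0 ≤ θ) (hθ1 : θ ≤ 1 / 2)
    (J : Finset (Fin M)) (z : Fin M → A) (hz : ∀ i ∈ J, z i ∈ T) :
    ens T ok M (fun c => if ∀ i ∈ J, c i = z i then 1 else 0) ≤
      ((1 + 2 * θ) / T.card) ^ J.card := by
  set ρ := (1 + 2 * θ) / (T.card : ℝ) with hρ
  have key : ∀ (m : ℕ) (J : Fin m → Prop) (z : Fin m → A), (m : ℝ) * b ≤ θ →
      (∀ i, J i → z i ∈ T) →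
      ens T ok m (fun c => ∏ i, if J i then (if c i = z i then (1 : ℝ) else 0) else 1) ≤
        ∏ i, if J i then ρ else 1 := by
    intro m
    induction m with
    | zero => intro J z _ _; simp [ens_zero]
    | succ m ih =>
      intro J z hm hz
      have hle : (m : ℝ) * b ≤ θ := by push_cast at hm; nlinarith
      have hρ0 : 0 ≤ ρ := by positivity
      rw [ens_succ, Fin.prod_univ_castSucc]
      have hstep : ∀ c : Fin m → A, avg (adm T ok c) (fun x => ∏ i : Fin (m + 1), if J i then
          (if (Fin.snoc c x : Fin (m + 1) → A) i = z i then (1 : ℝ) else 0) else 1) ≤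
          (if J (Fin.last m) then ρ else 1) *
          ∏ i : Fin m, if J i.castSucc then (if c i = z i.castSucc then (1 : ℝ) else 0) else 1 := by
        intro c
        have hp : 0 ≤ ∏ i : Fin m,
            if J i.castSucc then (if c i = z i.castSucc then (1 : ℝ) else 0) else 1 := by
          refine Finset.prod_nonneg fun i _ => ?_
          split_ifs <;> norm_num
        simp only [Fin.prod_univ_castSucc, Fin.snoc_castSucc, Fin.snoc_last]
        rw [avg_const_mul, mul_comm]
        refine mul_le_mul_of_nonneg_right ?_ hp
        by_cases hJ : J (Fin.last m)
        · simp only [hJ, if_true]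
          refine (avg_adm_le hT hb c hle hθ0 hθ1 fun x _ => ?_).trans ?_
          · split_ifs <;> norm_num
          · rw [Finset.sum_ite_eq' T, if_pos (hz _ hJ), mul_one]
        · simp only [hJ, if_false]
          exact avg_const_le _ zero_le_one
      refine (ens_mono hstep).trans ?_
      rw [ens_const_mul, mul_comm]
      refine mul_le_mul_of_nonneg_right (ih (fun i => J i.castSucc) (fun i => z i.castSucc) hle
        fun i hi => hz _ hi) ?_
      split_ifs <;> [exact hρ0; norm_num]
  refine le_trans (le_of_eq ?_) ((key M (· ∈ J) z hθ hz).trans (le_of_eq ?_))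
  · congr 1
    funext c
    by_cases h : ∀ i ∈ J, c i = z i
    · rw [if_pos h, Finset.prod_eq_one]
      intro i _
      by_cases hi : i ∈ J
      · simp [hi, h i hi]
      · simp [hi]
    · rw [if_neg h]
      push Not at h
      obtain ⟨i, hi, hne⟩ := h
      exact (Finset.prod_eq_zero (Finset.mem_univ i) (by simp [hi, hne])).symm
  · have h := Finset.prod_ite_mem Finset.univ J fun _ => ρ
    rw [Finset.univ_inter, Finset.prod_const] at h
    rw [← h]
    exact Finset.prod_congr rfl fun i _ => by congr

include hT hb in
lemma ens_pair_le (hb0 : 0 ≤ b) (hθ : M * b ≤ θ) (hθ0 : 0 ≤ θ) (hθ1 : θ ≤ 1 / 2)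
    {i j : Fin M} (hij : i ≠ j) {f : A → A → ℝ} (hf : ∀ x z, 0 ≤ f x z) :
    ens T ok M (fun c => f (c i) (c j)) ≤
      ((1 + 2 * θ) / T.card) ^ 2 * ∑ x ∈ T, ∑ z ∈ T, f x z := by
  have h1 : ens T ok M (fun c => f (c i) (c j)) ≤
      ens T ok M (fun c => ∑ x ∈ T, ∑ z ∈ T, f x z * if c i = x ∧ c j = z then 1 else 0) := by
    refine ens_mono_of_wt fun c hc => le_of_eq ?_
    rw [Finset.sum_eq_single_of_mem (c i) (mem_of_wt_ne_zero hc i),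
      Finset.sum_eq_single_of_mem (c j) (mem_of_wt_ne_zero hc j)]
    · simp
    · intro z _ hz
      simp [hz.symm]
    · intro x _ hx
      simp [hx.symm]
  refine h1.trans ?_
  rw [ens_sum, Finset.mul_sum]
  refine Finset.sum_le_sum fun x hx => ?_
  rw [ens_sum, Finset.mul_sum]
  refine Finset.sum_le_sum fun z hz => ?_
  rw [ens_const_mul, mul_comm]
  refine mul_le_mul_of_nonneg_right ?_ (hf x z)
  have := ens_eq_on_le hT hb hb0 hθ hθ0 hθ1 {i, j} (fun k => if k = i then x else z)
    (by intro k _; split_ifs <;> assumption)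
  rw [Finset.card_pair hij] at this
  simpa [hij.symm] using this

include hT hb in
lemma ens_triple_le (hb0 : 0 ≤ b) (hθ : M * b ≤ θ) (hθ0 : 0 ≤ θ) (hθ1 : θ ≤ 1 / 2)
    {i j k : Fin M} (hij : i ≠ j) (hik : i ≠ k) (hjk : j ≠ k) {f : A → A → A → ℝ}
    (hf : ∀ x z w, 0 ≤ f x z w) :
    ens T ok M (fun c => f (c i) (c j) (c k)) ≤
      ((1 + 2 * θ) / T.card) ^ 3 * ∑ x ∈ T, ∑ z ∈ T, ∑ w ∈ T, f x z w := by
  have h1 : ens T ok M (fun c => f (c i) (c j) (c k)) ≤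
      ens T ok M (fun c => ∑ x ∈ T, ∑ z ∈ T, ∑ w ∈ T,
        f x z w * if c i = x ∧ c j = z ∧ c k = w then 1 else 0) := by
    refine ens_mono_of_wt fun c hc => le_of_eq ?_
    rw [Finset.sum_eq_single_of_mem (c i) (mem_of_wt_ne_zero hc i),
      Finset.sum_eq_single_of_mem (c j) (mem_of_wt_ne_zero hc j),
      Finset.sum_eq_single_of_mem (c k) (mem_of_wt_ne_zero hc k)]
    · simp
    · intro z _ hz
      simp [hz.symm]
    · intro z _ hz
      simp [hz.symm]
    · intro x _ hx
      simp [hx.symm]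
  refine h1.trans ?_
  rw [ens_sum, Finset.mul_sum]
  refine Finset.sum_le_sum fun x hx => ?_
  rw [ens_sum, Finset.mul_sum]
  refine Finset.sum_le_sum fun z hz => ?_
  rw [ens_sum, Finset.mul_sum]
  refine Finset.sum_le_sum fun w hw => ?_
  rw [ens_const_mul, mul_comm]
  refine mul_le_mul_of_nonneg_right ?_ (hf x z w)
  have := ens_eq_on_le hT hb hb0 hθ hθ0 hθ1 {i, j, k}
    (fun l => if l = i then x else if l = j then z else w)
    (by intro l _; split_ifs <;> assumption)
  rw [Finset.card_eq_three.2 ⟨i, j, k, hij, hik, hjk, rfl⟩] at this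
  simpa [hij.symm, hik.symm, hjk.symm] using this

end Bounds
end Ensemble

section Tail

variable {A : Type} [Fintype A] {T : Finset A} {ok : A → A → Prop} {M : ℕ}
variable {b θ : ℝ} (hT : T.Nonempty)
  (hb : ∀ z, ((T.filter fun x => ¬ ok x z).card : ℝ) ≤ b * T.card)
  (hsym : ∀ x z, ok x z → ok z x)

include hb hsym in
lemma sum_card_filter_not_ok_le (S : Finset A) :
    ∑ x ∈ T, ((S.filter fun z => ¬ ok z x).card : ℝ) ≤ S.card * (b * T.card) := by
  have h1 : ∑ x ∈ T, ((S.filter fun z => ¬ ok z x).card : ℝ) =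
      ∑ z ∈ S, ((T.filter fun x => ¬ ok x z).card : ℝ) := by
    simp only [Finset.card_filter, Nat.cast_sum]
    rw [Finset.sum_comm]
    refine Finset.sum_congr rfl fun z _ => Finset.sum_congr rfl fun x _ => ?_
    by_cases h : ok z x
    · simp [h, hsym _ _ h]
    · have h' : ¬ ok x z := fun h' => h (hsym _ _ h')
      simp [h, h']
  rw [h1]
  refine (Finset.sum_le_sum fun z _ => hb z).trans ?_
  simp

include hT hb hsym in
/-- The part of `S` that is blocked by the sampled points rarely exceeds one half. -/
lemma ens_blocked_le (hb0 : 0 < b) (hM : 10 * M * b ≤ 1) {S : Finset A} (hS : S ⊆ T) :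
    pr T ok M (fun c => (S.card : ℝ) / 2 < ∑ j, ((S.filter fun z => ¬ ok z (c j)).card : ℝ)) ≤ Real.exp (-((S.card : ℝ) / T.card * M / 8)) := by
  have hT0 : (0 : ℝ) < T.card := by exact_mod_cast hT.card_pos
  set q : ℝ := (S.card : ℝ) / T.card with hq
  have hq0 : 0 ≤ q := by positivity
  set Y : A → ℝ := fun x => ((S.filter fun z => ¬ ok z x).card : ℝ) / (b * T.card) with hY
  have hY0 : ∀ x, 0 ≤ Y x := fun x => by positivity
  have hY1 : ∀ x, Y x ≤ 1 := by
    intro x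
    rw [hY]
    refine (div_le_one (by positivity)).2 (le_trans ?_ (hb x))
    exact_mod_cast Finset.card_le_card (Finset.filter_subset_filter _ hS)
  have hexp : ∀ t : ℝ, 0 ≤ t → t ≤ 1 → Real.exp t ≤ 1 + 2 * t := by
    intro t h0 h1
    have := Real.abs_exp_sub_one_le (x := t) (by rw [abs_of_nonneg h0]; exact h1)
    rw [abs_of_nonneg h0] at this
    linarith [le_abs_self (Real.exp t - 1)]
  have hE : ens T ok M (fun c => Real.exp (∑ j, Y (c j))) ≤ Real.exp (4 * q) ^ M := by
    have := ens_le_pow (T := T) (ok := ok) (M := M) (fun m c => Real.exp (∑ j, Y (c j)))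
      (Real.exp (4 * q)) (Real.exp_pos _).le ?_
    · simpa using this
    · intro m hm c
      have hmb : (m : ℝ) * b ≤ 1 / 2 := by
        have : (m : ℝ) ≤ M := by exact_mod_cast hm.le
        nlinarith
      simp only [Fin.sum_univ_castSucc, Fin.snoc_castSucc, Fin.snoc_last, Real.exp_add]
      rw [avg_const_mul, mul_comm]
      refine mul_le_mul_of_nonneg_right ?_ (Real.exp_pos _).le
      calc avg (adm T ok c) (fun x => Real.exp (Y x))
          ≤ avg (adm T ok c) (fun x => 1 + 2 * Y x) := avg_mono fun x _ => hexp _ (hY0 x) (hY1 x)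
        _ = avg (adm T ok c) (fun _ => 1) + 2 * avg (adm T ok c) Y := by
            rw [avg_add, avg_const_mul]
        _ ≤ 1 + 2 * ((1 + 2 * (1 / 2)) / T.card * ∑ x ∈ T, Y x) := by
            gcongr
            · exact avg_const_le _ zero_le_one
            · exact avg_adm_le hT hb c hmb (by norm_num) le_rfl fun x _ => hY0 x
        _ ≤ 1 + 2 * ((1 + 2 * (1 / 2)) / T.card * S.card) := by
            gcongr
            rw [hY, ← Finset.sum_div, div_le_iff₀ (by positivity)]
            exact sum_card_filter_not_ok_le hb hsym S
        _ = 4 * q + 1 := by rw [hq]; ring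
        _ ≤ _ := Real.add_one_le_exp _
  refine (pr_le_of_le (f := fun c => Real.exp (∑ j, Y (c j)))
    (fun c => (Real.exp_pos _).le) (Real.exp_pos (q / (2 * b))) ?_).trans ?_
  · intro c _ hc
    refine Real.exp_le_exp.2 ?_
    rw [hY, ← Finset.sum_div, hq, div_div, div_le_div_iff₀ (by positivity) (by positivity)]
    have : 0 < b * T.card := by positivity
    nlinarith
  · rw [← Real.exp_neg]
    refine (mul_le_mul_of_nonneg_left hE (Real.exp_pos _).le).trans ?_
    rw [← Real.exp_nat_mul, ← Real.exp_add]
    refine Real.exp_le_exp.2 ?_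
    have h5 : 5 * (M : ℝ) ≤ 1 / (2 * b) := by
      rw [le_div_iff₀ (by positivity)]
      linarith
    have h6 : q / (2 * b) = q * (1 / (2 * b)) := by ring
    rw [h6]
    have hM0 : (0 : ℝ) ≤ M := by positivity
    nlinarith [mul_le_mul_of_nonneg_left h5 hq0, mul_nonneg hq0 hM0]

include hT hb hsym in
/-- The number of sampled points in `S` is at least one eighth of its nominal mean, up to an
event whose probability decays exponentially in that mean. -/
lemma ens_count_lower_tail (hb0 : 0 < b) (hM : 10 * M * b ≤ 1) {S : Finset A} (hS : S ⊆ T) :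
    pr T ok M (fun c => (∑ j, if c j ∈ S then (1 : ℝ) else 0) < (S.card : ℝ) / T.card * M / 8) ≤
      2 * Real.exp (-((S.card : ℝ) / T.card * M / 8)) := by
  have hT0 : (0 : ℝ) < T.card := by exact_mod_cast hT.card_pos
  set q : ℝ := (S.card : ℝ) / T.card with hq
  have hq0 : 0 ≤ q := by positivity
  set G : ∀ m, (Fin m → A) → Prop := fun m c =>
    ∑ j, ((S.filter fun z => ¬ ok z (c j)).card : ℝ) ≤ (S.card : ℝ) / 2 with hG
  set F : ∀ m, (Fin m → A) → ℝ := fun m c =>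
    if G m c then Real.exp (-∑ j, if c j ∈ S then (1 : ℝ) else 0) else 0 with hF
  have hF0 : ∀ m c, 0 ≤ F m c := by
    intro m c
    rw [hF]
    dsimp only
    split_ifs
    · exact (Real.exp_pos _).le
    · exact le_rfl
  have hE : ens T ok M (F M) ≤ Real.exp (-(q / 4)) ^ M := by
    have := ens_le_pow (T := T) (ok := ok) (M := M) F
      (Real.exp (-(q / 4))) (Real.exp_pos _).le ?_
    · refine this.trans (mul_le_of_le_one_right (by positivity) ?_)
      rw [hF]
      dsimp only
      split_ifs <;> simp
    · intro m hm c
      have hmb : (m : ℝ) * b ≤ 1 / 2 := by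
        have : (m : ℝ) ≤ M := by exact_mod_cast hm.le
        nlinarith
      by_cases hc : G m c
      · have h1 : ∀ x, F (m + 1) (Fin.snoc c x) ≤
            F m c * Real.exp (-if x ∈ S then (1 : ℝ) else 0) := by
          intro x
          have h2 : F m c * Real.exp (-if x ∈ S then (1 : ℝ) else 0) =
              Real.exp (-∑ j, if (Fin.snoc c x : Fin (m + 1) → A) j ∈ S then (1 : ℝ) else 0) := by
            rw [hF]
            simp only [if_pos hc, Fin.sum_univ_castSucc, Fin.snoc_castSucc, Fin.snoc_last,
              neg_add, Real.exp_add]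
          rw [h2, hF]
          dsimp only
          split_ifs
          · exact le_rfl
          · exact (Real.exp_pos _).le
        refine (avg_mono fun x _ => h1 x).trans ?_
        rw [avg_const_mul, mul_comm]
        refine mul_le_mul_of_nonneg_right ?_ (hF0 m c)
        have hne := adm_nonempty hT hb c hmb le_rfl
        have hadm0 : (0 : ℝ) < (adm T ok c).card := by exact_mod_cast hne.card_pos
        have hcard : (S.card : ℝ) / 2 ≤ ∑ x ∈ adm T ok c, if x ∈ S then (1 : ℝ) else 0 := by
          have hsub : S ⊆ (adm T ok c).filter (· ∈ S) ∪
              Finset.univ.biUnion fun j => S.filter fun z => ¬ ok z (c j) := by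
            intro x hx
            by_cases h : ∀ j, ok x (c j)
            · exact Finset.mem_union_left _ (Finset.mem_filter.2
                ⟨Finset.mem_filter.2 ⟨hS hx, h⟩, hx⟩)
            · push Not at h
              obtain ⟨j, hj⟩ := h
              exact Finset.mem_union_right _
                (Finset.mem_biUnion.2 ⟨j, Finset.mem_univ _, Finset.mem_filter.2 ⟨hx, hj⟩⟩)
          have h2 : (S.card : ℝ) ≤ ((adm T ok c).filter (· ∈ S)).card +
              ∑ j, ((S.filter fun z => ¬ ok z (c j)).card : ℝ) := by
            exact_mod_cast (Finset.card_le_card hsub).trans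
              ((Finset.card_union_le _ _).trans (Nat.add_le_add_left Finset.card_biUnion_le _))
          have h3 : (((adm T ok c).filter (· ∈ S)).card : ℝ) =
              ∑ x ∈ adm T ok c, if x ∈ S then (1 : ℝ) else 0 := by
            simp [Finset.card_filter]
          rw [← h3]
          rw [hG] at hc
          linarith
        have h4 : avg (adm T ok c) (fun x => Real.exp (-if x ∈ S then (1 : ℝ) else 0)) ≤
            avg (adm T ok c) (fun x => 1 + (-(1 / 2)) * if x ∈ S then (1 : ℝ) else 0) := by
          refine avg_mono fun x _ => ?_
          split_ifs
          · have : Real.exp (-1) ≤ 1 / 2 := by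
              have := Real.exp_neg_one_lt_d9
              linarith
            linarith
          · simp
        refine h4.trans ?_
        rw [avg_add, avg_const_mul, avg_const hne]
        have h5 : q / 2 ≤ avg (adm T ok c) (fun x => if x ∈ S then (1 : ℝ) else 0) := by
          unfold avg
          rw [inv_mul_eq_div, hq, div_div, div_le_div_iff₀ (by positivity) hadm0]
          have : ((adm T ok c).card : ℝ) ≤ T.card := by
            exact_mod_cast Finset.card_le_card (adm_subset c)
          have hS0 : (0 : ℝ) ≤ S.card := by positivity
          nlinarith
        have := Real.add_one_le_exp (-(q / 4))
        linarith
      · have h1 : ∀ x, F (m + 1) (Fin.snoc c x) = 0 := by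
          intro x
          rw [hF]
          dsimp only
          rw [if_neg]
          intro h
          refine hc (le_trans ?_ h)
          rw [Fin.sum_univ_castSucc]
          simp
        simp only [h1]
        have := hF0 m c
        have h0 := avg_const_le (adm T ok c) (le_refl (0 : ℝ))
        exact h0.trans (by positivity)
  have hsplit : pr T ok M (fun c => (∑ j, if c j ∈ S then (1 : ℝ) else 0) < q * M / 8) ≤
      pr T ok M (fun c => (S.card : ℝ) / 2 < ∑ j, ((S.filter fun z => ¬ ok z (c j)).card : ℝ)) +
      pr T ok M (fun c => G M c ∧ (∑ j, if c j ∈ S then (1 : ℝ) else 0) < q * M / 8) := by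
    refine le_trans (pr_mono fun c _ h => ?_) (pr_or_le _ _)
    by_cases h' : G M c
    · exact Or.inr ⟨h', h⟩
    · exact Or.inl (not_le.1 h')
  refine hsplit.trans ?_
  rw [two_mul]
  refine add_le_add (ens_blocked_le hT hb hsym hb0 hM hS) ?_
  refine (pr_le_of_le (f := F M) (hF0 M) (Real.exp_pos (-(q * M / 8))) ?_).trans ?_
  · rintro c _ ⟨h1, h2⟩
    rw [hF]
    dsimp only
    rw [if_pos h1]
    exact Real.exp_le_exp.2 (by linarith)
  · rw [← Real.exp_neg]
    refine (mul_le_mul_of_nonneg_left hE (Real.exp_pos _).le).trans ?_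
    rw [← Real.exp_nat_mul, ← Real.exp_add]
    refine Real.exp_le_exp.2 (le_of_eq ?_)
    ring

end Tail

/-- Indicator of a proposition. -/
def ind (p : Prop) : ℝ := if p then 1 else 0

lemma ind_nonneg (p : Prop) : 0 ≤ ind p := by unfold ind; split_ifs <;> norm_num

lemma ind_le_one (p : Prop) : ind p ≤ 1 := by unfold ind; split_ifs <;> norm_num

lemma ind_of {p : Prop} (h : p) : ind p = 1 := if_pos h

lemma ind_of_not {p : Prop} (h : ¬ p) : ind p = 0 := if_neg h

lemma sum_ind_eq_card {A : Type*} (T : Finset A) (p : A → Prop) [DecidablePred p] :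
    ∑ x ∈ T, ind (p x) = ((T.filter p).card : ℝ) := by
  rw [Finset.card_filter, Nat.cast_sum]
  exact Finset.sum_congr rfl fun x _ => by unfold ind; split_ifs <;> simp

/-- Number of pairs of indices `i < j` whose entries are related by `s`. -/
def pairCount {A : Type} (s : A → A → Prop) {M : ℕ} (c : Fin M → A) : ℝ :=
  ∑ j, ∑ i, ind (i < j ∧ s (c i) (c j))

section SecondMoment

variable {A : Type} {T : Finset A} {ok s : A → A → Prop} {M : ℕ}
variable {b θ K : ℝ}

lemma pairCount_nonneg (c : Fin M → A) : 0 ≤ pairCount s c :=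
  Finset.sum_nonneg fun _ _ => Finset.sum_nonneg fun _ _ => ind_nonneg _

lemma pairCount_snoc (c : Fin M → A) (x : A) :
    pairCount s (Fin.snoc c x : Fin (M + 1) → A) = pairCount s c + ∑ i, ind (s (c i) x) := by
  unfold pairCount
  rw [Fin.sum_univ_castSucc]
  congr 1
  · refine Finset.sum_congr rfl fun j _ => ?_
    rw [Fin.sum_univ_castSucc]
    have : ¬ Fin.last M < j.castSucc := not_lt.2 (Fin.le_last _)
    rw [ind_of_not fun h => this h.1, add_zero]
    simp only [Fin.snoc_castSucc, Fin.castSucc_lt_castSucc_iff]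
  · rw [Fin.sum_univ_castSucc]
    simp [ind, Fin.castSucc_lt_last, -Finset.sum_boole]

variable [Fintype A] (hT : T.Nonempty)
  (hb : ∀ z, ((T.filter fun x => ¬ ok x z).card : ℝ) ≤ b * T.card)
  (hb0 : 0 ≤ b) (hθ0 : 0 ≤ θ) (hθ1 : θ ≤ 1 / 2)
  (hK1 : ∀ x ∈ T, ∑ z ∈ T, ind (s x z) = K) (hK2 : ∀ z ∈ T, ∑ x ∈ T, ind (s x z) = K)

include hT hb hθ0 hθ1 hK1 in
lemma avg_degree_le (hθ : M * b ≤ θ) {c : Fin M → A} (hc : wt T ok c ≠ 0) :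
    avg (adm T ok c) (fun x => ∑ i, ind (s (c i) x)) ≤ (1 + 2 * θ) * (K / T.card) * M := by
  refine (avg_adm_le hT hb c hθ hθ0 hθ1 fun x _ => Finset.sum_nonneg fun i _ => ind_nonneg _).trans
    (le_of_eq ?_)
  rw [Finset.sum_comm]
  simp only [hK1 _ (mem_of_wt_ne_zero hc _)]
  simp
  ring

include hT hb hb0 hθ0 hθ1 hK1 in
lemma ens_pairCount_le (hθ : M * b ≤ θ) :
    ens T ok M (pairCount s) ≤ (1 + 2 * θ) * (K / T.card) * (M * (M - 1) / 2) := by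
  induction M with
  | zero => simp [ens_zero, pairCount]
  | succ M ih =>
    have hle : (M : ℝ) * b ≤ θ := by push_cast at hθ; nlinarith
    rw [ens_succ]
    have h1 : ens T ok M (fun c => avg (adm T ok c) fun x => pairCount s (Fin.snoc c x)) ≤
        ens T ok M (fun c => pairCount s c + (1 + 2 * θ) * (K / T.card) * M * 1) := by
      refine ens_mono_of_wt fun c hc => ?_
      simp only [pairCount_snoc]
      rw [avg_add, mul_one]
      exact add_le_add (avg_const_le _ (pairCount_nonneg c))
        (avg_degree_le hT hb hθ0 hθ1 hK1 hle hc)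
    refine h1.trans ?_
    have hK0 : 0 ≤ K := by
      obtain ⟨x, hx⟩ := hT
      rw [← hK1 x hx]
      exact Finset.sum_nonneg fun i _ => ind_nonneg _
    rw [ens_add, ens_const_mul]
    have h2 := ih hle
    have h3 : (1 + 2 * θ) * (K / T.card) * M * ens T ok M (fun _ => 1) ≤
        (1 + 2 * θ) * (K / T.card) * M * 1 :=
      mul_le_mul_of_nonneg_left ens_one_le (by positivity)
    push_cast
    linarith

include hT hb hb0 hθ0 hθ1 hK1 hK2 in
lemma ens_sum_codegree_le (hθ : M * b ≤ θ) :
    ens T ok M (fun c => ∑ i, ∑ k, ∑ x ∈ T, ind (s (c i) x) * ind (s (c k) x)) ≤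
      M * K + M ^ 2 * (((1 + 2 * θ) / T.card) ^ 2 * (T.card * K ^ 2)) := by
  have hK0 : 0 ≤ K := by
    obtain ⟨x, hx⟩ := hT
    rw [← hK1 x hx]
    exact Finset.sum_nonneg fun i _ => ind_nonneg _
  set B := ((1 + 2 * θ) / (T.card : ℝ)) ^ 2 * (T.card * K ^ 2) with hB
  have hB0 : 0 ≤ B := by positivity
  have hpair : ∀ i k : Fin M, ens T ok M (fun c => ∑ x ∈ T, ind (s (c i) x) * ind (s (c k) x)) ≤
      (if i = k then K else 0) + B := by
    intro i k
    by_cases hik : i = k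
    · subst hik
      rw [if_pos rfl]
      refine le_trans (b := ens T ok M fun _ => K * 1) ?_ ?_
      · refine ens_mono_of_wt fun c hc => ?_
        rw [mul_one, ← hK1 _ (mem_of_wt_ne_zero hc i)]
        exact Finset.sum_le_sum fun x _ => mul_le_of_le_one_right (ind_nonneg _) (ind_le_one _)
      · rw [ens_const_mul]
        nlinarith [mul_le_mul_of_nonneg_left (ens_one_le (T := T) (ok := ok) (M := M)) hK0]
    · rw [if_neg hik, zero_add]
      refine (ens_pair_le hT hb hb0 hθ hθ0 hθ1 hik
        (f := fun z w => ∑ x ∈ T, ind (s z x) * ind (s w x))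
        fun z w => Finset.sum_nonneg fun x _ => mul_nonneg (ind_nonneg _) (ind_nonneg _)).trans
        (le_of_eq ?_)
      rw [hB]
      congr 1
      calc ∑ z ∈ T, ∑ w ∈ T, ∑ x ∈ T, ind (s z x) * ind (s w x)
          = ∑ x ∈ T, (∑ z ∈ T, ind (s z x)) * ∑ w ∈ T, ind (s w x) := by
            simp only [Finset.sum_mul_sum]
            rw [Finset.sum_comm' (t' := T) (s' := fun _ => T) (by tauto)]
            rw [Finset.sum_comm]
            rw [Finset.sum_congr rfl fun z _ => Finset.sum_comm]
            rw [Finset.sum_comm]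
        _ = T.card * K ^ 2 := by
            rw [Finset.sum_congr rfl fun x hx => by rw [hK2 x hx]]
            rw [Finset.sum_const, nsmul_eq_mul]
            ring
  rw [ens_sum]
  simp only [ens_sum]
  calc _ ≤ ∑ i : Fin M, ∑ k : Fin M, ((if i = k then K else 0) + B) :=
        Finset.sum_le_sum fun i _ => Finset.sum_le_sum fun k _ => by
          simpa only [ens_sum] using hpair i k
    _ = _ := by
        simp [Finset.sum_add_distrib]
        ring

include hT hb hb0 hθ0 hθ1 hK1 hK2 in
lemma ens_pairCount_sq_le (hθ : M * b ≤ θ) :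
    ens T ok M (fun c => pairCount s c ^ 2) ≤
      (1 + 2 * θ) ^ 2 * (K / T.card) ^ 2 * (M * (M - 1) / 2) ^ 2 +
      (1 + 2 * θ) * (K / T.card) * (M * (M - 1) / 2) +
      (1 + 2 * θ) ^ 3 * (K / T.card) ^ 2 * M ^ 3 := by
  have hT0 : (0 : ℝ) < T.card := by exact_mod_cast hT.card_pos
  have hK0 : 0 ≤ K := by
    obtain ⟨x, hx⟩ := hT
    rw [← hK1 x hx]
    exact Finset.sum_nonneg fun i _ => ind_nonneg _
  induction M with
  | zero => simp [ens_zero, pairCount]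
  | succ M ih =>
    have hle : (M : ℝ) * b ≤ θ := by push_cast at hθ; nlinarith
    rw [ens_succ]
    have h1 : ens T ok M (fun c => avg (adm T ok c) fun x => pairCount s (Fin.snoc c x) ^ 2) ≤
        ens T ok M (fun c => pairCount s c ^ 2 +
          (2 * ((1 + 2 * θ) * (K / T.card) * M) * pairCount s c +
          (1 + 2 * θ) / T.card *
            ∑ i, ∑ k, ∑ x ∈ T, ind (s (c i) x) * ind (s (c k) x))) := by
      refine ens_mono_of_wt fun c hc => ?_
      have h2 : ∀ x, pairCount s (Fin.snoc c x : Fin (M + 1) → A) ^ 2 =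
          pairCount s c ^ 2 + ((2 * pairCount s c) * ∑ i, ind (s (c i) x) +
            (∑ i, ind (s (c i) x)) ^ 2) := by
        intro x
        rw [pairCount_snoc]
        ring
      simp only [h2]
      rw [avg_add, avg_add, avg_const_mul]
      refine add_le_add (avg_const_le _ (sq_nonneg _)) (add_le_add ?_ ?_)
      · have := mul_le_mul_of_nonneg_left (avg_degree_le hT hb hθ0 hθ1 hK1 hle hc)
          (mul_nonneg zero_le_two (pairCount_nonneg (s := s) c))
        linarith
      · refine (avg_adm_le hT hb c hle hθ0 hθ1 fun x _ => sq_nonneg _).trans (le_of_eq ?_)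
        congr 1
        simp only [sq, Finset.sum_mul_sum]
        rw [Finset.sum_comm]
        refine Finset.sum_congr rfl fun i _ => ?_
        rw [Finset.sum_comm]
    refine h1.trans ?_
    rw [ens_add, ens_add, ens_const_mul, ens_const_mul]
    have h3 := ih hle
    have h4 := mul_le_mul_of_nonneg_left
      (ens_pairCount_le (s := s) hT hb hb0 hθ0 hθ1 hK1 hle)
      (by positivity : 0 ≤ 2 * ((1 + 2 * θ) * (K / T.card) * M))
    have h5 := mul_le_mul_of_nonneg_left
      (ens_sum_codegree_le hT hb hb0 hθ0 hθ1 hK1 hK2 hle)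
      (by positivity : 0 ≤ (1 + 2 * θ) / (T.card : ℝ))
    have h6 : (1 + 2 * θ) / (T.card : ℝ) *
        (M * K + M ^ 2 * (((1 + 2 * θ) / T.card) ^ 2 * (T.card * K ^ 2))) =
        (1 + 2 * θ) * (K / T.card) * M + (1 + 2 * θ) ^ 3 * (K / T.card) ^ 2 * M ^ 2 := by
      field_simp
    rw [h6] at h5
    set q := K / (T.card : ℝ)
    have hq0 : 0 ≤ q := by positivity
    set a := 1 + 2 * θ
    have ha0 : 0 ≤ a := by positivity
    have hM0 : (0 : ℝ) ≤ M := by positivity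
    push_cast
    have h7 : 0 ≤ a ^ 3 * q ^ 2 * (2 * M ^ 2 + 3 * M + 1) := by positivity
    have h8 : 0 ≤ a ^ 2 * q ^ 2 * (M : ℝ) ^ 2 := by positivity
    nlinarith

include hT hb hb0 hθ0 hθ1 hK1 in
lemma le_ens_pairCount (hsym : ∀ x z, ok x z → ok z x) (hs : ∀ x z, s x z → ok x z)
    (hθ : M * b ≤ θ) :
    (K / T.card) * (1 - 4 * θ) * (M * (M - 1) / 2) ≤ ens T ok M (pairCount s) := by
  have hT0 : (0 : ℝ) < T.card := by exact_mod_cast hT.card_pos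
  have hK0 : 0 ≤ K := by
    obtain ⟨x, hx⟩ := hT
    rw [← hK1 x hx]
    exact Finset.sum_nonneg fun i _ => ind_nonneg _
  induction M with
  | zero => simp [ens_zero, pairCount]
  | succ M ih =>
    have hle : (M : ℝ) * b ≤ θ := by push_cast at hθ; nlinarith
    rw [ens_succ]
    set D : A → A → ℝ := fun z w => ∑ x ∈ T, ind (s z x) * ind (¬ ok x w) with hD
    have hD0 : ∀ z w, 0 ≤ D z w := fun z w =>
      Finset.sum_nonneg fun x _ => mul_nonneg (ind_nonneg _) (ind_nonneg _)
    have hpair : ∀ i k : Fin M, ens T ok M (fun c => D (c i) (c k)) ≤ 4 * K * b := by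
      intro i k
      by_cases hik : i = k
      · subst hik
        have : ens T ok M (fun c => D (c i) (c i)) = ens T ok M (fun c => 0 * 1) := by
          congr 1
          funext c
          rw [hD, zero_mul]
          refine Finset.sum_eq_zero fun x _ => ?_
          by_cases h : s (c i) x
          · rw [ind_of_not (p := ¬ ok x (c i)) (not_not.2 (hsym _ _ (hs _ _ h))), mul_zero]
          · rw [ind_of_not h, zero_mul]
        rw [this, ens_const_mul, zero_mul]
        positivity
      · refine (ens_pair_le hT hb hb0 hle hθ0 hθ1 hik hD0).trans ?_
        have h1 : ∑ z ∈ T, ∑ w ∈ T, D z w ≤ T.card * (K * (b * T.card)) := by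
          calc ∑ z ∈ T, ∑ w ∈ T, D z w
              = ∑ z ∈ T, ∑ x ∈ T, ind (s z x) * ∑ w ∈ T, ind (¬ ok x w) := by
                refine Finset.sum_congr rfl fun z _ => ?_
                rw [hD, Finset.sum_comm]
                simp only [Finset.mul_sum]
            _ ≤ ∑ z ∈ T, ∑ x ∈ T, ind (s z x) * (b * T.card) := by
                refine Finset.sum_le_sum fun z _ => Finset.sum_le_sum fun x _ =>
                  mul_le_mul_of_nonneg_left ?_ (ind_nonneg _)
                rw [sum_ind_eq_card]
                refine le_trans (le_of_eq ?_) (hb x)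
                congr 2
                ext w
                simp only [Finset.mem_filter]
                exact and_congr_right fun _ =>
                  ⟨fun h h' => h (hsym _ _ h'), fun h h' => h (hsym _ _ h')⟩
            _ = _ := by
                simp only [← Finset.sum_mul]
                rw [Finset.sum_congr rfl fun z hz => hK1 z hz]
                simp
                ring
        calc _ ≤ ((1 + 2 * θ) / (T.card : ℝ)) ^ 2 * (T.card * (K * (b * T.card))) :=
              mul_le_mul_of_nonneg_left h1 (by positivity)
          _ = (1 + 2 * θ) ^ 2 * (K * b) := by field_simp
          _ ≤ 4 * (K * b) := by
              refine mul_le_mul_of_nonneg_right ?_ (by positivity)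
              nlinarith
          _ = _ := by ring
    have h1 : ens T ok M (fun c => pairCount s c + (T.card : ℝ)⁻¹ *
        (M * K * 1 - ∑ i, ∑ k, D (c i) (c k))) ≤
        ens T ok M (fun c => avg (adm T ok c) fun x => pairCount s (Fin.snoc c x)) := by
      refine ens_mono_of_wt fun c hc => ?_
      have hne := adm_nonempty hT hb c hle hθ1
      simp only [pairCount_snoc]
      rw [avg_add, avg_const hne]
      refine add_le_add le_rfl ?_
      have hadm0 : (0 : ℝ) < (adm T ok c).card := by exact_mod_cast hne.card_pos
      have hadm : ((adm T ok c).card : ℝ) ≤ T.card := by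
        exact_mod_cast Finset.card_le_card (adm_subset c)
      have h2 : (M * K * 1 - ∑ i, ∑ k, D (c i) (c k)) ≤
          ∑ x ∈ adm T ok c, ∑ i, ind (s (c i) x) := by
        rw [Finset.sum_comm (s := adm T ok c)]
        have h3 : (M : ℝ) * K * 1 = ∑ i : Fin M, K := by simp
        rw [h3, ← Finset.sum_sub_distrib]
        refine Finset.sum_le_sum fun i _ => ?_
        rw [← hK1 _ (mem_of_wt_ne_zero hc i), hD]
        dsimp only
        rw [Finset.sum_comm, ← Finset.sum_sub_distrib]
        unfold adm
        rw [Finset.sum_filter]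
        refine Finset.sum_le_sum fun x _ => ?_
        have hnn : 0 ≤ ∑ k, ind (s (c i) x) * ind (¬ ok x (c k)) :=
          Finset.sum_nonneg fun k _ => mul_nonneg (ind_nonneg _) (ind_nonneg _)
        split_ifs with h
        · linarith
        · push Not at h
          obtain ⟨k, hk⟩ := h
          have := Finset.single_le_sum (f := fun k => ind (s (c i) x) * ind (¬ ok x (c k)))
            (fun k _ => mul_nonneg (ind_nonneg _) (ind_nonneg _)) (Finset.mem_univ k)
          rw [ind_of hk, mul_one] at this
          linarith
      have h4 : 0 ≤ ∑ x ∈ adm T ok c, ∑ i, ind (s (c i) x) :=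
        Finset.sum_nonneg fun x _ => Finset.sum_nonneg fun i _ => ind_nonneg _
      unfold avg
      calc _ ≤ (T.card : ℝ)⁻¹ * ∑ x ∈ adm T ok c, ∑ i, ind (s (c i) x) :=
            mul_le_mul_of_nonneg_left h2 (by positivity)
        _ ≤ _ := mul_le_mul_of_nonneg_right (inv_anti₀ hadm0 hadm) h4
    refine le_trans ?_ h1
    rw [ens_add, ens_const_mul, ens_sub, ens_const_mul]
    rw [ens_one hT hb hb0 (hle.trans hθ1)]
    have h5 : ens T ok M (fun c => ∑ i, ∑ k, D (c i) (c k)) ≤ M * (M * (4 * K * b)) := by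
      rw [ens_sum]
      simp only [ens_sum]
      refine (Finset.sum_le_sum fun i _ => Finset.sum_le_sum fun k _ => hpair i k).trans
        (le_of_eq ?_)
      simp
    have h6 := ih hle
    have h7 : (T.card : ℝ)⁻¹ * (M * K * 1 - M * (K * (4 * θ))) ≤
        (T.card : ℝ)⁻¹ * (M * K * 1 - ens T ok M (fun c => ∑ i, ∑ k, D (c i) (c k))) := by
      refine mul_le_mul_of_nonneg_left ?_ (by positivity)
      have : (M : ℝ) * (M * (4 * K * b)) ≤ M * (K * (4 * θ)) := by
        refine mul_le_mul_of_nonneg_left ?_ (by positivity)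
        nlinarith [mul_le_mul_of_nonneg_left hle hK0]
      linarith
    have h8 : (T.card : ℝ)⁻¹ * (M * K * 1 - M * (K * (4 * θ))) =
        K / T.card * (1 - 4 * θ) * M := by
      field_simp
    push_cast
    linarith

include hT hb hb0 hθ0 hθ1 hK1 hK2 in
/-- The number of related pairs is rarely below half of its nominal mean. -/
lemma pr_pairCount_lt_le (hsym : ∀ x z, ok x z → ok z x) (hs : ∀ x z, s x z → ok x z)
    (hθ : M * b ≤ θ) (hM : 2 ≤ M) (hK : 0 < K) :
    pr T ok M (fun c => pairCount s c < K / T.card * M ^ 2 / 8) ≤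
      56 * θ + 32 / (K / T.card * M ^ 2) + 512 / M := by
  have hT0 : (0 : ℝ) < T.card := by exact_mod_cast hT.card_pos
  have h1 := ens_pairCount_sq_le (s := s) hT hb hb0 hθ0 hθ1 hK1 hK2 hθ
  have h2 := le_ens_pairCount (s := s) hT hb hb0 hθ0 hθ1 hK1 hsym hs hθ
  set q := K / (T.card : ℝ)
  have hq0 : 0 < q := by positivity
  set V : ℝ := M * (M - 1) / 2 with hV
  have hM2 : (2 : ℝ) ≤ M := by exact_mod_cast hM
  have hVM : (M : ℝ) ^ 2 / 4 ≤ V := by rw [hV]; nlinarith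
  have hV0 : 0 < V := lt_of_lt_of_le (by positivity) hVM
  have h3 : ens T ok M (fun c => (pairCount s c - V * q) ^ 2) ≤
      14 * θ * (V * q) ^ 2 + 2 * (q * V) + 8 * q ^ 2 * M ^ 3 := by
    have : (fun c : Fin M → A => (pairCount s c - V * q) ^ 2) =
        fun c => pairCount s c ^ 2 - ((2 * (V * q)) * pairCount s c - (V * q) ^ 2 * 1) := by
      funext c
      ring
    rw [this, ens_sub, ens_sub, ens_const_mul, ens_const_mul, ens_one hT hb hb0 (hθ.trans hθ1)]
    have h4 := mul_le_mul_of_nonneg_left h2 (by positivity : 0 ≤ 2 * (V * q))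
    have h5 : (1 + 2 * θ) ^ 2 * q ^ 2 * V ^ 2 ≤ (1 + 6 * θ) * (q ^ 2 * V ^ 2) := by
      rw [mul_assoc]
      refine mul_le_mul_of_nonneg_right ?_ (by positivity)
      nlinarith
    have h6 : (1 + 2 * θ) * q * V ≤ 2 * (q * V) := by
      rw [mul_assoc]
      refine mul_le_mul_of_nonneg_right ?_ (by positivity)
      linarith
    have h7 : (1 + 2 * θ) ^ 3 * q ^ 2 * (M : ℝ) ^ 3 ≤ 8 * q ^ 2 * M ^ 3 := by
      have : (1 + 2 * θ) ^ 3 ≤ 2 ^ 3 := pow_le_pow_left₀ (by positivity) (by linarith) 3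
      gcongr
      linarith
    nlinarith
  refine (pr_le_of_le (f := fun c => (pairCount s c - V * q) ^ 2) (fun c => sq_nonneg _)
    (a := (V * q / 2) ^ 2) (by positivity) ?_).trans ?_
  · intro c _ hc
    have hlt : pairCount s c < V * q / 2 := by nlinarith
    have : 0 ≤ V * q / 2 := by positivity
    nlinarith
  · refine (mul_le_mul_of_nonneg_left h3 (by positivity)).trans ?_
    have e : ((V * q / 2) ^ 2)⁻¹ * (14 * θ * (V * q) ^ 2 + 2 * (q * V) + 8 * q ^ 2 * M ^ 3) =
        56 * θ + 8 / (q * V) + 32 * M ^ 3 / V ^ 2 := by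
      field_simp
      ring
    rw [e]
    have e1 : 8 / (q * V) ≤ 32 / (q * (M : ℝ) ^ 2) := by
      rw [div_le_div_iff₀ (by positivity) (by positivity)]
      nlinarith
    have e2 : 32 * (M : ℝ) ^ 3 / V ^ 2 ≤ 512 / M := by
      rw [div_le_div_iff₀ (by positivity) (by positivity)]
      have := pow_le_pow_left₀ (by positivity) hVM 2
      nlinarith
    linarith

end SecondMoment

/-- Shannon entropy (natural logarithm). -/
def ent {A : Type} [Fintype A] (P : A → ℝ) : ℝ := ∑ a, Real.negMulLog (P a)

section Types

variable {A B : Type} [Fintype A] [Fintype B] {n : ℕ}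

/-- Number of occurrences of a letter in a sequence. -/
def cnt (x : Fin n → A) (a : A) : ℕ := (Finset.univ.filter fun i => x i = a).card

lemma emp_apply (x : Fin n → A) (a : A) : emp n x a = cnt x a / n := rfl

lemma sum_cnt (x : Fin n → A) : ∑ a, cnt x a = n := by
  have := Finset.card_eq_sum_card_fiberwise (f := x) (s := Finset.univ) (t := Finset.univ)
    (fun i _ => Finset.mem_univ _)
  simpa [cnt] using this.symm

omit [Fintype A] in
lemma cnt_le (x : Fin n → A) (a : A) : cnt x a ≤ n := by
  simpa [cnt] using Finset.card_le_univ (Finset.univ.filter fun i => x i = a)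

lemma emp_nonneg (x : Fin n → A) (a : A) : 0 ≤ emp n x a := by
  rw [emp_apply]; positivity

lemma emp_le_one (x : Fin n → A) (a : A) : emp n x a ≤ 1 := by
  rw [emp_apply]
  exact div_le_one_of_le₀ (by exact_mod_cast cnt_le x a) (by positivity)

lemma sum_emp (hn : 0 < n) (x : Fin n → A) : ∑ a, emp n x a = 1 := by
  simp only [emp_apply]
  rw [← Finset.sum_div, ← Nat.cast_sum, sum_cnt]
  exact div_self (by positivity)

lemma emp_pair (x : Fin n → A) (y : Fin n → B) : emp n (fun i => (x i, y i)) = emp2 n x y := by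
  funext p
  obtain ⟨a, b⟩ := p
  simp [emp, emp2, Prod.ext_iff]

lemma emp_comp (x : Fin n → A) (σ : Equiv.Perm (Fin n)) : emp n (x ∘ σ) = emp n x := by
  funext a
  rw [emp_apply, emp_apply]
  congr 2
  refine Finset.card_bij (fun i _ => σ i) ?_ ?_ ?_
  · intro i hi
    simpa using hi
  · intro i _ j _ h
    exact σ.injective h
  · intro j hj
    exact ⟨σ.symm j, by simpa using hj, by simp⟩

lemma emp2_comp (x : Fin n → A) (y : Fin n → B) (σ : Equiv.Perm (Fin n)) :
    emp2 n (x ∘ σ) (y ∘ σ) = emp2 n x y := by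
  rw [← emp_pair, ← emp_pair]
  exact emp_comp (fun i => (x i, y i)) σ

lemma cnt_eq_of_emp_eq (hn : 0 < n) {x z : Fin n → A} (h : emp n x = emp n z) (a : A) :
    cnt x a = cnt z a := by
  have := congrFun h a
  rw [emp_apply, emp_apply] at this
  have hn' : (n : ℝ) ≠ 0 := by positivity
  field_simp at this
  exact_mod_cast this

lemma exists_perm_of_emp_eq (hn : 0 < n) {x z : Fin n → A} (h : emp n x = emp n z) :
    ∃ σ : Equiv.Perm (Fin n), x = z ∘ σ := by
  have e : ∀ a, Nonempty ({i // x i = a} ≃ {i // z i = a}) := by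
    intro a
    refine ⟨Fintype.equivOfCardEq ?_⟩
    rw [Fintype.card_subtype, Fintype.card_subtype]
    exact cnt_eq_of_emp_eq hn h a
  let f := fun a => (e a).some
  refine ⟨Equiv.ofFiberEquiv f, ?_⟩
  funext i
  exact (Equiv.ofFiberEquiv_map f i).symm

lemma mem_typeClass {x : Fin n → A} {P : A → ℝ} : x ∈ typeClass n P ↔ emp n x = P := by
  simp [typeClass]

lemma self_mem_typeClass (x : Fin n → A) : x ∈ typeClass n (emp n x) := mem_typeClass.2 rfl

lemma prod_emp_eq (x : Fin n → A) : ∏ i, emp n x (x i) = ∏ a, emp n x a ^ cnt x a := by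
  rw [← Finset.prod_fiberwise (s := Finset.univ) (g := x)]
  refine Finset.prod_congr rfl fun a _ => ?_
  rw [Finset.prod_congr rfl (g := fun _ => emp n x a) (by
    intro i hi
    simp only [Finset.mem_filter, Finset.mem_univ, true_and] at hi
    rw [hi])]
  rw [Finset.prod_const]
  rfl

lemma prod_emp (x : Fin n → A) : ∏ i, emp n x (x i) = Real.exp (-(n * ent (emp n x))) := by
  rcases Nat.eq_zero_or_pos n with rfl | hn
  · simp
  rw [prod_emp_eq, ent, Finset.mul_sum, ← Finset.sum_neg_distrib, Real.exp_sum]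
  refine Finset.prod_congr rfl fun a _ => ?_
  have hn' : (n : ℝ) ≠ 0 := by positivity
  have h2 : (n : ℝ) * emp n x a = cnt x a := by rw [emp_apply]; field_simp
  rcases Nat.eq_zero_or_pos (cnt x a) with h0 | hpos
  · simp [emp_apply, h0]
  · have hp : 0 < emp n x a := by rw [emp_apply]; positivity
    rw [Real.negMulLog, show -((n : ℝ) * (-emp n x a * Real.log (emp n x a))) =
      (n * emp n x a) * Real.log (emp n x a) by ring, h2, mul_comm, Real.exp_mul,
      Real.exp_log hp, Real.rpow_natCast]

lemma card_typeClass_le (hn : 0 < n) (x : Fin n → A) :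
    ((typeClass n (emp n x)).card : ℝ) ≤ Real.exp (n * ent (emp n x)) := by
  have h1 : ∑ z : Fin n → A, ∏ i, emp n x (z i) = 1 := by
    have := Finset.prod_univ_sum (fun _ : Fin n => (Finset.univ : Finset A)) (fun _ a => emp n x a)
    simp only [sum_emp hn, Finset.prod_const_one, Fintype.piFinset_univ] at this
    exact this.symm
  have h2 : ∑ z ∈ typeClass n (emp n x), ∏ i, emp n x (z i) ≤ 1 := by
    rw [← h1]
    exact Finset.sum_le_sum_of_subset_of_nonneg (Finset.subset_univ _) fun z _ _ =>
      Finset.prod_nonneg fun i _ => emp_nonneg _ _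
  have h3 : ∀ z ∈ typeClass n (emp n x),
      ∏ i, emp n x (z i) = Real.exp (-(n * ent (emp n x))) := by
    intro z hz
    rw [← mem_typeClass.1 hz, prod_emp]
  rw [Finset.sum_congr rfl h3, Finset.sum_const, nsmul_eq_mul, Real.exp_neg] at h2
  have := Real.exp_pos (n * ent (emp n x))
  rwa [mul_inv_le_iff₀ this, one_mul] at h2

lemma factorial_le_card_mul (x : Fin n → A) :
    n.factorial ≤ (typeClass n (emp n x)).card * ∏ a, (cnt x a).factorial := by
  have h1 : (Finset.univ : Finset (Equiv.Perm (Fin n))).card = n.factorial := by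
    rw [Finset.card_univ, Fintype.card_perm, Fintype.card_fin]
  rw [← h1]
  have hst : Fintype.card {σ : Equiv.Perm (Fin n) // x ∘ σ = x} = ∏ a, (cnt x a).factorial := by
    rw [DomMulAct.stabilizer_card]
    refine Finset.prod_congr rfl fun a _ => ?_
    rw [Fintype.card_subtype]
    rfl
  rw [mul_comm]
  refine Finset.card_le_mul_card_image_of_maps_to (f := fun σ : Equiv.Perm (Fin n) => x ∘ σ) ?_ _ ?_
  · intro σ _
    exact mem_typeClass.2 (emp_comp x σ)
  · intro z _
    rw [← hst, ← Fintype.card_coe]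
    by_cases hne : Nonempty {σ : Equiv.Perm (Fin n) // x ∘ σ = z}
    · obtain ⟨σ₀, h₀⟩ := hne
      refine Fintype.card_le_of_injective
        (fun σ => ⟨σ.1 * σ₀⁻¹, ?_⟩) ?_
      · have hσ : x ∘ σ.1 = z := (Finset.mem_filter.1 σ.2).2
        funext i
        have h4 := congrFun (hσ.trans h₀.symm) (σ₀⁻¹ i)
        simpa using h4
      · intro σ τ h
        exact Subtype.ext (mul_right_cancel (Subtype.ext_iff.1 h))
    · rw [Fintype.card_eq_zero_iff.2]
      · exact Nat.zero_le _
      · exact ⟨fun σ => hne ⟨σ.1, (Finset.mem_filter.1 σ.2).2⟩⟩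

lemma pow_le_factorial_mul_exp (k : ℕ) : (k : ℝ) ^ k ≤ k.factorial * Real.exp k := by
  have := Real.pow_div_factorial_le_exp (k : ℝ) (by positivity) k
  rwa [div_le_iff₀ (by positivity), mul_comm] at this

lemma factorial_succ_mul_exp_le (k : ℕ) :
    ((k + 1).factorial : ℝ) * Real.exp (k + 1) ≤ Real.exp 1 * (k + 1) * (k + 1) ^ (k + 1) := by
  induction k with
  | zero => simp
  | succ k ih =>
    have h1 : Real.exp 1 ≤ (((k : ℝ) + 2) / (k + 1)) ^ (k + 2) := by
      have h2 : 1 / ((k : ℝ) + 2) ≤ Real.log ((k + 2) / (k + 1)) := by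
        have := Real.one_sub_inv_le_log_of_pos (x := ((k : ℝ) + 2) / (k + 1)) (by positivity)
        refine le_trans (le_of_eq ?_) this
        field_simp
        ring
      rw [← Real.exp_log (show 0 < ((k : ℝ) + 2) / (k + 1) by positivity), ← Real.exp_nat_mul]
      refine Real.exp_le_exp.2 ?_
      rw [div_le_iff₀ (by positivity)] at h2
      push_cast
      linarith
    rw [Nat.factorial_succ]
    push_cast
    rw [Real.exp_add]
    calc ((k : ℝ) + 1 + 1) * (k + 1).factorial * (Real.exp (k + 1) * Real.exp 1)
        = (k + 2) * Real.exp 1 * ((k + 1).factorial * Real.exp (k + 1)) := by ring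
      _ ≤ (k + 2) * (((k : ℝ) + 2) / (k + 1)) ^ (k + 2) *
          (Real.exp 1 * (k + 1) * (k + 1) ^ (k + 1)) := by gcongr
      _ = Real.exp 1 * (k + 1 + 1) * (k + 1 + 1) ^ (k + 1 + 1) := by
          rw [div_pow, show (k : ℝ) + 1 + 1 = k + 2 by ring,
            show ((k : ℝ) + 1) ^ (k + 2) = (k + 1) ^ (k + 1) * (k + 1) by ring]
          field_simp

lemma factorial_mul_exp_le (k : ℕ) :
    (k.factorial : ℝ) * Real.exp k ≤ Real.exp 1 * (k + 1) * k ^ k := by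
  cases k with
  | zero => simp [Real.one_le_exp zero_le_one]
  | succ k =>
    push_cast
    refine (factorial_succ_mul_exp_le k).trans ?_
    gcongr
    linarith

/-- The polynomial factor of the method of types. -/
def polyF (A : Type) [Fintype A] (n : ℕ) : ℝ := (Real.exp 1 * (n + 1)) ^ Fintype.card A

lemma polyF_pos : 0 < polyF A n := by unfold polyF; positivity

lemma le_card_typeClass (hn : 0 < n) (x : Fin n → A) :
    Real.exp (n * ent (emp n x)) ≤ polyF A n * (typeClass n (emp n x)).card := by
  have hn' : (0 : ℝ) < n := by exact_mod_cast hn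
  have h1 : (n.factorial : ℝ) ≤
      (typeClass n (emp n x)).card * ∏ a, ((cnt x a).factorial : ℝ) := by
    exact_mod_cast factorial_le_card_mul x
  have h2 : ∏ a, ((cnt x a).factorial : ℝ) * Real.exp (cnt x a) ≤
      ∏ a, (Real.exp 1 * (n + 1)) * ((cnt x a : ℝ) ^ cnt x a) := by
    refine Finset.prod_le_prod (fun a _ => by positivity) fun a _ => ?_
    refine (factorial_mul_exp_le _).trans ?_
    have : (cnt x a : ℝ) ≤ n := by exact_mod_cast cnt_le x a
    gcongr
  rw [Finset.prod_mul_distrib, Finset.prod_mul_distrib, ← Real.exp_sum, ← Nat.cast_sum,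
    sum_cnt, Finset.prod_const, Finset.card_univ] at h2
  have h3 : ∏ a, ((cnt x a : ℝ) ^ cnt x a) =
      n ^ n * Real.exp (-(n * ent (emp n x))) := by
    rw [← prod_emp]
    have h4 : ∏ i, emp n x (x i) = ∏ a, emp n x a ^ cnt x a := prod_emp_eq x
    rw [h4, show (n : ℝ) ^ n = ∏ a, (n : ℝ) ^ cnt x a by
      rw [Finset.prod_pow_eq_pow_sum, sum_cnt], ← Finset.prod_mul_distrib]
    refine Finset.prod_congr rfl fun a _ => ?_
    rw [← mul_pow, emp_apply]
    congr 1
    field_simp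
  rw [h3] at h2
  have h5 := pow_le_factorial_mul_exp n
  have h6 : (n : ℝ) ^ n ≤ (typeClass n (emp n x)).card *
      (polyF A n * (n ^ n * Real.exp (-(n * ent (emp n x))))) := by
    refine h5.trans ?_
    calc _ ≤ ((typeClass n (emp n x)).card * ∏ a, ((cnt x a).factorial : ℝ)) * Real.exp n := by
          gcongr
      _ = (typeClass n (emp n x)).card * ((∏ a, ((cnt x a).factorial : ℝ)) * Real.exp n) := by
          ring
      _ ≤ _ := by
          unfold polyF
          gcongr
  have h7 : (0 : ℝ) < n ^ n := by positivity
  rw [Real.exp_neg] at h6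
  have h8 := Real.exp_pos (n * ent (emp n x))
  have h9 : (n : ℝ) ^ n * Real.exp (n * ent (emp n x)) ≤
      n ^ n * (polyF A n * (typeClass n (emp n x)).card) := by
    calc _ ≤ ((typeClass n (emp n x)).card *
      (polyF A n * (n ^ n * (Real.exp (n * ent (emp n x)))⁻¹))) * Real.exp (n * ent (emp n x)) := by
          gcongr
      _ = _ := by field_simp
  exact le_of_mul_le_mul_left h9 h7

lemma sum_exp_neg_ent_le (hn : 0 < n) :
    ∑ z : Fin n → A, Real.exp (-(n * ent (emp n z))) ≤ polyF A n := by
  have hmaps : ∀ z ∈ (Finset.univ : Finset (Fin n → A)),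
      (fun z : Fin n → A => emp n z) z ∈ Finset.univ.image fun z : Fin n → A => emp n z :=
    fun z hz => Finset.mem_image_of_mem _ hz
  rw [← Finset.sum_fiberwise_of_maps_to hmaps]
  have h1 : ∀ P ∈ Finset.univ.image fun z : Fin n → A => emp n z,
      ∑ z ∈ (Finset.univ : Finset (Fin n → A)).filter (fun z => emp n z = P),
        Real.exp (-(n * ent (emp n z))) ≤ 1 := by
    intro P hP
    obtain ⟨x, -, rfl⟩ := Finset.mem_image.1 hP
    rw [Finset.sum_congr rfl (g := fun _ => Real.exp (-(n * ent (emp n x)))) (by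
      intro z hz
      rw [(Finset.mem_filter.1 hz).2])]
    rw [Finset.sum_const, nsmul_eq_mul, Real.exp_neg, mul_inv_le_iff₀ (Real.exp_pos _), one_mul]
    exact card_typeClass_le hn x
  refine (Finset.sum_le_sum h1).trans ?_
  rw [Finset.sum_const, nsmul_eq_mul, mul_one]
  have h2 : (Finset.univ.image fun z : Fin n → A => emp n z).card ≤ (n + 1) ^ Fintype.card A := by
    have h3 : (Finset.univ.image fun z : Fin n → A => emp n z) ⊆
        (Finset.univ : Finset (A → Fin (n + 1))).image fun k a => ((k a : ℕ) : ℝ) / n := by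
      intro P hP
      obtain ⟨x, -, rfl⟩ := Finset.mem_image.1 hP
      exact Finset.mem_image.2 ⟨fun a => ⟨cnt x a, Nat.lt_succ_of_le (cnt_le x a)⟩,
        Finset.mem_univ _, rfl⟩
    refine (Finset.card_le_card h3).trans (Finset.card_image_le.trans (le_of_eq ?_))
    simp
  calc _ ≤ (((n + 1) ^ Fintype.card A : ℕ) : ℝ) := by exact_mod_cast h2
    _ ≤ _ := by
      unfold polyF
      push_cast
      refine pow_le_pow_left₀ (by positivity) ?_ _
      nlinarith [Real.one_le_exp zero_le_one, Real.add_one_le_exp (1 : ℝ)]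

/-- A sum over the first sequence of a permutation invariant function depends on the second
sequence through its type only. -/
lemma card_mul_sum_eq (hn : 0 < n) {F : (Fin n → A) → (Fin n → B) → ℝ}
    (hF : ∀ x y (σ : Equiv.Perm (Fin n)), F (x ∘ σ) (y ∘ σ) = F x y) (y : Fin n → B) :
    ((typeClass n (emp n y)).card : ℝ) * ∑ x, F x y =
      ∑ y' ∈ typeClass n (emp n y), ∑ x, F x y' := by
  rw [← nsmul_eq_mul, ← Finset.sum_const]
  refine Finset.sum_congr rfl fun y' hy' => ?_
  obtain ⟨σ, rfl⟩ := exists_perm_of_emp_eq hn (mem_typeClass.1 hy')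
  refine Fintype.sum_equiv (Equiv.arrowCongr σ.symm (Equiv.refl A)) _ _ fun x => ?_
  rw [← hF x y σ]
  rfl

end Types

section Pairs

variable {A B : Type} [Fintype A] [Fintype B] {n : ℕ}

lemma eventually_polyF_le (A : Type) [Fintype A] {η : ℝ} (hη : 0 < η) :
    ∀ᶠ n : ℕ in atTop, polyF A n ≤ Real.exp (n * η) := by
  set k := Fintype.card A with hk
  have h1 := (isLittleO_pow_exp_pos_mul_atTop k hη).def
    (c := (Real.exp 1 ^ k * Real.exp η)⁻¹) (by positivity)
  have h2 : Tendsto (fun n : ℕ => (n : ℝ) + 1) atTop atTop :=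
    tendsto_atTop_add_const_right _ _ tendsto_natCast_atTop_atTop
  filter_upwards [h2.eventually h1] with n hn
  rw [Real.norm_of_nonneg (by positivity), Real.norm_of_nonneg (by positivity), mul_add, mul_one,
    Real.exp_add, inv_mul_eq_div, le_div_iff₀ (by positivity)] at hn
  unfold polyF
  rw [← hk, mul_pow, mul_comm (n : ℝ) η]
  have := Real.exp_pos η
  refine le_of_mul_le_mul_right ?_ this
  linarith

/-- First marginal. -/
def mL (P : A × B → ℝ) : A → ℝ := fun a => ∑ b, P (a, b)

/-- Second marginal. -/
def mR (P : A × B → ℝ) : B → ℝ := fun b => ∑ a, P (a, b)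

/-- Mutual information as a difference of entropies; continuous on the whole space. -/
def miE (P : A × B → ℝ) : ℝ := ent (mL P) + ent (mR P) - ent P

lemma continuous_ent : Continuous (ent : (A → ℝ) → ℝ) := by
  unfold ent
  fun_prop

omit [Fintype A] in
lemma continuous_mL : Continuous (mL : (A × B → ℝ) → A → ℝ) := by
  unfold mL
  fun_prop

omit [Fintype B] in
lemma continuous_mR : Continuous (mR : (A × B → ℝ) → B → ℝ) := by
  unfold mR
  fun_prop

lemma continuous_miE : Continuous (miE : (A × B → ℝ) → ℝ) :=
  ((continuous_ent.comp continuous_mL).add (continuous_ent.comp continuous_mR)).sub continuous_ent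

lemma mutInf_eq_miE {P : A × B → ℝ} (hP : ∀ p, 0 ≤ P p) : mutInf P = miE P := by
  have h1 : ent (mL P) = ∑ p : A × B, -(P p * Real.log (mL P p.1)) := by
    rw [Fintype.sum_prod_type]
    refine Finset.sum_congr rfl fun a _ => ?_
    rw [Finset.sum_neg_distrib, Real.negMulLog, neg_mul]
    congr 1
    exact Finset.sum_mul _ _ _
  have h2 : ent (mR P) = ∑ p : A × B, -(P p * Real.log (mR P p.2)) := by
    rw [Fintype.sum_prod_type_right]
    refine Finset.sum_congr rfl fun a _ => ?_
    rw [Finset.sum_neg_distrib, Real.negMulLog, neg_mul]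
    congr 1
    exact Finset.sum_mul _ _ _
  unfold miE
  rw [h1, h2, ent, ← Finset.sum_add_distrib, ← Finset.sum_sub_distrib]
  refine Finset.sum_congr rfl fun p _ => ?_
  obtain ⟨a, b⟩ := p
  rcases (hP (a, b)).eq_or_lt with h0 | hpos
  · simp [← h0]
  · have hL : 0 < mL P a := hpos.trans_le
      (Finset.single_le_sum (f := fun b => P (a, b)) (fun b _ => hP _) (Finset.mem_univ b))
    have hR : 0 < mR P b := hpos.trans_le
      (Finset.single_le_sum (f := fun a => P (a, b)) (fun a _ => hP _) (Finset.mem_univ a))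
    change P (a, b) * Real.log (P (a, b) / (mL P a * mR P b)) = _
    rw [Real.log_div hpos.ne' (by positivity), Real.log_mul hL.ne' hR.ne', Real.negMulLog]
    ring

lemma sum_fst_emp {C : Type} [Fintype C] (z : Fin n → C) (f : C → A) (a : A) :
    ∑ c with f c = a, emp n z c = emp n (fun i => f (z i)) a := by
  simp only [emp_apply]
  rw [← Finset.sum_div, ← Nat.cast_sum]
  congr 2
  unfold cnt
  rw [Finset.card_eq_sum_card_fiberwise (f := z) (t := Finset.univ.filter fun c => f c = a)]
  · refine Finset.sum_congr rfl fun c hc => ?_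
    congr 1
    ext i
    simp only [Finset.mem_filter, Finset.mem_univ, true_and] at hc ⊢
    exact ⟨fun h => ⟨by rw [h, hc], h⟩, fun h => h.2⟩
  · intro i hi
    simpa using hi

lemma mL_emp2 (x : Fin n → A) (y : Fin n → B) : mL (emp2 n x y) = emp n x := by
  funext a
  have := sum_fst_emp (fun i => (x i, y i)) Prod.fst a
  rw [emp_pair] at this
  rw [← this, mL, Finset.sum_filter, Fintype.sum_prod_type_right]
  simp

lemma mR_emp2 (x : Fin n → A) (y : Fin n → B) : mR (emp2 n x y) = emp n y := by
  funext a
  have := sum_fst_emp (fun i => (x i, y i)) Prod.snd a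
  rw [emp_pair] at this
  rw [← this, mR, Finset.sum_filter, Fintype.sum_prod_type]
  simp

lemma emp2_nonneg (x : Fin n → A) (y : Fin n → B) (p : A × B) : 0 ≤ emp2 n x y p := by
  rw [← emp_pair]; exact emp_nonneg _ _

lemma emp2_le_one (x : Fin n → A) (y : Fin n → B) (p : A × B) : emp2 n x y p ≤ 1 := by
  rw [← emp_pair]; exact emp_le_one _ _

lemma mutInf_emp2 (x : Fin n → A) (y : Fin n → B) :
    mutInf (emp2 n x y) = ent (emp n x) + ent (emp n y) - ent (emp2 n x y) := by
  rw [mutInf_eq_miE (emp2_nonneg x y), miE, mL_emp2, mR_emp2]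

lemma emp2_swap (x : Fin n → A) (y : Fin n → B) :
    emp2 n y x = fun p => emp2 n x y (p.2, p.1) := by
  funext p
  simp only [emp2, and_comm]

lemma mutInf_emp2_comm (x : Fin n → A) (y : Fin n → B) :
    mutInf (emp2 n x y) = mutInf (emp2 n y x) := by
  rw [mutInf_emp2, mutInf_emp2, emp2_swap x y]
  have : ent (fun p : B × A => emp2 n x y (p.2, p.1)) = ent (emp2 n x y) := by
    unfold ent
    exact Fintype.sum_equiv (Equiv.prodComm B A) _ _ fun p => rfl
  rw [this]
  ring

/-- The polynomial factor for pairs of sequences. -/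
def polyF2 (A B : Type) [Fintype A] [Fintype B] (n : ℕ) : ℝ :=
  polyF (A × B) n * (polyF A n * polyF B n)

lemma polyF2_pos (A B : Type) [Fintype A] [Fintype B] (n : ℕ) : 0 < polyF2 A B n := by
  unfold polyF2
  have := polyF_pos (A := A) (n := n)
  have := polyF_pos (A := B) (n := n)
  have := polyF_pos (A := A × B) (n := n)
  positivity

lemma eventually_polyF2_le (A B : Type) [Fintype A] [Fintype B] {η : ℝ} (hη : 0 < η) :
    ∀ᶠ n : ℕ in atTop, polyF2 A B n ≤ Real.exp (n * η) := by
  filter_upwards [eventually_polyF_le (A × B) (η := η / 3) (by positivity),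
    eventually_polyF_le A (η := η / 3) (by positivity),
    eventually_polyF_le B (η := η / 3) (by positivity)] with n h1 h2 h3
  have h4 : Real.exp (n * η) =
      Real.exp (n * (η / 3)) * (Real.exp (n * (η / 3)) * Real.exp (n * (η / 3))) := by
    rw [← Real.exp_add, ← Real.exp_add]
    congr 1
    ring
  rw [h4]
  unfold polyF2
  have := polyF_pos (A := A) (n := n)
  have := polyF_pos (A := B) (n := n)
  gcongr

lemma sum_exp_mutInf_le (hn : 0 < n) {Q : A → ℝ} (hQ : (typeClass n Q).Nonempty)
    (y : Fin n → B) :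
    ∑ x ∈ typeClass n Q, Real.exp (n * mutInf (emp2 n x y)) ≤
      polyF2 A B n * (typeClass n Q).card := by
  obtain ⟨x₀, hx₀⟩ := hQ
  have hT := mem_typeClass.1 hx₀
  have h1 : ∑ x ∈ typeClass n Q, Real.exp (n * mutInf (emp2 n x y)) ≤
      Real.exp (n * ent Q) * Real.exp (n * ent (emp n y)) *
        ∑ x : Fin n → A, Real.exp (-(n * ent (emp2 n x y))) := by
    rw [Finset.mul_sum]
    refine le_trans (le_of_eq ?_) (Finset.sum_le_sum_of_subset_of_nonneg
      (Finset.subset_univ (typeClass n Q)) fun x _ _ => by positivity)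
    refine Finset.sum_congr rfl fun x hx => ?_
    rw [mutInf_emp2, mem_typeClass.1 hx, ← Real.exp_add, ← Real.exp_add]
    congr 1
    ring
  have h2 := card_mul_sum_eq (A := A) hn
    (F := fun x y => Real.exp (-(n * ent (emp2 n x y))))
    (fun x y σ => by simp only [emp2_comp]) y
  have h3 : ∑ y' ∈ typeClass n (emp n y), ∑ x : Fin n → A, Real.exp (-(n * ent (emp2 n x y'))) ≤
      polyF (A × B) n := by
    refine le_trans ?_ (sum_exp_neg_ent_le (A := A × B) hn)
    refine (Finset.sum_le_sum_of_subset_of_nonneg (Finset.subset_univ _) fun y _ _ =>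
      Finset.sum_nonneg fun x _ => by positivity).trans (le_of_eq ?_)
    rw [Finset.sum_comm, ← Fintype.sum_prod_type']
    refine Fintype.sum_equiv (Equiv.arrowProdEquivProdArrow (Fin n) (fun _ => A) (fun _ => B)).symm
      _ _ fun p => ?_
    rw [← emp_pair]
    rfl
  rw [← h2] at h3
  set S := ∑ x : Fin n → A, Real.exp (-(n * ent (emp2 n x y)))
  have hS : 0 ≤ S := Finset.sum_nonneg fun x _ => by positivity
  have h4 := le_card_typeClass hn y
  have h5 := le_card_typeClass hn x₀
  rw [hT] at h5
  have hp1 := polyF_pos (A := A) (n := n)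
  have hp2 := polyF_pos (A := B) (n := n)
  calc _ ≤ Real.exp (n * ent Q) * Real.exp (n * ent (emp n y)) * S := h1
    _ ≤ (polyF A n * (typeClass n Q).card) *
        (polyF B n * (typeClass n (emp n y)).card) * S := by gcongr
    _ = (polyF A n * (typeClass n Q).card) * polyF B n *
        ((typeClass n (emp n y)).card * S) := by ring
    _ ≤ (polyF A n * (typeClass n Q).card) * polyF B n * polyF (A × B) n := by gcongr
    _ = _ := by unfold polyF2; ring

/-- Counting the sequences with a given joint type with a fixed sequence. -/
lemma sum_ind_emp2_mul_card (hn : 0 < n) (x₀ : Fin n → A) (y : Fin n → B) :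
    (∑ x : Fin n → A, ind (emp2 n x y = emp2 n x₀ y)) * (typeClass n (emp n y)).card =
      (typeClass n (emp2 n x₀ y)).card := by
  rw [mul_comm, card_mul_sum_eq (A := A) hn
    (F := fun x z => ind (emp2 n x z = emp2 n x₀ y)) (fun x y σ => by simp only [emp2_comp]) y]
  have h1 : ∑ y' ∈ typeClass n (emp n y), ∑ x : Fin n → A, ind (emp2 n x y' = emp2 n x₀ y) =
      ∑ y' : Fin n → B, ∑ x : Fin n → A, ind (emp2 n x y' = emp2 n x₀ y) := by
    refine Finset.sum_subset (Finset.subset_univ _) fun y' _ hy' => ?_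
    refine Finset.sum_eq_zero fun x _ => ind_of_not fun h => hy' (mem_typeClass.2 ?_)
    rw [← mR_emp2 x y', h, mR_emp2]
  rw [h1, Finset.sum_comm, ← Fintype.sum_prod_type', typeClass, ← sum_ind_eq_card]
  refine Fintype.sum_equiv (Equiv.arrowProdEquivProdArrow (Fin n) (fun _ => A) (fun _ => B)).symm
    _ _ fun p => ?_
  rw [← emp_pair]
  rfl

lemma le_sum_ind_emp2 (hn : 0 < n) (x₀ : Fin n → A) (y : Fin n → B) :
    Real.exp (-(n * mutInf (emp2 n x₀ y))) * (typeClass n (emp n x₀)).card ≤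
      polyF (A × B) n * ∑ x : Fin n → A, ind (emp2 n x y = emp2 n x₀ y) := by
  have h1 := sum_ind_emp2_mul_card hn x₀ y
  have h2 := card_typeClass_le hn x₀
  have h3 := card_typeClass_le hn y
  have h4 := le_card_typeClass hn (fun i => (x₀ i, y i))
  rw [emp_pair, ← h1] at h4
  set N := ∑ x : Fin n → A, ind (emp2 n x y = emp2 n x₀ y)
  have hN : 0 ≤ N := Finset.sum_nonneg fun x _ => ind_nonneg _
  have hp := polyF_pos (A := A × B) (n := n)
  calc _ ≤ Real.exp (-(n * mutInf (emp2 n x₀ y))) * Real.exp (n * ent (emp n x₀)) := by gcongr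
    _ = Real.exp (n * ent (emp2 n x₀ y)) * (Real.exp (n * ent (emp n y)))⁻¹ := by
      rw [← Real.exp_neg, ← Real.exp_add, ← Real.exp_add, mutInf_emp2]
      congr 1
      ring
    _ ≤ (polyF (A × B) n * (N * (typeClass n (emp n y)).card)) *
        (Real.exp (n * ent (emp n y)))⁻¹ := by gcongr
    _ ≤ (polyF (A × B) n * (N * Real.exp (n * ent (emp n y)))) *
        (Real.exp (n * ent (emp n y)))⁻¹ := by gcongr
    _ = _ := by field_simp

end Pairs

section Rounding

variable {A B C : Type} [Fintype A] [Fintype B] [Fintype C] {n : ℕ}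

/-- Pushforward of a mass function. -/
def push (f : C → A) (P : C → ℝ) : A → ℝ := fun a => ∑ c with f c = a, P c

lemma push_emp (f : C → A) (z : Fin n → C) : push f (emp n z) = emp n (fun i => f (z i)) :=
  funext fun a => sum_fst_emp z f a

omit [Fintype A] in
lemma continuous_push (f : C → A) : Continuous (push f) := by
  unfold push
  fun_prop

lemma sum_push (f : C → A) (P : C → ℝ) : ∑ a, push f P a = ∑ c, P c :=
  Finset.sum_fiberwise _ _ _

lemma le_one_of_sum {P : C → ℝ} (hP : ∀ c, 0 ≤ P c) (h1 : ∑ c, P c = 1) (c : C) : P c ≤ 1 := by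
  rw [← h1]
  exact Finset.single_le_sum (fun c _ => hP c) (Finset.mem_univ c)

omit [Fintype A] in
lemma exists_embedding_of_card_fiber_le {S : Type} [Fintype S] (z : Fin n → A) (h : S → A)
    (hc : ∀ a, (Finset.univ.filter fun s => h s = a).card ≤ cnt z a) :
    ∃ e : S ↪ Fin n, ∀ s, z (e s) = h s := by
  have key : ∀ a, Nonempty ({s // h s = a} ↪ {i // z i = a}) := by
    intro a
    refine Function.Embedding.nonempty_of_card_le ?_
    rw [Fintype.card_subtype, Fintype.card_subtype]
    exact hc a
  let φ := fun a => (key a).some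
  have hφ : ∀ (s : S) (a : A) (p : h s = a), (φ (h s) ⟨s, rfl⟩ : Fin n) = φ a ⟨s, p⟩ := by
    intro s a p
    subst p
    rfl
  have hz : ∀ s, z (φ (h s) ⟨s, rfl⟩ : Fin n) = h s := fun s => (φ (h s) ⟨s, rfl⟩).2
  refine ⟨⟨fun s => (φ (h s) ⟨s, rfl⟩ : Fin n), ?_⟩, hz⟩
  intro s t hst
  have h1 : h s = h t := by
    rw [← hz s, ← hz t]
    exact congrArg z hst
  dsimp only at hst
  rw [hφ s (h t) h1] at hst
  have := (φ (h t)).injective (Subtype.ext hst)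
  exact congrArg Subtype.val this

omit [Fintype A] [Fintype B] in
/-- Aligning two sequences along prescribed letters. -/
lemma exists_align {S : Type} [Fintype S] (z₀ : Fin n → A) (z₁ : Fin n → B) (h₀ : S → A)
    (h₁ : S → B) (hc₀ : ∀ a, (Finset.univ.filter fun s => h₀ s = a).card ≤ cnt z₀ a)
    (hc₁ : ∀ a, (Finset.univ.filter fun s => h₁ s = a).card ≤ cnt z₁ a) :
    ∃ (e : S ↪ Fin n) (σ : Equiv.Perm (Fin n)), ∀ s, z₀ (e s) = h₀ s ∧ z₁ (σ (e s)) = h₁ s := by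
  obtain ⟨e₀, he₀⟩ := exists_embedding_of_card_fiber_le z₀ h₀ hc₀
  obtain ⟨e₁, he₁⟩ := exists_embedding_of_card_fiber_le z₁ h₁ hc₁
  let ψ : {i // i ∈ Set.range e₀} ≃ {i // i ∈ Set.range e₁} :=
    (Equiv.ofInjective e₀ e₀.injective).symm.trans (Equiv.ofInjective e₁ e₁.injective)
  refine ⟨e₀, ψ.extendSubtype, fun s => ⟨he₀ s, ?_⟩⟩
  rw [Equiv.extendSubtype_apply_of_mem ψ (e₀ s) ⟨s, rfl⟩]
  have : ψ ⟨e₀ s, ⟨s, rfl⟩⟩ = ⟨e₁ s, ⟨s, rfl⟩⟩ := by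
    have h2 : (Equiv.ofInjective e₀ e₀.injective).symm ⟨e₀ s, ⟨s, rfl⟩⟩ = s :=
      Equiv.ofInjective_symm_apply e₀.injective s
    simp only [ψ, Equiv.trans_apply, h2]
    rfl
  rw [this]
  exact he₁ s

omit [Fintype A] in
lemma card_sigma_filter (k : C → ℕ) (f : C → A) (a : A) :
    (Finset.univ.filter fun s : Σ c, Fin (k c) => f s.1 = a).card = ∑ c with f c = a, k c := by
  rw [Finset.card_filter, Fintype.sum_sigma, Finset.sum_filter]
  refine Finset.sum_congr rfl fun c _ => ?_
  split_ifs <;> simp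

lemma card_sigma_floor_le (hn : 0 < n) {P : C → ℝ} (hP : ∀ c, 0 ≤ P c) (f : C → A)
    (z : Fin n → A) (h : push f P = emp n z) (a : A) :
    (Finset.univ.filter fun s : Σ c, Fin ⌊n * P c⌋₊ => f s.1 = a).card ≤ cnt z a := by
  have hn' : (0 : ℝ) < n := by exact_mod_cast hn
  rw [card_sigma_filter]
  have h1 : (n : ℝ) * push f P a = cnt z a := by
    rw [h, emp_apply]
    field_simp
  have h2 : (∑ c with f c = a, (⌊n * P c⌋₊ : ℝ)) ≤ cnt z a := by
    rw [← h1, push, Finset.mul_sum]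
    exact Finset.sum_le_sum fun c _ => Nat.floor_le (mul_nonneg hn'.le (hP c))
  exact_mod_cast h2

/-- A sequence containing `⌊n P⌋` copies of every letter is close to `P` in type. -/
lemma abs_emp_sub_le (hn : 0 < n) {P : C → ℝ} (h1 : ∑ c, P c = 1)
    (e : (Σ c, Fin ⌊n * P c⌋₊) ↪ Fin n) (t : Fin n → C) (ht : ∀ s, t (e s) = s.1) (c : C) :
    |emp n t c - P c| ≤ Fintype.card C / n := by
  have hn' : (0 : ℝ) < n := by exact_mod_cast hn
  have hlow : ∀ c, P c - 1 / n ≤ emp n t c := by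
    intro c
    have h2 : ⌊n * P c⌋₊ ≤ cnt t c := by
      have := Finset.card_le_card_of_injOn (s := (Finset.univ : Finset (Fin ⌊n * P c⌋₊)))
        (t := Finset.univ.filter fun i => t i = c) (fun j => e ⟨c, j⟩)
        (by intro j _; simpa using ht ⟨c, j⟩)
        (by
          intro j _ j' _ hj
          have := e.injective hj
          simpa using this)
      simpa [cnt] using this
    have h3 : (n : ℝ) * P c < ⌊n * P c⌋₊ + 1 := Nat.lt_floor_add_one _
    have h4 : (⌊n * P c⌋₊ : ℝ) ≤ cnt t c := by exact_mod_cast h2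
    rw [emp_apply, le_div_iff₀ hn', sub_mul, one_div, inv_mul_cancel₀ hn'.ne']
    linarith
  have hC : (1 : ℝ) ≤ Fintype.card C := by
    exact_mod_cast Fintype.card_pos_iff.2 ⟨c⟩
  rw [abs_le]
  constructor
  · have h5 : 1 / (n : ℝ) ≤ Fintype.card C / n := by gcongr
    linarith [hlow c]
  · have h6 : ∑ c, (emp n t c - P c + 1 / n) = Fintype.card C / n := by
      rw [Finset.sum_add_distrib, Finset.sum_sub_distrib, h1, sum_emp hn]
      simp
      ring
    have h7 := Finset.single_le_sum (f := fun c => emp n t c - P c + 1 / n)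
      (fun c _ => by linarith [hlow c]) (Finset.mem_univ c)
    have : 0 < 1 / (n : ℝ) := by positivity
    linarith

lemma exists_emp2_near (hn : 0 < n) {P : A × B → ℝ} (hP : ∀ p, 0 ≤ P p) (h1 : ∑ p, P p = 1)
    {z : Fin n → A} {y : Fin n → B} (hL : push Prod.fst P = emp n z)
    (hR : push Prod.snd P = emp n y) :
    ∃ x, emp n x = emp n z ∧ ∀ p, |emp2 n x y p - P p| ≤ Fintype.card (A × B) / n := by
  obtain ⟨e, σ, he⟩ := exists_align (S := Σ c, Fin ⌊n * P c⌋₊) y z (fun s => s.1.2)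
    (fun s => s.1.1) (card_sigma_floor_le hn hP Prod.snd y hR)
    (card_sigma_floor_le hn hP Prod.fst z hL)
  refine ⟨z ∘ σ, emp_comp z σ, fun p => ?_⟩
  rw [← emp_pair]
  exact abs_emp_sub_le hn h1 e _ (fun s => Prod.ext (he s).2 (he s).1) p

lemma exists_emp3_near (hn : 0 < n) {P : (A × A) × B → ℝ} (hP : ∀ p, 0 ≤ P p)
    (h1 : ∑ p, P p = 1) {z : Fin n → A} (hX : push (fun c => c.1.1) P = emp n z)
    (hX' : push (fun c => c.1.2) P = emp n z) {W : A → B → ℝ}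
    (hW : ∀ a, ∃ b, W a b ≠ 0) (hPW : ∀ c, W c.1.1 c.2 = 0 → P c = 0) :
    ∃ (x x' : Fin n → A) (y : Fin n → B), emp n x = emp n z ∧ emp n x' = emp n z ∧
      (∀ i, W (x i) (y i) ≠ 0) ∧
      ∀ p, |emp n (fun i => ((x i, x' i), y i)) p - P p| ≤ Fintype.card ((A × A) × B) / n := by
  obtain ⟨e, σ, he⟩ := exists_align (S := Σ c, Fin ⌊n * P c⌋₊) z z (fun s => s.1.1.1)
    (fun s => s.1.1.2) (card_sigma_floor_le hn hP _ z hX) (card_sigma_floor_le hn hP _ z hX')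
  choose w hw using hW
  let y : Fin n → B := fun i => if h : ∃ s, e s = i then h.choose.1.2 else w (z i)
  have hy : ∀ s, y (e s) = s.1.2 := by
    intro s
    have h : ∃ s', e s' = e s := ⟨s, rfl⟩
    have h2 : h.choose = s := e.injective h.choose_spec
    simp only [y, dif_pos h, h2]
  refine ⟨z, z ∘ σ, y, rfl, emp_comp z σ, fun i => ?_, fun p => ?_⟩
  · by_cases h : ∃ s, e s = i
    · obtain ⟨s, rfl⟩ := h
      rw [hy, (he s).1]
      intro h0
      have h3 := hPW s.1 h0
      have h4 := s.2.2
      simp [h3] at h4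
    · simp only [y, dif_neg h]
      exact hw _
  · exact abs_emp_sub_le hn h1 e _ (fun s => Prod.ext (Prod.ext (he s).1 (he s).2) (hy s)) p

end Rounding

section Analysis

variable {A B C : Type} [Fintype A] [Fintype B] [Fintype C] {n : ℕ}

lemma push_fst (P : A × B → ℝ) : push Prod.fst P = mL P := by
  funext a
  rw [push, mL, Finset.sum_filter, Fintype.sum_prod_type_right]
  simp

lemma push_snd (P : A × B → ℝ) : push Prod.snd P = mR P := by
  funext a
  rw [push, mR, Finset.sum_filter, Fintype.sum_prod_type]
  simp

lemma exists_modulus {φ : (C → ℝ) → ℝ} (hφ : Continuous φ) {η : ℝ} (hη : 0 < η) :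
    ∃ r > 0, ∀ P ∈ Set.Icc (0 : C → ℝ) 1, ∀ P' ∈ Set.Icc (0 : C → ℝ) 1,
      (∀ c, |P c - P' c| ≤ r) → |φ P - φ P'| ≤ η := by
  have h1 := (isCompact_Icc (a := (0 : C → ℝ)) (b := 1)).uniformContinuousOn_of_continuous
    hφ.continuousOn
  rw [Metric.uniformContinuousOn_iff] at h1
  obtain ⟨r, hr, h2⟩ := h1 η hη
  refine ⟨r / 2, by positivity, fun P hP P' hP' h => ?_⟩
  have h3 : dist P P' ≤ r / 2 := (dist_pi_le_iff (by positivity)).2 fun c => h c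
  exact (h2 P hP P' hP' (by linarith)).le

lemma mem_Icc_of_dist {P : C → ℝ} (hP : ∀ c, 0 ≤ P c) (h1 : ∑ c, P c = 1) :
    P ∈ Set.Icc (0 : C → ℝ) 1 := ⟨hP, fun c => le_one_of_sum hP h1 c⟩

lemma emp_mem_Icc (z : Fin n → C) : emp n z ∈ Set.Icc (0 : C → ℝ) 1 :=
  ⟨emp_nonneg z, emp_le_one z⟩

lemma emp2_mem_Icc (x : Fin n → A) (y : Fin n → B) :
    emp2 n x y ∈ Set.Icc (0 : A × B → ℝ) 1 := ⟨emp2_nonneg x y, emp2_le_one x y⟩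

lemma sum_mL (P : A × B → ℝ) : ∑ a, mL P a = ∑ p, P p := (Fintype.sum_prod_type _).symm

lemma concave_ent {P P' : C → ℝ} (hP : ∀ c, 0 ≤ P c) (hP' : ∀ c, 0 ≤ P' c) {s : ℝ}
    (hs0 : 0 ≤ s) (hs1 : s ≤ 1) :
    (1 - s) * ent P + s * ent P' ≤ ent (fun c => (1 - s) * P c + s * P' c) := by
  unfold ent
  rw [Finset.mul_sum, Finset.mul_sum, ← Finset.sum_add_distrib]
  refine Finset.sum_le_sum fun c _ => ?_
  have := Real.concaveOn_negMulLog.2 (hP c) (hP' c) (sub_nonneg.2 hs1) hs0 (by ring)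
  simpa [smul_eq_mul] using this

/-- Product mass function. -/
def prodP (p : A → ℝ) (q : B → ℝ) : A × B → ℝ := fun c => p c.1 * q c.2

omit [Fintype A] in
lemma mL_prodP {p : A → ℝ} {q : B → ℝ} (hq : ∑ b, q b = 1) : mL (prodP p q) = p := by
  funext a
  simp [mL, prodP, ← Finset.mul_sum, hq]

omit [Fintype B] in
lemma mR_prodP {p : A → ℝ} {q : B → ℝ} (hp : ∑ a, p a = 1) : mR (prodP p q) = q := by
  funext b
  simp [mR, prodP, ← Finset.sum_mul, hp]

lemma miE_prodP {p : A → ℝ} {q : B → ℝ} (hp : ∑ a, p a = 1) (hq : ∑ b, q b = 1) :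
    miE (prodP p q) = 0 := by
  rw [miE, mL_prodP hq, mR_prodP hp]
  have : ent (prodP p q) = ent p + ent q := by
    unfold ent prodP
    rw [Fintype.sum_prod_type]
    simp only [Real.negMulLog_mul, Finset.sum_add_distrib, ← Finset.sum_mul, ← Finset.mul_sum,
      hp, hq, one_mul]
  rw [this]
  ring

/-- The set of joint distributions with marginals `Q` and `py` and mutual information at
most `R`. -/
def aSet (Q : A → ℝ) (R : ℝ) (py : B → ℝ) : Set (A × B → ℝ) :=
  {P | (∀ p, 0 ≤ P p) ∧ mL P = Q ∧ mR P = py ∧ miE P ≤ R}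

/-- The normalized logarithmic contribution of a joint type to the decoder's denominator. -/
def fObj (g : (A × B → ℝ) → ℝ) (R : ℝ) (P : A × B → ℝ) : ℝ := g P - miE P + R

/-- The typical normalized logarithm of the decoder's denominator. -/
def alpha0 (g : (A × B → ℝ) → ℝ) (Q : A → ℝ) (R : ℝ) (py : B → ℝ) : ℝ :=
  sSup (fObj g R '' aSet Q R py)

variable {g : (A × B → ℝ) → ℝ} {Q : A → ℝ} {R : ℝ}

lemma continuous_fObj (hg : Continuous g) : Continuous (fObj g R) :=
  (hg.sub continuous_miE).add continuous_const

lemma aSet_subset_Icc (hQ : IsDist Q) {py : B → ℝ} : aSet Q R py ⊆ Set.Icc 0 1 := by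
  rintro P ⟨h0, hL, -, -⟩
  refine mem_Icc_of_dist h0 ?_
  rw [← sum_mL, hL, hQ.2]

lemma bddAbove_aSet (hg : Continuous g) (hQ : IsDist Q) (py : B → ℝ) :
    BddAbove (fObj g R '' aSet Q R py) :=
  ((isCompact_Icc.image (continuous_fObj hg)).bddAbove).mono
    (Set.image_mono (aSet_subset_Icc hQ))

lemma prodP_mem_aSet (hQ : IsDist Q) (hR : 0 ≤ R) {py : B → ℝ} (hpy : IsDist py) :
    prodP Q py ∈ aSet Q R py :=
  ⟨fun _ => mul_nonneg (hQ.1 _) (hpy.1 _), mL_prodP hpy.2, mR_prodP hQ.2,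
    (miE_prodP hQ.2 hpy.2).trans_le hR⟩

lemma emp_isDist (hn : 0 < n) (z : Fin n → C) : IsDist (emp n z) := ⟨emp_nonneg z, sum_emp hn z⟩

/-- A joint type nearly attaining `alpha0`, strictly inside the rate constraint. -/
lemma exists_good_type (hg : Continuous g) (hQ : IsDist Q) (hR : 0 < R) {η : ℝ} (hη : 0 < η) :
    ∃ ε > 0, ∀ᶠ n : ℕ in atTop, (typeClass n Q).Nonempty → ∀ y : Fin n → B,
      ∃ x ∈ typeClass n Q, mutInf (emp2 n x y) ≤ R - ε ∧
        alpha0 g Q R (emp n y) - η ≤ g (emp2 n x y) - mutInf (emp2 n x y) + R := by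
  obtain ⟨r, hr, hr'⟩ := exists_modulus (continuous_fObj (R := R) hg) (η := η / 3) (by positivity)
  set s := min r 1 with hs
  have hs0 : 0 < s := lt_min hr one_pos
  have hs1 : s ≤ 1 := min_le_right _ _
  have hsr : s ≤ r := min_le_left _ _
  obtain ⟨r₂, hr₂, hr₂'⟩ := exists_modulus (continuous_miE (A := A) (B := B))
    (η := s * R / 2) (by positivity)
  refine ⟨s * R / 2, by positivity, ?_⟩
  have hlim : Tendsto (fun n : ℕ => (Fintype.card (A × B) : ℝ) / n) atTop (nhds 0) :=
    tendsto_const_div_atTop_nhds_zero_nat _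
  filter_upwards [eventually_gt_atTop 0, hlim.eventually (gt_mem_nhds hr),
    hlim.eventually (gt_mem_nhds hr₂)] with n hn hn1 hn2
  rintro ⟨z, hz⟩ y
  have hz' := mem_typeClass.1 hz
  have hy := emp_isDist hn y
  obtain ⟨_, ⟨P, hP, rfl⟩, hPa⟩ := exists_lt_of_lt_csSup
    (Set.Nonempty.image (fObj g R) ⟨_, prodP_mem_aSet hQ hR.le hy⟩)
    (show alpha0 g Q R (emp n y) - η / 3 < sSup (fObj g R '' aSet Q R (emp n y)) by
      change _ < alpha0 g Q R (emp n y)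
      linarith)
  have hPi := aSet_subset_Icc hQ hP
  have hPp := aSet_subset_Icc hQ (prodP_mem_aSet hQ hR.le hy)
  obtain ⟨hP0, hPL, hPR, hPI⟩ := hP
  obtain ⟨hX0, hXL, hXR, -⟩ := prodP_mem_aSet hQ hR.le hy
  set X := prodP Q (emp n y)
  set P' : A × B → ℝ := fun c => (1 - s) * P c + s * X c with hP'
  have hP'0 : ∀ c, 0 ≤ P' c := fun c =>
    add_nonneg (mul_nonneg (by linarith) (hP0 c)) (mul_nonneg hs0.le (hX0 c))
  have hP'L : mL P' = Q := by
    funext a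
    have h1 := congrFun hPL a
    have h2 := congrFun hXL a
    simp only [mL] at h1 h2
    simp only [mL, hP', Finset.sum_add_distrib, ← Finset.mul_sum, h1, h2]
    ring
  have hP'R : mR P' = emp n y := by
    funext a
    have h1 := congrFun hPR a
    have h2 := congrFun hXR a
    simp only [mR] at h1 h2
    simp only [mR, hP', Finset.sum_add_distrib, ← Finset.mul_sum, h1, h2]
    ring
  have hP'1 : ∑ c, P' c = 1 := by rw [← sum_mL, hP'L, hQ.2]
  have hP'i := mem_Icc_of_dist hP'0 hP'1
  have hI : miE P' ≤ (1 - s) * R := by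
    have h1 := concave_ent hP0 hX0 hs0.le hs1
    have h2 : miE X = 0 := miE_prodP hQ.2 hy.2
    have h3 : (1 - s) * miE P ≤ (1 - s) * R := mul_le_mul_of_nonneg_left hPI (by linarith)
    rw [miE, hXL, hXR] at h2
    rw [miE, hPL, hPR] at h3
    rw [miE, hP'L, hP'R]
    nlinarith
  have hf := hr' P' hP'i P hPi (fun c => by
    have e : P' c - P c = s * (X c - P c) := by rw [hP']; ring
    rw [e, abs_mul, abs_of_pos hs0]
    have h1 : |X c - P c| ≤ 1 := by
      rw [abs_le]
      have a1 := hPp.1 c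
      have a2 := hPp.2 c
      have a3 := hPi.1 c
      have a4 := hPi.2 c
      simp only [Pi.zero_apply, Pi.one_apply] at a1 a2 a3 a4
      constructor <;> linarith
    nlinarith)
  obtain ⟨x, hx, hxP⟩ := exists_emp2_near (z := z) (y := y) hn hP'0 hP'1
    (by rw [push_fst, hP'L, hz']) (by rw [push_snd, hP'R])
  have hf2 := hr' _ (emp2_mem_Icc x y) P' hP'i fun c => (hxP c).trans hn1.le
  have hI2 := hr₂' _ (emp2_mem_Icc x y) P' hP'i fun c => (hxP c).trans hn2.le
  rw [abs_le] at hf hf2 hI2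
  refine ⟨x, mem_typeClass.2 (hx.trans hz'), ?_, ?_⟩
  · rw [mutInf_eq_miE (emp2_nonneg x y)]
    linarith [hI2.2]
  · rw [mutInf_eq_miE (emp2_nonneg x y)]
    change _ ≤ fObj g R (emp2 n x y)
    linarith [hf.1, hf2.1]

/-- Upper semicontinuity of `alpha0` in the output distribution and the rate constraint. -/
lemma exists_fObj_le_alpha0 (hg : Continuous g) (hQ : IsDist Q) (py : B → ℝ) {η : ℝ}
    (hη : 0 < η) :
    ∃ ε > 0, ∀ P : A × B → ℝ, (∀ p, 0 ≤ P p) → mL P = Q → (∀ b, |mR P b - py b| ≤ ε) →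
      miE P ≤ R + ε → fObj g R P ≤ alpha0 g Q R py + η := by
  set K : Set (A × B → ℝ) := Set.Icc 0 1 ∩ {P | mL P = Q ∧ alpha0 g Q R py + η ≤ fObj g R P}
    with hK
  have hKc : IsCompact K := by
    refine isCompact_Icc.inter_right ?_
    exact (isClosed_eq continuous_mL continuous_const).inter
      (isClosed_le continuous_const (continuous_fObj hg))
  let Φ : (A × B → ℝ) → ℝ := fun P => max (dist (mR P) py) (miE P - R)
  have hΦ : Continuous Φ :=
    (continuous_mR.dist continuous_const).max (continuous_miE.sub continuous_const)
  have hpos : ∀ P ∈ K, 0 < Φ P := by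
    rintro P ⟨hPi, hPL, hPf⟩
    by_contra hcon
    rw [not_lt, max_le_iff] at hcon
    have h1 : mR P = py := dist_le_zero.1 hcon.1
    have h2 : P ∈ aSet Q R py := ⟨hPi.1, hPL, h1, by linarith [hcon.2]⟩
    have h3 : fObj g R P ≤ alpha0 g Q R py :=
      le_csSup (bddAbove_aSet hg hQ py) (Set.mem_image_of_mem _ h2)
    linarith
  obtain ⟨m, hm, hmK⟩ : ∃ m > 0, ∀ P ∈ K, m ≤ Φ P := by
    rcases K.eq_empty_or_nonempty with he | hne
    · exact ⟨1, one_pos, by simp [he]⟩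
    · obtain ⟨P, hP, hmin⟩ := hKc.exists_isMinOn hne hΦ.continuousOn
      exact ⟨Φ P, hpos P hP, fun P' hP' => hmin hP'⟩
  refine ⟨m / 2, by positivity, fun P hP0 hPL hPR hPI => ?_⟩
  by_contra hcon
  rw [not_le] at hcon
  have hPi : P ∈ Set.Icc (0 : A × B → ℝ) 1 :=
    mem_Icc_of_dist hP0 (by rw [← sum_mL, hPL, hQ.2])
  have h1 := hmK P ⟨hPi, hPL, hcon.le⟩
  have h2 : dist (mR P) py ≤ m / 2 := (dist_pi_le_iff (by positivity)).2 fun b => hPR b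
  have h3 : Φ P ≤ m / 2 := max_le h2 (by linarith)
  linarith

end Analysis

section Exponent

variable {α β : Type} [Fintype α] [Fintype β] {n : ℕ}

/-- The sequence of triples formed by two codewords and a channel output. -/
def trip (x x' : Fin n → α) (y : Fin n → β) : Fin n → (α × α) × β := fun i => ((x i, x' i), y i)

/-- Expected log-likelihood of a triple distribution under the channel. -/
def lw (W : α → β → ℝ) (P : (α × α) × β → ℝ) : ℝ := ∑ c, P c * Real.log (W c.1.1 c.2)

/-- Marginal on the first codeword and the output. -/
def pXY (P : (α × α) × β → ℝ) : α × β → ℝ := push (fun c => (c.1.1, c.2)) P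

/-- Marginal on the second codeword and the output. -/
def pXpY (P : (α × α) × β → ℝ) : α × β → ℝ := push (fun c => (c.1.2, c.2)) P

/-- The exponent contributed by a triple distribution, with denominator exponent `a`. -/
def eEa (g : (α × β → ℝ) → ℝ) (Q : α → ℝ) (R : ℝ) (W : α → β → ℝ) (a : ℝ)
    (P : (α × α) × β → ℝ) : ℝ :=
  2 * ent Q - ent P - R - lw W P + max 0 (max (g (pXY P)) a - g (pXpY P))

/-- The exponent contributed by a triple distribution. -/
def eE (g : (α × β → ℝ) → ℝ) (Q : α → ℝ) (R : ℝ) (W : α → β → ℝ)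
    (P : (α × α) × β → ℝ) : ℝ :=
  eEa g Q R W (alpha0 g Q R (push Prod.snd P)) P

/-- Triple distributions compatible with the code and the channel. -/
def feasT (Q : α → ℝ) (W : α → β → ℝ) (ρ : ℝ) : Set ((α × α) × β → ℝ) :=
  {P | (∀ c, 0 ≤ P c) ∧ push (fun c => c.1.1) P = Q ∧ push (fun c => c.1.2) P = Q ∧
    miE (push Prod.fst P) < ρ ∧ ∀ c, W c.1.1 c.2 = 0 → P c = 0}

/-- The limiting exponent. -/
def eL (g : (α × β → ℝ) → ℝ) (Q : α → ℝ) (R : ℝ) (W : α → β → ℝ) (ρ : ℝ) : ℝ :=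
  sInf (eE g Q R W '' feasT Q W ρ)

/-- Compatibility of codewords. -/
def okR (ρ : ℝ) (x z : Fin n → α) : Prop := mutInf (emp2 n x z) < ρ

variable {g : (α × β → ℝ) → ℝ} {Q : α → ℝ} {R ρ : ℝ} {W : α → β → ℝ}

lemma okR_symm (x z : Fin n → α) : okR ρ x z → okR ρ z x := by
  unfold okR
  rw [mutInf_emp2_comm]
  exact id

omit [Fintype α] in
lemma channel_le_one (hW : IsChannel W) (a : α) (b : β) : W a b ≤ 1 :=
  le_one_of_sum (hW a).1 (hW a).2 b

lemma lw_nonpos (hW : IsChannel W) {P : (α × α) × β → ℝ} (hP : ∀ c, 0 ≤ P c) : lw W P ≤ 0 :=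
  Finset.sum_nonpos fun c _ => mul_nonpos_of_nonneg_of_nonpos (hP c)
    (Real.log_nonpos ((hW _).1 _) (channel_le_one hW _ _))

lemma feasT_subset_Icc (hQ : IsDist Q) : feasT Q W ρ ⊆ Set.Icc 0 1 := by
  rintro P ⟨h0, hX, -⟩
  refine mem_Icc_of_dist h0 ?_
  rw [← sum_push (fun c => c.1.1) P, hX, hQ.2]

lemma bddBelow_eE (hQ : IsDist Q) (hW : IsChannel W) :
    BddBelow (eE g Q R W '' feasT Q W ρ) := by
  obtain ⟨H, hH⟩ := (isCompact_Icc.image (continuous_ent (A := (α × α) × β))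
    (s := Set.Icc 0 1)).bddAbove
  refine ⟨2 * ent Q - H - R, ?_⟩
  rintro _ ⟨P, hP, rfl⟩
  have h1 : ent P ≤ H := hH (Set.mem_image_of_mem _ (feasT_subset_Icc hQ hP))
  have h2 := lw_nonpos hW hP.1
  have h3 := le_max_left 0 (max (g (pXY P)) (alpha0 g Q R (push Prod.snd P)) - g (pXpY P))
  unfold eE eEa
  linarith

lemma feasT_nonempty (hQ : IsDist Q) (hW : IsChannel W) (hρ : 0 < ρ) :
    (feasT Q W ρ).Nonempty := by
  have hfst : push Prod.fst (fun c : (α × α) × β => Q c.1.1 * Q c.1.2 * W c.1.1 c.2) =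
      prodP Q Q := by
    rw [push_fst]
    funext p
    simp [mL, ← Finset.mul_sum, (hW p.1).2, prodP]
  have hcomp : ∀ (f : α × α → α) (P : (α × α) × β → ℝ),
      push (fun c => f c.1) P = push f (push Prod.fst P) := by
    intro f P
    rw [push_fst]
    funext a
    unfold push mL
    simp only [Finset.sum_filter]
    rw [Fintype.sum_prod_type]
    refine Finset.sum_congr rfl fun p _ => ?_
    split_ifs
    · rfl
    · simp
  refine ⟨fun c => Q c.1.1 * Q c.1.2 * W c.1.1 c.2, ?_, ?_, ?_, ?_, ?_⟩
  · exact fun c => mul_nonneg (mul_nonneg (hQ.1 _) (hQ.1 _)) ((hW _).1 _)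
  · rw [hcomp Prod.fst, hfst, push_fst, mL_prodP hQ.2]
  · rw [hcomp Prod.snd, hfst, push_snd, mR_prodP hQ.2]
  · rw [hfst, miE_prodP hQ.2 hQ.2]
    exact hρ
  · intro c hc
    simp [hc]

lemma sum_emp_mul (hn : 0 < n) {C : Type} [Fintype C] (t : Fin n → C) (f : C → ℝ) :
    (n : ℝ) * ∑ c, emp n t c * f c = ∑ i, f (t i) := by
  have hn' : (n : ℝ) ≠ 0 := by positivity
  rw [← Finset.sum_fiberwise (s := Finset.univ) (g := t), Finset.mul_sum]
  refine Finset.sum_congr rfl fun c _ => ?_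
  rw [Finset.sum_congr rfl (g := fun _ => f c) (by
    intro i hi
    rw [(Finset.mem_filter.1 hi).2]), Finset.sum_const, nsmul_eq_mul, emp_apply]
  unfold cnt
  field_simp

lemma Wn_eq_exp (hn : 0 < n) (hW : IsChannel W) {x : Fin n → α} (x' : Fin n → α)
    {y : Fin n → β} (h : ∀ i, W (x i) (y i) ≠ 0) :
    Wn n W x y = Real.exp (n * lw W (emp n (trip x x' y))) := by
  unfold lw
  rw [sum_emp_mul hn (trip x x' y) (fun c => Real.log (W c.1.1 c.2)), Real.exp_sum, Wn]
  refine Finset.prod_congr rfl fun i _ => ?_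
  exact (Real.exp_log (lt_of_le_of_ne ((hW _).1 _) (h i).symm)).symm

lemma pXY_emp (x x' : Fin n → α) (y : Fin n → β) : pXY (emp n (trip x x' y)) = emp2 n x y := by
  rw [pXY, push_emp, ← emp_pair]
  rfl

lemma pXpY_emp (x x' : Fin n → α) (y : Fin n → β) :
    pXpY (emp n (trip x x' y)) = emp2 n x' y := by
  rw [pXpY, push_emp, ← emp_pair]
  rfl

lemma push_snd_emp (x x' : Fin n → α) (y : Fin n → β) :
    push Prod.snd (emp n (trip x x' y)) = emp n y := by
  rw [push_emp]
  rfl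

lemma push_fst_emp (x x' : Fin n → α) (y : Fin n → β) :
    push Prod.fst (emp n (trip x x' y)) = emp2 n x x' := by
  rw [push_emp, ← emp_pair]
  rfl

lemma emp_trip_mem_feasT {x x' : Fin n → α} {y : Fin n → β} (hx : x ∈ typeClass n Q)
    (hx' : x' ∈ typeClass n Q) (hok : okR ρ x x') (h : ∀ i, W (x i) (y i) ≠ 0) :
    emp n (trip x x' y) ∈ feasT Q W ρ := by
  refine ⟨emp_nonneg _, ?_, ?_, ?_, ?_⟩
  · rw [push_emp]
    exact mem_typeClass.1 hx
  · rw [push_emp]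
    exact mem_typeClass.1 hx'
  · rw [push_fst_emp, ← mutInf_eq_miE (emp2_nonneg x x')]
    exact hok
  · intro c hc
    rw [emp_apply]
    have : cnt (trip x x' y) c = 0 := by
      unfold cnt
      refine Finset.card_eq_zero.2 (Finset.eq_empty_of_forall_notMem fun i hi => h i ?_)
      have hi' : trip x x' y i = c := by simpa using hi
      rwa [← hi'] at hc
    simp [this]

lemma card_not_okR_le (hn : 0 < n) (hT : (typeClass n Q).Nonempty) (z : Fin n → α) :
    (((typeClass n Q).filter fun x => ¬ okR ρ x z).card : ℝ) ≤
      (polyF2 α α n * Real.exp (-(n * ρ))) * (typeClass n Q).card := by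
  have h1 := sum_exp_mutInf_le hn hT z
  have h2 : (((typeClass n Q).filter fun x => ¬ okR ρ x z).card : ℝ) * Real.exp (n * ρ) ≤
      ∑ x ∈ typeClass n Q, Real.exp (n * mutInf (emp2 n x z)) := by
    rw [← nsmul_eq_mul, ← Finset.sum_const]
    refine le_trans (Finset.sum_le_sum fun x hx => ?_)
      (Finset.sum_le_sum_of_subset_of_nonneg (Finset.filter_subset (fun x => ¬ okR ρ x z) _)
        fun x _ _ => (Real.exp_pos _).le)
    refine Real.exp_le_exp.2 (mul_le_mul_of_nonneg_left ?_ (by positivity))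
    exact not_lt.1 (Finset.mem_filter.1 hx).2
  rw [Real.exp_neg]
  have h3 := Real.exp_pos (n * ρ)
  calc _ ≤ (polyF2 α α n * (typeClass n Q).card) * (Real.exp (n * ρ))⁻¹ := by
        rw [← div_eq_mul_inv, le_div_iff₀ h3]
        exact h2.trans h1
    _ = _ := by ring

lemma sum_trip (F : (Fin n → (α × α) × β) → ℝ) :
    ∑ x : Fin n → α, ∑ x' : Fin n → α, ∑ y : Fin n → β, F (trip x x' y) = ∑ t, F t := by
  have h1 : ∀ x : Fin n → α, ∑ x' : Fin n → α, ∑ y : Fin n → β, F (trip x x' y) =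
      ∑ p : (Fin n → α) × (Fin n → β), F (trip x p.1 p.2) := fun x =>
    (Fintype.sum_prod_type (fun p : (Fin n → α) × (Fin n → β) => F (trip x p.1 p.2))).symm
  simp only [h1]
  rw [← Fintype.sum_prod_type (fun q : (Fin n → α) × ((Fin n → α) × (Fin n → β)) =>
    F (trip q.1 q.2.1 q.2.2))]
  refine Finset.sum_bij' (fun q _ => trip q.1 q.2.1 q.2.2)
    (fun t _ => (fun i => (t i).1.1, fun i => (t i).1.2, fun i => (t i).2)) ?_ ?_ ?_ ?_ ?_
  all_goals intros; first | rfl | exact Finset.mem_univ _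

lemma exp_le_Mof (R : ℝ) (n : ℕ) : Real.exp (n * R) ≤ Mof R n := Nat.le_ceil _

lemma Mof_le (hR : 0 ≤ R) (n : ℕ) : (Mof R n : ℝ) ≤ 2 * Real.exp (n * R) := by
  have h1 : (Mof R n : ℝ) < Real.exp (n * R) + 1 := Nat.ceil_lt_add_one (Real.exp_pos _).le
  have h2 : 1 ≤ Real.exp (n * R) := Real.one_le_exp (by positivity)
  linarith

lemma tendsto_exp_neg_mul {a : ℝ} (ha : 0 < a) (C : ℝ) :
    Tendsto (fun n : ℕ => C * Real.exp (-(n * a))) atTop (nhds 0) := by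
  have h1 : Tendsto (fun n : ℕ => (n : ℝ) * a) atTop atTop :=
    tendsto_natCast_atTop_atTop.atTop_mul_const ha
  simpa using (Real.tendsto_exp_neg_atTop_nhds_zero.comp h1).const_mul C

lemma eventually_exp_neg_le {a : ℝ} (ha : 0 < a) (C : ℝ) {ζ : ℝ} (hζ : 0 < ζ) :
    ∀ᶠ n : ℕ in atTop, C * Real.exp (-(n * a)) ≤ ζ :=
  ((tendsto_exp_neg_mul ha C).eventually (gt_mem_nhds hζ)).mono fun _ h => h.le

/-- The blocked fraction times the code size vanishes. -/
lemma eventually_Mof_mul_le (hR : 0 ≤ R) (hρ : R < ρ) {ζ : ℝ} (hζ : 0 < ζ) :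
    ∀ᶠ n : ℕ in atTop, (Mof R n : ℝ) * (polyF2 α α n * Real.exp (-(n * ρ))) ≤ ζ := by
  have h0 : 0 < (ρ - R) / 2 := by linarith
  filter_upwards [eventually_polyF2_le α α h0, eventually_exp_neg_le h0 2 hζ] with n h1 h2
  refine le_trans ?_ h2
  calc _ ≤ (2 * Real.exp (n * R)) * (Real.exp (n * ((ρ - R) / 2)) * Real.exp (-(n * ρ))) := by
        refine mul_le_mul (Mof_le hR n) (mul_le_mul_of_nonneg_right h1 (Real.exp_pos _).le)
          (mul_nonneg (polyF2_pos α α n).le (Real.exp_pos _).le) (by positivity)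
    _ = _ := by
        rw [mul_assoc, ← Real.exp_add, ← Real.exp_add]
        congr 2
        ring

end Exponent

section Upper

variable {α β : Type} [Fintype α] [Fintype β] {n : ℕ}
variable {g : (α × β → ℝ) → ℝ} {Q : α → ℝ} {R ρ : ℝ} {W : α → β → ℝ}

lemma eventually_const_mul_polyF_le (A : Type) [Fintype A] (C : ℝ) (hC : 0 ≤ C) {η : ℝ}
    (hη : 0 < η) : ∀ᶠ n : ℕ in atTop, C * polyF A n ≤ Real.exp (n * η) := by
  have h0 : 0 < η / 2 := by positivity
  filter_upwards [eventually_polyF_le A h0, eventually_exp_neg_le h0 C one_pos] with n h1 h2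
  calc C * polyF A n ≤ C * Real.exp (n * (η / 2)) := mul_le_mul_of_nonneg_left h1 hC
    _ = (C * Real.exp (-(n * (η / 2)))) * Real.exp (n * η) := by
        rw [mul_assoc, ← Real.exp_add]
        congr 2
        ring
    _ ≤ 1 * Real.exp (n * η) := mul_le_mul_of_nonneg_right h2 (Real.exp_pos _).le
    _ = _ := one_mul _

lemma eventually_card_pow_mul_exp_le (B : Type) [Fintype B] {κ ζ : ℝ} (hκ : 0 < κ)
    (hζ : 0 < ζ) : ∀ᶠ n : ℕ in atTop,
      (Fintype.card (Fin n → B) : ℝ) * (2 * Real.exp (-Real.exp (n * κ))) ≤ ζ := by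
  set b : ℝ := (Fintype.card B : ℝ) with hb
  have hb0 : 0 ≤ b := by positivity
  filter_upwards [eventually_exp_neg_le one_pos 2 hζ,
    eventually_ge_atTop ⌈2 * (b + 1) / κ ^ 2⌉₊] with n h1 h2
  have h3 : 2 * (b + 1) / κ ^ 2 ≤ n := (Nat.le_ceil _).trans (by exact_mod_cast h2)
  have h4 : (Fintype.card (Fin n → B) : ℝ) ≤ Real.exp (n * b) := by
    rw [Fintype.card_fun, Fintype.card_fin, Nat.cast_pow, ← hb, Real.exp_nat_mul]
    refine pow_le_pow_left₀ hb0 ?_ n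
    have := Real.add_one_le_exp b
    linarith
  have h5 : n * (b + 1) ≤ Real.exp (n * κ) := by
    have h6 := Real.quadratic_le_exp_of_nonneg (x := n * κ) (by positivity)
    rw [div_le_iff₀ (by positivity)] at h3
    have h7 : 0 ≤ (n : ℝ) * κ := by positivity
    nlinarith [mul_le_mul_of_nonneg_left h3 (Nat.cast_nonneg (α := ℝ) n)]
  calc _ ≤ Real.exp (n * b) * (2 * Real.exp (-(n * (b + 1)))) := by
        gcongr
    _ = 2 * Real.exp (-(n * 1)) := by
        rw [mul_left_comm, ← Real.exp_add]
        congr 2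
        ring
    _ ≤ ζ := h1

/-- The denominator of the generalized likelihood decoder. -/
def den (g : (α × β → ℝ) → ℝ) {M : ℕ} (c : Fin M → Fin n → α) (y : Fin n → β) : ℝ :=
  ∑ m, Real.exp (n * g (emp2 n (c m) y))

lemma exp_le_den {M : ℕ} (c : Fin M → Fin n → α) (y : Fin n → β) (m : Fin M) :
    Real.exp (n * g (emp2 n (c m) y)) ≤ den g c y :=
  Finset.single_le_sum (f := fun m => Real.exp (n * g (emp2 n (c m) y)))
    (fun _ _ => (Real.exp_pos _).le) (Finset.mem_univ m)

lemma eventually_pr_den_lt_le (hg : Continuous g) (hQ : IsDist Q) (hR : 0 < R) (hρ : R < ρ)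
    {η ζ : ℝ} (hη : 0 < η) (hζ : 0 < ζ) :
    ∀ᶠ n : ℕ in atTop, (typeClass n Q).Nonempty →
      pr (typeClass n Q) (okR ρ) (Mof R n) (fun c => ∃ y : Fin n → β,
        den g c y < Real.exp (n * (alpha0 g Q R (emp n y) - η))) ≤ ζ := by
  obtain ⟨ε, hε, hgood⟩ := exists_good_type (A := α) (B := β) hg hQ hR (half_pos hη)
  set κ := min ε (η / 2) with hκdef
  have hκ : 0 < κ := lt_min hε (half_pos hη)
  filter_upwards [hgood, eventually_const_mul_polyF_le (α × β) 8 (by norm_num) (half_pos hκ),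
    eventually_card_pow_mul_exp_le β (half_pos hκ) hζ, eventually_gt_atTop 0,
    eventually_Mof_mul_le (α := α) hR.le hρ (ζ := 1 / 10) (by norm_num)]
    with n hgood hpoly hcard hn hMb hT
  refine (pr_exists_le _).trans (le_trans ?_ hcard)
  rw [← nsmul_eq_mul, ← Finset.card_univ, ← Finset.sum_const]
  refine Finset.sum_le_sum fun y _ => ?_
  obtain ⟨x₀, hx₀, hI, ha⟩ := hgood hT y
  set S := (typeClass n Q).filter fun x => emp2 n x y = emp2 n x₀ y with hS
  set q : ℝ := (S.card : ℝ) / (typeClass n Q).card * Mof R n / 8 with hq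
  have hTc : (0 : ℝ) < (typeClass n Q).card := by exact_mod_cast hT.card_pos
  have hScard : Real.exp (-(n * mutInf (emp2 n x₀ y))) * (typeClass n Q).card ≤
      polyF (α × β) n * S.card := by
    have h1 := le_sum_ind_emp2 hn x₀ y
    rw [mem_typeClass.1 hx₀] at h1
    refine h1.trans (mul_le_mul_of_nonneg_left ?_ polyF_pos.le)
    rw [hS, ← sum_ind_eq_card, ← Finset.sum_subset (Finset.subset_univ (typeClass n Q))]
    intro x _ hx
    refine ind_of_not fun h => hx ?_
    rw [mem_typeClass, ← mem_typeClass.1 hx₀, ← mL_emp2 x y, ← mL_emp2 x₀ y, h]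
  have hq1 : Real.exp (n * (R - mutInf (emp2 n x₀ y) - κ / 2)) ≤ q := by
    have h2 : Real.exp (-(n * mutInf (emp2 n x₀ y))) / polyF (α × β) n ≤
        (S.card : ℝ) / (typeClass n Q).card := by
      rw [div_le_div_iff₀ polyF_pos hTc]
      linarith
    calc Real.exp (n * (R - mutInf (emp2 n x₀ y) - κ / 2))
        = Real.exp (-(n * mutInf (emp2 n x₀ y))) * Real.exp (n * R) /
            Real.exp (n * (κ / 2)) := by
          rw [← Real.exp_add, ← Real.exp_sub]
          congr 1
          ring
      _ ≤ Real.exp (-(n * mutInf (emp2 n x₀ y))) * Real.exp (n * R) /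
            (8 * polyF (α × β) n) := by
          refine div_le_div_of_nonneg_left (by positivity) ?_ hpoly
          exact mul_pos (by norm_num) polyF_pos
      _ = Real.exp (-(n * mutInf (emp2 n x₀ y))) / polyF (α × β) n * Real.exp (n * R) / 8 := by
          have := polyF_pos (A := α × β) (n := n)
          field_simp
      _ ≤ q := by
          rw [hq]
          gcongr
          exact exp_le_Mof R n
  have hn0 : (0 : ℝ) ≤ n := by positivity
  have hκε : κ ≤ ε := min_le_left _ _
  have hκη : κ ≤ η / 2 := min_le_right _ _
  have htail := ens_count_lower_tail hT (card_not_okR_le (ρ := ρ) hn hT) okR_symm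
    (mul_pos (polyF2_pos α α n) (Real.exp_pos _)) (M := Mof R n) (by linarith)
    (S := S) (Finset.filter_subset _ _)
  refine le_trans (pr_mono ?_) (htail.trans ?_)
  · intro c _ hc
    by_contra hcon
    rw [not_lt] at hcon
    refine absurd hc (not_lt.2 ?_)
    calc Real.exp (n * (alpha0 g Q R (emp n y) - η))
        ≤ Real.exp (n * (R - mutInf (emp2 n x₀ y) - κ / 2)) *
            Real.exp (n * g (emp2 n x₀ y)) := by
          rw [← Real.exp_add, ← mul_add]
          refine Real.exp_le_exp.2 (mul_le_mul_of_nonneg_left ?_ hn0)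
          linarith
      _ ≤ _ := mul_le_mul_of_nonneg_right (hq1.trans hcon) (Real.exp_pos _).le
      _ ≤ den g c y := by
          rw [den, Finset.sum_mul]
          refine Finset.sum_le_sum fun j _ => ?_
          split_ifs with hj
          · rw [(Finset.mem_filter.1 hj).2, one_mul]
          · rw [zero_mul]
            exact (Real.exp_pos _).le
  · refine mul_le_mul_of_nonneg_left (Real.exp_le_exp.2 (neg_le_neg ?_)) (by norm_num)
    refine le_trans (Real.exp_le_exp.2 (mul_le_mul_of_nonneg_left ?_ hn0)) hq1
    linarith

/-- The contribution of a pair of codewords to the upper bound on the error probability. -/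
def pairUB (g : (α × β → ℝ) → ℝ) (Q : α → ℝ) (R : ℝ) (W : α → β → ℝ) (ρ η : ℝ)
    (x x' : Fin n → α) : ℝ :=
  ind (okR ρ x x') * ∑ y : Fin n → β, Wn n W x y *
    Real.exp (-(n * max 0 (max (g (emp2 n x y)) (alpha0 g Q R (emp n y) - η) -
      g (emp2 n x' y))))

omit [Fintype α] in
lemma Wn_nonneg (hW : IsChannel W) (x : Fin n → α) (y : Fin n → β) : 0 ≤ Wn n W x y :=
  Finset.prod_nonneg fun _ _ => (hW _).1 _

lemma pairUB_nonneg (hW : IsChannel W) (η : ℝ) (x x' : Fin n → α) :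
    0 ≤ pairUB g Q R W ρ η x x' :=
  mul_nonneg (ind_nonneg _) (Finset.sum_nonneg fun _ _ =>
    mul_nonneg (Wn_nonneg hW _ _) (Real.exp_pos _).le)

lemma Pe_le_sum_pairUB (hW : IsChannel W) {η : ℝ} {M : ℕ} {c : Fin M → Fin n → α}
    (hok : ∀ m m', m ≠ m' → okR ρ (c m) (c m'))
    (hden : ∀ y : Fin n → β, Real.exp (n * (alpha0 g Q R (emp n y) - η)) ≤ den g c y) :
    Pe n W g c ≤ (M : ℝ)⁻¹ * ∑ m, ∑ m' ∈ Finset.univ.erase m,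
      pairUB g Q R W ρ η (c m) (c m') := by
  unfold Pe
  refine mul_le_mul_of_nonneg_left (Finset.sum_le_sum fun m _ =>
    Finset.sum_le_sum fun m' hm' => ?_) (by positivity)
  rw [pairUB, ind_of (hok m m' (Finset.ne_of_mem_erase hm').symm), one_mul]
  refine Finset.sum_le_sum fun y _ => ?_
  rw [mul_div_assoc]
  refine mul_le_mul_of_nonneg_left ?_ (Wn_nonneg hW _ _)
  change _ / den g c y ≤ _
  have hpos : 0 < den g c y := (Real.exp_pos _).trans_le (exp_le_den c y m)
  have hn0 : (0 : ℝ) ≤ n := by positivity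
  rw [div_le_iff₀ hpos]
  have key : ∀ t, Real.exp (n * t) ≤ den g c y → Real.exp (n * g (emp2 n (c m') y)) ≤
      Real.exp (-(n * (t - g (emp2 n (c m') y)))) * den g c y := by
    intro t ht
    refine le_trans (le_of_eq ?_) (mul_le_mul_of_nonneg_left ht (Real.exp_pos _).le)
    rw [← Real.exp_add]
    congr 1
    ring
  rcases max_choice 0 (max (g (emp2 n (c m) y)) (alpha0 g Q R (emp n y) - η) -
      g (emp2 n (c m') y)) with h | h <;> rw [h]
  · simpa using exp_le_den c y m'
  · refine key _ ?_
    rcases max_choice (g (emp2 n (c m) y)) (alpha0 g Q R (emp n y) - η) with h | h <;> rw [h]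
    · exact exp_le_den c y m
    · exact hden y

lemma sum_pairUB_le (hn : 0 < n) (hQ : IsDist Q) (hW : IsChannel W) {η : ℝ} (hη : 0 ≤ η) :
    ∑ x ∈ typeClass n Q, ∑ x' ∈ typeClass n Q, pairUB g Q R W ρ η x x' ≤
      Real.exp (n * (2 * ent Q - R - eL g Q R W ρ + η)) * polyF ((α × α) × β) n := by
  have hn0 : (0 : ℝ) ≤ n := by positivity
  have key : ∀ x ∈ typeClass n Q, ∀ x' ∈ typeClass n Q, pairUB g Q R W ρ η x x' ≤
      ∑ y : Fin n → β, Real.exp (n * (2 * ent Q - R - eL g Q R W ρ + η)) *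
        Real.exp (-(n * ent (emp n (trip x x' y)))) := by
    intro x hx x' hx'
    rw [pairUB]
    by_cases hok : okR ρ x x'
    swap
    · rw [ind_of_not hok, zero_mul]
      positivity
    rw [ind_of hok, one_mul]
    refine Finset.sum_le_sum fun y _ => ?_
    by_cases h : ∀ i, W (x i) (y i) ≠ 0
    swap
    · push Not at h
      obtain ⟨i, hi⟩ := h
      rw [Wn, Finset.prod_eq_zero (Finset.mem_univ i) hi, zero_mul]
      positivity
    have hL : eL g Q R W ρ ≤ eE g Q R W (emp n (trip x x' y)) :=
      csInf_le (bddBelow_eE hQ hW) ⟨_, emp_trip_mem_feasT hx hx' hok h, rfl⟩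
    rw [Wn_eq_exp hn hW x' h, ← Real.exp_add, ← Real.exp_add]
    rw [eE, eEa, pXY_emp, pXpY_emp, push_snd_emp] at hL
    have h1 : max 0 (max (g (emp2 n x y)) (alpha0 g Q R (emp n y)) - g (emp2 n x' y)) ≤
        max 0 (max (g (emp2 n x y)) (alpha0 g Q R (emp n y) - η) - g (emp2 n x' y)) + η := by
      have h2 := le_max_left 0
        (max (g (emp2 n x y)) (alpha0 g Q R (emp n y) - η) - g (emp2 n x' y))
      have h3 := le_max_right 0
        (max (g (emp2 n x y)) (alpha0 g Q R (emp n y) - η) - g (emp2 n x' y))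
      have h4 := le_max_left (g (emp2 n x y)) (alpha0 g Q R (emp n y) - η)
      have h5 := le_max_right (g (emp2 n x y)) (alpha0 g Q R (emp n y) - η)
      refine max_le (by linarith) ?_
      rw [sub_le_iff_le_add]
      exact max_le (by linarith) (by linarith)
    refine Real.exp_le_exp.2 ?_
    have h6 := mul_le_mul_of_nonneg_left (hL.trans (add_le_add_right h1 _)) hn0
    nlinarith [h6]
  calc _ ≤ ∑ x ∈ typeClass n Q, ∑ x' ∈ typeClass n Q, ∑ y : Fin n → β,
        Real.exp (n * (2 * ent Q - R - eL g Q R W ρ + η)) *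
        Real.exp (-(n * ent (emp n (trip x x' y)))) :=
        Finset.sum_le_sum fun x hx => Finset.sum_le_sum fun x' hx' => key x hx x' hx'
    _ ≤ ∑ x : Fin n → α, ∑ x' : Fin n → α, ∑ y : Fin n → β,
        Real.exp (n * (2 * ent Q - R - eL g Q R W ρ + η)) *
        Real.exp (-(n * ent (emp n (trip x x' y)))) := by
        refine le_trans (Finset.sum_le_sum fun x _ => ?_) (Finset.sum_le_sum_of_subset_of_nonneg
          (Finset.subset_univ _) fun _ _ _ => by positivity)
        exact Finset.sum_le_sum_of_subset_of_nonneg (Finset.subset_univ _)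
          fun _ _ _ => by positivity
    _ = Real.exp (n * (2 * ent Q - R - eL g Q R W ρ + η)) *
        ∑ t : Fin n → (α × α) × β, Real.exp (-(n * ent (emp n t))) := by
        rw [sum_trip (fun t => Real.exp (n * (2 * ent Q - R - eL g Q R W ρ + η)) *
          Real.exp (-(n * ent (emp n t)))), Finset.mul_sum]
    _ ≤ _ := mul_le_mul_of_nonneg_left (sum_exp_neg_ent_le hn) (Real.exp_pos _).le

lemma ens_sum_pairUB_le (hn : 0 < n) (hQ : IsDist Q) (hW : IsChannel W) (hR : 0 ≤ R) {η : ℝ}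
    (hη : 0 ≤ η) (hT : (typeClass n Q).Nonempty)
    (hMb : (Mof R n : ℝ) * (polyF2 α α n * Real.exp (-(n * ρ))) ≤ 1 / 2) :
    ens (typeClass n Q) (okR ρ) (Mof R n) (fun c => (Mof R n : ℝ)⁻¹ *
      ∑ m, ∑ m' ∈ Finset.univ.erase m, pairUB g Q R W ρ η (c m) (c m')) ≤
      8 * polyF α n ^ 2 * polyF ((α × α) × β) n * Real.exp (-(n * (eL g Q R W ρ - η))) := by
  set M := Mof R n with hMdef
  set T := typeClass n Q with hTdef
  set σ := ∑ x ∈ T, ∑ x' ∈ T, pairUB g Q R W ρ η x x' with hσ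
  have hσ0 : 0 ≤ σ := Finset.sum_nonneg fun x _ => Finset.sum_nonneg fun x' _ =>
    pairUB_nonneg hW η x x'
  have hM0 : (0 : ℝ) < M := (Real.exp_pos _).trans_le (exp_le_Mof R n)
  have hTc : (0 : ℝ) < T.card := by exact_mod_cast hT.card_pos
  rw [ens_const_mul, ens_sum]
  have h1 : ∑ m : Fin M, ens T (okR ρ) M (fun c => ∑ m' ∈ Finset.univ.erase m,
      pairUB g Q R W ρ η (c m) (c m')) ≤ M * (M * ((2 / T.card) ^ 2 * σ)) := by
    calc _ ≤ ∑ m : Fin M, (M * ((2 / T.card) ^ 2 * σ)) := by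
          refine Finset.sum_le_sum fun m _ => ?_
          rw [ens_sum]
          calc _ ≤ ∑ m' ∈ Finset.univ.erase m, (2 / (T.card : ℝ)) ^ 2 * σ := by
                refine Finset.sum_le_sum fun m' hm' => ?_
                have h := ens_pair_le hT (card_not_okR_le (ρ := ρ) hn hT)
                  (mul_nonneg (polyF2_pos α α n).le (Real.exp_pos _).le) hMb (by norm_num)
                  le_rfl (Finset.ne_of_mem_erase hm').symm
                  (pairUB_nonneg (g := g) (Q := Q) (R := R) (ρ := ρ) hW η)
                norm_num at h
                exact h
            _ ≤ _ := by
                rw [Finset.sum_const, nsmul_eq_mul]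
                refine mul_le_mul_of_nonneg_right ?_ (by positivity)
                exact_mod_cast (Finset.card_le_univ _).trans (by simp)
      _ = _ := by simp
  obtain ⟨x₀, hx₀⟩ := hT
  have hTl : 1 / (T.card : ℝ) ≤ polyF α n * Real.exp (-(n * ent Q)) := by
    have h2 := le_card_typeClass hn x₀
    rw [mem_typeClass.1 hx₀, ← hTdef] at h2
    rw [div_le_iff₀ hTc, Real.exp_neg, mul_right_comm, ← div_eq_mul_inv,
      le_div_iff₀ (Real.exp_pos _), one_mul]
    exact h2
  have hp := polyF_pos (A := α) (n := n)
  calc _ ≤ (M : ℝ)⁻¹ * (M * (M * ((2 / T.card) ^ 2 * σ))) :=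
        mul_le_mul_of_nonneg_left h1 (by positivity)
    _ = 4 * M * (1 / (T.card : ℝ)) ^ 2 * σ := by
        field_simp
        ring
    _ ≤ 4 * (2 * Real.exp (n * R)) * (polyF α n * Real.exp (-(n * ent Q))) ^ 2 *
        (Real.exp (n * (2 * ent Q - R - eL g Q R W ρ + η)) * polyF ((α × α) × β) n) := by
        gcongr
        · exact Mof_le hR n
        · exact sum_pairUB_le hn hQ hW hη
    _ = 8 * polyF α n ^ 2 * polyF ((α × α) × β) n * (Real.exp (n * R) *
        (Real.exp (-(n * ent Q)) * Real.exp (-(n * ent Q))) *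
        Real.exp (n * (2 * ent Q - R - eL g Q R W ρ + η))) := by ring
    _ = _ := by
        rw [← Real.exp_add, ← Real.exp_add, ← Real.exp_add]
        congr 2
        ring

lemma eventually_pr_lt_Pe_le (hg : Continuous g) (hQ : IsDist Q) (hW : IsChannel W)
    (hR : 0 < R) (hρ : R < ρ) {η ζ : ℝ} (hη : 0 < η) (hζ : 0 < ζ) :
    ∀ᶠ n : ℕ in atTop, (typeClass n Q).Nonempty →
      pr (typeClass n Q) (okR ρ) (Mof R n) (fun c =>
        Real.exp (-(n * (eL g Q R W ρ - η))) < Pe n W g c) ≤ ζ := by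
  have h8 : 0 < η / 8 := by positivity
  filter_upwards [eventually_pr_den_lt_le hg hQ hR hρ h8 (half_pos hζ),
    eventually_polyF_le α h8, eventually_polyF_le ((α × α) × β) h8, eventually_gt_atTop 0,
    eventually_Mof_mul_le (α := α) hR.le hρ (ζ := 1 / 2) (by norm_num),
    eventually_exp_neg_le (half_pos hη) 8 (half_pos hζ)] with n hden hp1 hp2 hn hMb hexp hT
  set F : (Fin (Mof R n) → Fin n → α) → ℝ := fun c => (Mof R n : ℝ)⁻¹ *
      ∑ m, ∑ m' ∈ Finset.univ.erase m, pairUB g Q R W ρ (η / 8) (c m) (c m') with hF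
  have hsplit := pr_mono (T := typeClass n Q) (ok := okR ρ) (M := Mof R n)
    (p := fun c => Real.exp (-(n * (eL g Q R W ρ - η))) < Pe n W g c)
    (q := fun c => (∃ y : Fin n → β,
        den g c y < Real.exp (n * (alpha0 g Q R (emp n y) - η / 8))) ∨
      Real.exp (-(n * (eL g Q R W ρ - η))) ≤ F c) (by
      intro c hc hPe
      by_cases h : ∃ y : Fin n → β, den g c y < Real.exp (n * (alpha0 g Q R (emp n y) - η / 8))
      · exact Or.inl h
      · right
        push Not at h
        exact hPe.le.trans (Pe_le_sum_pairUB hW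
          (fun m m' hm => ok_of_wt_ne_zero okR_symm hc hm) h))
  refine hsplit.trans ((pr_or_le _ _).trans ?_)
  have hmarkov := pr_le_of_le (T := typeClass n Q) (ok := okR ρ) (f := F)
    (fun c => mul_nonneg (by positivity) (Finset.sum_nonneg fun m _ =>
      Finset.sum_nonneg fun m' _ => pairUB_nonneg hW _ _ _))
    (Real.exp_pos (-(n * (eL g Q R W ρ - η))))
    (p := fun c => Real.exp (-(n * (eL g Q R W ρ - η))) ≤ F c) (fun c _ h => h)
  have hE := ens_sum_pairUB_le (g := g) (W := W) hn hQ hW hR.le h8.le hT hMb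
  have hfin : (Real.exp (-(n * (eL g Q R W ρ - η))))⁻¹ *
      ens (typeClass n Q) (okR ρ) (Mof R n) F ≤ 8 * Real.exp (-(n * (η / 2))) := by
    have hp := polyF_pos (A := α) (n := n)
    have hp' := polyF_pos (A := (α × α) × β) (n := n)
    calc _ ≤ (Real.exp (-(n * (eL g Q R W ρ - η))))⁻¹ * (8 * Real.exp (n * (η / 8)) ^ 2 *
          Real.exp (n * (η / 8)) * Real.exp (-(n * (eL g Q R W ρ - η / 8)))) := by
          refine mul_le_mul_of_nonneg_left (hE.trans ?_) (by positivity)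
          gcongr
      _ = 8 * (Real.exp (n * (eL g Q R W ρ - η)) * ((Real.exp (n * (η / 8)) *
          Real.exp (n * (η / 8))) * Real.exp (n * (η / 8)) *
          Real.exp (-(n * (eL g Q R W ρ - η / 8))))) := by
          rw [Real.exp_neg, inv_inv]
          ring
      _ = _ := by
          rw [← Real.exp_add, ← Real.exp_add, ← Real.exp_add, ← Real.exp_add]
          congr 2
          ring
  linarith [hden hT]

end Upper

section Lower

variable {α β : Type} [Fintype α] [Fintype β] {n : ℕ}
variable {g : (α × β → ℝ) → ℝ} {Q : α → ℝ} {R ρ : ℝ} {W : α → β → ℝ}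

lemma continuous_lw (W : α → β → ℝ) : Continuous (lw W) := by
  unfold lw
  fun_prop

lemma continuous_eEa (hg : Continuous g) (a : ℝ) : Continuous (eEa g Q R W a) := by
  have h1 : Continuous fun P : (α × α) × β → ℝ => g (pXY P) := hg.comp (continuous_push _)
  have h2 : Continuous fun P : (α × α) × β → ℝ => g (pXpY P) := hg.comp (continuous_push _)
  exact ((((continuous_const.sub continuous_ent).sub continuous_const).sub
    (continuous_lw W)).add (continuous_const.max ((h1.max continuous_const).sub h2)))

/-- A triple of sequences whose joint type nearly attains the limiting exponent, together with
a uniform bound on the metric of third codewords. -/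
lemma exists_good_trip (hg : Continuous g) (hQ : IsDist Q) (hW : IsChannel W) (hρ : 0 < ρ)
    {η : ℝ} (hη : 0 < η) :
    ∃ a ε : ℝ, 0 < ε ∧ ∀ᶠ n : ℕ in atTop, (typeClass n Q).Nonempty →
      ∃ x₀ ∈ typeClass n Q, ∃ x₀' ∈ typeClass n Q, ∃ y₀ : Fin n → β,
        (∀ i, W (x₀ i) (y₀ i) ≠ 0) ∧ okR ρ x₀ x₀' ∧
        eEa g Q R W a (emp n (trip x₀ x₀' y₀)) ≤ eL g Q R W ρ + η ∧
        ∀ y, emp n y = emp n y₀ → ∀ x ∈ typeClass n Q, mutInf (emp2 n x y) ≤ R + ε →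
          g (emp2 n x y) ≤ a + η + mutInf (emp2 n x y) - R := by
  have hη2 := half_pos hη
  obtain ⟨_, ⟨P, hP, rfl⟩, hlt⟩ := exists_lt_of_csInf_lt
    ((feasT_nonempty hQ hW hρ).image (eE g Q R W)) (lt_add_of_pos_right (eL g Q R W ρ) hη2)
  obtain ⟨ε, hε, hα⟩ := exists_fObj_le_alpha0 (R := R) hg hQ (push Prod.snd P) hη
  refine ⟨alpha0 g Q R (push Prod.snd P), ε, hε, ?_⟩
  obtain ⟨r₁, hr₁, h₁⟩ := exists_modulus
    (continuous_eEa (Q := Q) (R := R) (W := W) hg (alpha0 g Q R (push Prod.snd P))) hη2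
  have hmi : 0 < (ρ - miE (push Prod.fst P)) / 2 := by linarith [hP.2.2.2.1]
  obtain ⟨r₂, hr₂, h₂⟩ := exists_modulus (C := (α × α) × β)
    (φ := fun P => miE (push Prod.fst P)) (continuous_miE.comp (continuous_push _)) hmi
  obtain ⟨r₃, hr₃, h₃⟩ := exists_modulus (C := (α × α) × β)
    (φ := fun P' => ∑ b, |push Prod.snd P' b - push Prod.snd P b|)
    (continuous_finsetSum _ fun b _ =>
      (((continuous_apply b).comp (continuous_push _)).sub continuous_const).abs) hε
  have hP1 : ∑ c, P c = 1 := by rw [← sum_push (fun c => c.1.1) P, hP.2.1, hQ.2]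
  have hPI : P ∈ Set.Icc 0 1 := feasT_subset_Icc hQ hP
  have hr : 0 < min r₁ (min r₂ r₃) := lt_min hr₁ (lt_min hr₂ hr₃)
  filter_upwards [eventually_gt_atTop 0, eventually_ge_atTop
    ⌈(Fintype.card ((α × α) × β) : ℝ) / min r₁ (min r₂ r₃)⌉₊] with n hn hN hT
  obtain ⟨z, hz⟩ := hT
  have hzQ := mem_typeClass.1 hz
  obtain ⟨x, x', y, hx, hx', hxy, hnear⟩ := exists_emp3_near hn hP.1 hP1
    (hP.2.1.trans hzQ.symm) (hP.2.2.1.trans hzQ.symm) (W := W) (by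
      intro a
      by_contra hcon
      push Not at hcon
      have := (hW a).2
      simp [hcon] at this) hP.2.2.2.2
  have hnear' : ∀ p, |emp n (trip x x' y) p - P p| ≤ min r₁ (min r₂ r₃) := by
    intro p
    refine (hnear p).trans ?_
    have h4 : (Fintype.card ((α × α) × β) : ℝ) / min r₁ (min r₂ r₃) ≤ n :=
      (Nat.le_ceil _).trans (by exact_mod_cast hN)
    rw [div_le_iff₀ hr] at h4
    rw [div_le_iff₀ (by exact_mod_cast hn)]
    linarith
  have hI := emp_mem_Icc (trip x x' y)
  have e₁ := h₁ _ hI _ hPI fun c => (hnear' c).trans (min_le_left _ _)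
  have e₂ := h₂ _ hI _ hPI fun c => (hnear' c).trans ((min_le_right _ _).trans (min_le_left _ _))
  have e₃ := h₃ _ hI _ hPI fun c => (hnear' c).trans ((min_le_right _ _).trans (min_le_right _ _))
  refine ⟨x, mem_typeClass.2 (hx.trans hzQ), x', mem_typeClass.2 (hx'.trans hzQ), y, hxy,
    ?_, ?_, ?_⟩
  · rw [okR, mutInf_eq_miE (emp2_nonneg x x'), ← push_fst_emp x x' y]
    have := (abs_le.1 e₂).2
    linarith
  · have := (abs_le.1 e₁).2
    unfold eE at hlt
    linarith
  · intro y' hy' w hw hwI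
    rw [mutInf_eq_miE (emp2_nonneg w y')] at hwI ⊢
    have h5 := hα (emp2 n w y') (emp2_nonneg w y') (by rw [mL_emp2, mem_typeClass.1 hw]) (by
      intro b
      rw [mR_emp2, hy', ← push_snd_emp x x' y]
      refine le_trans (Finset.single_le_sum
        (f := fun b => |push Prod.snd (emp n (trip x x' y)) b - push Prod.snd P b|)
        (fun _ _ => abs_nonneg _) (Finset.mem_univ b)) ?_
      have := (abs_le.1 e₃).2
      simpa using this) hwI
    unfold fObj at h5
    linarith

lemma sum_eq_of_emp_eq {A B : Type} [Fintype A] [Fintype B] (hn : 0 < n)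
    {F : (Fin n → A) → (Fin n → B) → ℝ}
    (hF : ∀ x y (σ : Equiv.Perm (Fin n)), F (x ∘ σ) (y ∘ σ) = F x y) {y y' : Fin n → B}
    (h : emp n y' = emp n y) : ∑ x, F x y' = ∑ x, F x y := by
  obtain ⟨σ, rfl⟩ := exists_perm_of_emp_eq hn h
  refine (Fintype.sum_equiv (Equiv.arrowCongr σ.symm (Equiv.refl A)) _ _ fun x => ?_).symm
  rw [← hF x y σ]
  rfl

lemma exists_degree (hn : 0 < n) {x₀ x₀' : Fin n → α} (hx₀ : x₀ ∈ typeClass n Q)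
    (hx₀' : x₀' ∈ typeClass n Q) :
    ∃ K : ℝ, (∀ x ∈ typeClass n Q, ∑ z ∈ typeClass n Q, ind (emp2 n x z = emp2 n x₀ x₀') = K) ∧
      (∀ z ∈ typeClass n Q, ∑ x ∈ typeClass n Q, ind (emp2 n x z = emp2 n x₀ x₀') = K) ∧
      Real.exp (-(n * mutInf (emp2 n x₀ x₀'))) * (typeClass n Q).card ≤
        polyF (α × α) n * K := by
  have hTc : (0 : ℝ) < (typeClass n Q).card := by
    exact_mod_cast Finset.card_pos.2 ⟨x₀, hx₀⟩
  have hrow : ∀ x, ∑ z ∈ typeClass n Q, ind (emp2 n x z = emp2 n x₀ x₀') =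
      ∑ z, ind (emp2 n x z = emp2 n x₀ x₀') := by
    intro x
    refine Finset.sum_subset (Finset.subset_univ _) fun z _ hz => ind_of_not fun h => hz ?_
    rw [mem_typeClass, ← mem_typeClass.1 hx₀', ← mR_emp2 x z, ← mR_emp2 x₀ x₀', h]
  have hcol : ∀ z, ∑ x ∈ typeClass n Q, ind (emp2 n x z = emp2 n x₀ x₀') =
      ∑ x, ind (emp2 n x z = emp2 n x₀ x₀') := by
    intro z
    refine Finset.sum_subset (Finset.subset_univ _) fun x _ hx => ind_of_not fun h => hx ?_
    rw [mem_typeClass, ← mem_typeClass.1 hx₀, ← mL_emp2 x z, ← mL_emp2 x₀ x₀', h]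
  have hc : ∀ z ∈ typeClass n Q, ∑ x ∈ typeClass n Q, ind (emp2 n x z = emp2 n x₀ x₀') =
      ∑ x, ind (emp2 n x x₀' = emp2 n x₀ x₀') := by
    intro z hz
    rw [hcol]
    exact sum_eq_of_emp_eq (F := fun x z => ind (emp2 n x z = emp2 n x₀ x₀')) hn
      (fun x z σ => by rw [emp2_comp]) ((mem_typeClass.1 hz).trans (mem_typeClass.1 hx₀').symm)
  have hr : ∀ x ∈ typeClass n Q, ∑ z ∈ typeClass n Q, ind (emp2 n x z = emp2 n x₀ x₀') =
      ∑ z, ind (emp2 n x₀ z = emp2 n x₀ x₀') := by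
    intro x hx
    rw [hrow]
    exact sum_eq_of_emp_eq (F := fun z x => ind (emp2 n x z = emp2 n x₀ x₀')) hn
      (fun z x σ => by rw [emp2_comp]) ((mem_typeClass.1 hx).trans (mem_typeClass.1 hx₀).symm)
  have heq : ∑ z, ind (emp2 n x₀ z = emp2 n x₀ x₀') =
      ∑ x, ind (emp2 n x x₀' = emp2 n x₀ x₀') := by
    have h1 := Finset.sum_congr rfl hr
    have h2 := Finset.sum_congr rfl hc
    rw [Finset.sum_comm, h1, Finset.sum_const, Finset.sum_const, nsmul_eq_mul,
      nsmul_eq_mul] at h2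
    exact mul_left_cancel₀ hTc.ne' h2
  refine ⟨_, hr, fun z hz => (hc z hz).trans heq.symm, ?_⟩
  have h3 := le_sum_ind_emp2 hn x₀ x₀'
  rw [mem_typeClass.1 hx₀] at h3
  rw [heq]
  exact h3

/-- The number of outputs completing a pair of codewords to a prescribed joint type. -/
def outCount (π : (α × α) × β → ℝ) (x z : Fin n → α) : ℝ :=
  ∑ y : Fin n → β, ind (emp n (trip x z y) = π)

lemma outCount_eq (hn : 0 < n) (π : (α × α) × β → ℝ) {x z x₀ z₀ : Fin n → α}
    (h : emp2 n x z = emp2 n x₀ z₀) : outCount π x z = outCount π x₀ z₀ := by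
  rw [← emp_pair, ← emp_pair] at h
  exact sum_eq_of_emp_eq (F := fun (y : Fin n → β) (p : Fin n → α × α) =>
    ind (emp n (fun i => (p i, y i)) = π)) hn (fun y p σ => by
      rw [← emp_comp (fun i => (p i, y i)) σ]
      rfl) h

lemma sum_ind_trip (π : (α × α) × β → ℝ) :
    ∑ x : Fin n → α, ∑ z : Fin n → α, ∑ y : Fin n → β, ind (emp n (trip x z y) = π) =
      (typeClass n π).card := by
  rw [sum_trip (fun t => ind (emp n t = π)), sum_ind_eq_card]
  rfl

lemma ind_trip_mul (x₀ z₀ : Fin n → α) (y₀ : Fin n → β) (x z : Fin n → α) :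
    outCount (emp n (trip x₀ z₀ y₀)) x z =
      ind (emp2 n x z = emp2 n x₀ z₀) * outCount (emp n (trip x₀ z₀ y₀)) x z := by
  by_cases h : emp2 n x z = emp2 n x₀ z₀
  · rw [ind_of h, one_mul]
  · rw [ind_of_not h, zero_mul]
    refine Finset.sum_eq_zero fun y _ => ind_of_not fun h' => h ?_
    rw [← push_fst_emp x z y, h', push_fst_emp]

lemma card_typeClass_trip (hn : 0 < n) {x₀ z₀ : Fin n → α} (y₀ : Fin n → β)
    (hx₀ : x₀ ∈ typeClass n Q) (hz₀ : z₀ ∈ typeClass n Q) {K : ℝ}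
    (hK : ∀ x ∈ typeClass n Q, ∑ z ∈ typeClass n Q, ind (emp2 n x z = emp2 n x₀ z₀) = K) :
    ((typeClass n (emp n (trip x₀ z₀ y₀))).card : ℝ) =
      (typeClass n Q).card * K * outCount (emp n (trip x₀ z₀ y₀)) x₀ z₀ := by
  set π := emp n (trip x₀ z₀ y₀) with hπ
  have h1 : ∀ x z, outCount π x z =
      ind (emp2 n x z = emp2 n x₀ z₀) * outCount π x₀ z₀ := by
    intro x z
    rw [ind_trip_mul]
    by_cases h : emp2 n x z = emp2 n x₀ z₀
    · rw [outCount_eq hn _ h]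
    · rw [ind_of_not h, zero_mul, zero_mul]
  rw [← sum_ind_trip]
  change ∑ x, ∑ z, outCount π x z = _
  rw [Finset.sum_congr rfl fun x _ => (Finset.sum_congr rfl fun z _ => h1 x z).trans
    (Finset.sum_mul _ _ _).symm, ← Finset.sum_mul]
  congr 1
  rw [← nsmul_eq_mul, ← Finset.sum_const, ← Finset.sum_congr rfl hK]
  symm
  refine (Finset.sum_congr rfl fun x _ => ?_).trans
    (Finset.sum_subset (Finset.subset_univ _) fun x _ hx => ?_)
  · refine Finset.sum_subset (Finset.subset_univ _) fun z _ hz => ind_of_not fun h => hz ?_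
    rw [mem_typeClass, ← mem_typeClass.1 hz₀, ← mR_emp2 x z, ← mR_emp2 x₀ z₀, h]
  · refine Finset.sum_eq_zero fun z _ => ind_of_not fun h => hx ?_
    rw [mem_typeClass, ← mem_typeClass.1 hx₀, ← mL_emp2 x z, ← mL_emp2 x₀ z₀, h]

end Lower

section LowerProb

variable {α β : Type} [Fintype α] [Fintype β] {n : ℕ}
variable {g : (α × β → ℝ) → ℝ} {Q : α → ℝ} {R ρ : ℝ} {W : α → β → ℝ}

/-- Interference of a third codeword with an output sequence. -/
def intf (R κ : ℝ) (u : Fin n → α) (y : Fin n → β) : ℝ :=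
  Real.exp (n * (mutInf (emp2 n u y) - R - κ))

/-- Total interference on a pair of codewords. -/
def totIntf (R κ : ℝ) {M : ℕ} (c : Fin M → Fin n → α) (i j : Fin M) (y : Fin n → β) : ℝ :=
  ∑ k ∈ (Finset.univ.erase i).erase j, intf R κ (c k) y

/-- Interference summed over the outputs completing a pair to a prescribed joint type. -/
def outIntf (R κ : ℝ) (π : (α × α) × β → ℝ) (x z u : Fin n → α) : ℝ :=
  ∑ y : Fin n → β, ind (emp n (trip x z y) = π) * intf R κ u y

/-- Interference summed over all ordered pairs of codewords. -/
def badSum (R κ : ℝ) (π : (α × α) × β → ℝ) {M : ℕ} (c : Fin M → Fin n → α) : ℝ :=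
  ∑ j, ∑ i, ind (i < j) * ∑ k ∈ (Finset.univ.erase i).erase j, outIntf R κ π (c i) (c j) (c k)

lemma outIntf_nonneg (κ : ℝ) (π : (α × α) × β → ℝ) (x z u : Fin n → α) :
    0 ≤ outIntf R κ π x z u :=
  Finset.sum_nonneg fun _ _ => mul_nonneg (ind_nonneg _) (Real.exp_pos _).le

lemma badSum_nonneg (κ : ℝ) (π : (α × α) × β → ℝ) {M : ℕ} (c : Fin M → Fin n → α) :
    0 ≤ badSum R κ π c :=
  Finset.sum_nonneg fun _ _ => Finset.sum_nonneg fun _ _ => mul_nonneg (ind_nonneg _)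
    (Finset.sum_nonneg fun _ _ => outIntf_nonneg κ π _ _ _)

lemma den_le {a ε η κ : ℝ} {M : ℕ} {c : Fin M → Fin n → α} {y : Fin n → β} (hn : 0 < n)
    (hκε : κ ≤ ε) (hκη : κ ≤ η) (hc : ∀ i, c i ∈ typeClass n Q)
    (hy : ∀ x ∈ typeClass n Q, mutInf (emp2 n x y) ≤ R + ε →
          g (emp2 n x y) ≤ a + η + mutInf (emp2 n x y) - R)
    {i j : Fin M} (hij : i ≠ j) (h : totIntf R κ c i j y < 1) :
    den g c y ≤ Real.exp (n * g (emp2 n (c i) y)) + (Real.exp (n * g (emp2 n (c j) y)) +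
      Real.exp (n * (a + 2 * η))) := by
  have hn0 : (0 : ℝ) < n := by exact_mod_cast hn
  unfold den
  rw [← Finset.add_sum_erase _ _ (Finset.mem_univ i),
    ← Finset.add_sum_erase _ _ (Finset.mem_erase.2 ⟨hij.symm, Finset.mem_univ j⟩)]
  gcongr
  calc _ ≤ ∑ k ∈ (Finset.univ.erase i).erase j, intf R κ (c k) y *
        Real.exp (n * (a + 2 * η)) := by
        refine Finset.sum_le_sum fun k hk => ?_
        have h1 : intf R κ (c k) y < 1 := (Finset.single_le_sum
          (f := fun k => intf R κ (c k) y) (fun _ _ => (Real.exp_pos _).le) hk).trans_lt h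
        rw [intf, Real.exp_lt_one_iff] at h1
        have h2 : mutInf (emp2 n (c k) y) - R - κ < 0 := by
          by_contra hcon
          exact absurd h1 (not_lt.2 (mul_nonneg hn0.le (not_lt.1 hcon)))
        have h3 := hy (c k) (hc k) (by linarith)
        rw [intf, ← Real.exp_add, ← mul_add]
        refine Real.exp_le_exp.2 (mul_le_mul_of_nonneg_left ?_ hn0.le)
        linarith
    _ = totIntf R κ c i j y * Real.exp (n * (a + 2 * η)) := by
        rw [totIntf, Finset.sum_mul]
    _ ≤ 1 * Real.exp (n * (a + 2 * η)) :=
        mul_le_mul_of_nonneg_right h.le (Real.exp_pos _).le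
    _ = _ := one_mul _

/-- Lower bound for the contribution of a pair of codewords and an output. -/
lemma le_term {a ε η κ : ℝ} {M : ℕ} {c : Fin M → Fin n → α} {y : Fin n → β} (hn : 0 < n)
    (hη : 0 ≤ η) (hκε : κ ≤ ε) (hκη : κ ≤ η) (hW : IsChannel W)
    (hc : ∀ i, c i ∈ typeClass n Q) {x₀ z₀ : Fin n → α} {y₀ : Fin n → β}
    (hxy : ∀ i, W (x₀ i) (y₀ i) ≠ 0)
    (hy : ∀ y, emp n y = emp n y₀ → ∀ x ∈ typeClass n Q, mutInf (emp2 n x y) ≤ R + ε →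
          g (emp2 n x y) ≤ a + η + mutInf (emp2 n x y) - R)
    {i j : Fin M} (hij : i ≠ j) :
    Real.exp (n * (2 * ent Q - ent (emp n (trip x₀ z₀ y₀)) - R -
        eEa g Q R W a (emp n (trip x₀ z₀ y₀)) - 2 * η)) / 3 *
      (ind (emp n (trip (c i) (c j) y) = emp n (trip x₀ z₀ y₀)) -
        ind (emp n (trip (c i) (c j) y) = emp n (trip x₀ z₀ y₀)) * totIntf R κ c i j y) ≤
      Wn n W (c i) y * Real.exp (n * g (emp2 n (c j) y)) / den g c y := by
  set π := emp n (trip x₀ z₀ y₀) with hπ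
  have hn0 : (0 : ℝ) ≤ n := by positivity
  have hdpos : 0 < den g c y := (Real.exp_pos _).trans_le (exp_le_den c y i)
  have hrhs : 0 ≤ Wn n W (c i) y * Real.exp (n * g (emp2 n (c j) y)) / den g c y :=
    div_nonneg (mul_nonneg (Wn_nonneg hW _ _) (Real.exp_pos _).le) hdpos.le
  by_cases hV : emp n (trip (c i) (c j) y) = π
  swap
  · rw [ind_of_not hV]
    simpa using hrhs
  rw [ind_of hV, one_mul]
  have hH0 : 0 ≤ totIntf R κ c i j y := Finset.sum_nonneg fun _ _ => (Real.exp_pos _).le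
  by_cases hH : totIntf R κ c i j y < 1
  swap
  · refine le_trans (mul_nonpos_of_nonneg_of_nonpos (by positivity) ?_) hrhs
    linarith
  have hWy : ∀ l, W (c i l) (y l) ≠ 0 := by
    obtain ⟨σ, hσ⟩ := exists_perm_of_emp_eq hn hV
    intro l
    have h1 : trip (c i) (c j) y l = trip x₀ z₀ y₀ (σ l) := congrFun hσ l
    have h2 : c i l = x₀ (σ l) := congrArg (fun p => p.1.1) h1
    have h3 : y l = y₀ (σ l) := congrArg (fun p => p.2) h1
    rw [h2, h3]
    exact hxy _
  have hyy : emp n y = emp n y₀ := by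
    rw [← push_snd_emp (c i) (c j) y, hV, hπ, push_snd_emp]
  have hden := den_le hn hκε hκη hc (hy y hyy) hij hH
  rw [Wn_eq_exp hn hW (c j) hWy, hV]
  have hgi : emp2 n (c i) y = pXY π := by rw [← hV, pXY_emp]
  have hgj : emp2 n (c j) y = pXpY π := by rw [← hV, pXpY_emp]
  rw [hgi, hgj] at hden
  rw [hgj]
  set m := max (max (g (pXY π)) (a + 2 * η)) (g (pXpY π)) with hm
  have hden' : den g c y ≤ 3 * Real.exp (n * m) := by
    have h1 : Real.exp (n * g (pXY π)) ≤ Real.exp (n * m) :=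
      Real.exp_le_exp.2 (mul_le_mul_of_nonneg_left
        ((le_max_left _ _).trans (le_max_left _ _)) hn0)
    have h2 : Real.exp (n * g (pXpY π)) ≤ Real.exp (n * m) :=
      Real.exp_le_exp.2 (mul_le_mul_of_nonneg_left (le_max_right _ _) hn0)
    have h3 : Real.exp (n * (a + 2 * η)) ≤ Real.exp (n * m) :=
      Real.exp_le_exp.2 (mul_le_mul_of_nonneg_left
        ((le_max_right _ _).trans (le_max_left _ _)) hn0)
    linarith
  have hmle : m ≤ g (pXpY π) + max 0 (max (g (pXY π)) a - g (pXpY π)) + 2 * η := by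
    have h1 := le_max_left 0 (max (g (pXY π)) a - g (pXpY π))
    have h2 := le_max_right 0 (max (g (pXY π)) a - g (pXpY π))
    have h3 := le_max_left (g (pXY π)) a
    have h4 := le_max_right (g (pXY π)) a
    refine max_le (max_le ?_ ?_) ?_ <;> linarith
  calc _ ≤ Real.exp (n * (2 * ent Q - ent π - R - eEa g Q R W a π - 2 * η)) / 3 * 1 :=
        mul_le_mul_of_nonneg_left (by linarith) (by positivity)
    _ ≤ Real.exp (n * lw W π) * Real.exp (n * g (pXpY π)) / (3 * Real.exp (n * m)) := by
        rw [mul_one, mul_comm 3, ← div_div]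
        refine div_le_div_of_nonneg_right ?_ (by norm_num)
        rw [← Real.exp_add, ← Real.exp_sub, ← mul_add, ← mul_sub]
        refine Real.exp_le_exp.2 (mul_le_mul_of_nonneg_left ?_ hn0)
        unfold eEa
        linarith
    _ ≤ _ := div_le_div_of_nonneg_left (by positivity) hdpos hden'

lemma le_Pe {a ε η κ : ℝ} {M : ℕ} {c : Fin M → Fin n → α} (hn : 0 < n)
    (hη : 0 ≤ η) (hκε : κ ≤ ε) (hκη : κ ≤ η) (hW : IsChannel W)
    (hc : ∀ i, c i ∈ typeClass n Q) {x₀ z₀ : Fin n → α} {y₀ : Fin n → β}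
    (hxy : ∀ i, W (x₀ i) (y₀ i) ≠ 0)
    (hy : ∀ y, emp n y = emp n y₀ → ∀ x ∈ typeClass n Q, mutInf (emp2 n x y) ≤ R + ε →
          g (emp2 n x y) ≤ a + η + mutInf (emp2 n x y) - R) :
    (M : ℝ)⁻¹ * (Real.exp (n * (2 * ent Q - ent (emp n (trip x₀ z₀ y₀)) - R -
        eEa g Q R W a (emp n (trip x₀ z₀ y₀)) - 2 * η)) / 3 *
      (outCount (emp n (trip x₀ z₀ y₀)) x₀ z₀ *
        pairCount (fun x z => emp2 n x z = emp2 n x₀ z₀) c -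
        badSum R κ (emp n (trip x₀ z₀ y₀)) c)) ≤ Pe n W g c := by
  set π := emp n (trip x₀ z₀ y₀) with hπ
  set C := Real.exp (n * (2 * ent Q - ent π - R - eEa g Q R W a π - 2 * η)) / 3 with hC
  unfold Pe
  refine mul_le_mul_of_nonneg_left ?_ (by positivity)
  set t : Fin M → Fin M → ℝ := fun i j => ∑ y : Fin n → β,
    Wn n W (c i) y * Real.exp (n * g (emp2 n (c j) y)) / den g c y with ht
  have ht0 : ∀ i j, 0 ≤ t i j := fun i j => Finset.sum_nonneg fun y _ =>
    div_nonneg (mul_nonneg (Wn_nonneg hW _ _) (Real.exp_pos _).le)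
      (Finset.sum_nonneg fun _ _ => (Real.exp_pos _).le)
  change _ ≤ ∑ m : Fin M, ∑ m' ∈ Finset.univ.erase m, t m m'
  have h1 : ∑ j : Fin M, ∑ i : Fin M, ind (i < j) * t i j ≤
      ∑ m : Fin M, ∑ m' ∈ Finset.univ.erase m, t m m' := by
    rw [Finset.sum_comm]
    refine Finset.sum_le_sum fun i _ => ?_
    rw [← Finset.add_sum_erase _ _ (Finset.mem_univ i), ind_of_not (lt_irrefl i), zero_mul,
      zero_add]
    exact Finset.sum_le_sum fun j _ => mul_le_of_le_one_left (ht0 i j) (ind_le_one _)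
  refine le_trans (le_of_eq_of_le (b := ∑ j, ∑ i, ind (i < j) * (C * (outCount π (c i) (c j) -
      ∑ k ∈ (Finset.univ.erase i).erase j, outIntf R κ π (c i) (c j) (c k)))) ?_
    (Finset.sum_le_sum fun j _ => Finset.sum_le_sum fun i _ => ?_)) h1
  · have h2 : outCount π x₀ z₀ * pairCount (fun x z => emp2 n x z = emp2 n x₀ z₀) c =
        ∑ j, ∑ i, ind (i < j) * outCount π (c i) (c j) := by
      rw [pairCount, Finset.mul_sum]
      refine Finset.sum_congr rfl fun j _ => ?_
      rw [Finset.mul_sum]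
      refine Finset.sum_congr rfl fun i _ => ?_
      by_cases hij : i < j
      · by_cases hs : emp2 n (c i) (c j) = emp2 n x₀ z₀
        · rw [ind_of ⟨hij, hs⟩, ind_of hij, outCount_eq hn π hs]
          ring
        · rw [hπ, ind_trip_mul x₀ z₀ y₀ (c i), ind_of_not hs, ind_of_not fun h => hs h.2]
          ring
      · rw [ind_of_not hij, ind_of_not fun h => hij h.1]
        ring
    rw [h2, badSum]
    simp only [mul_sub, Finset.sum_sub_distrib, Finset.mul_sum, mul_left_comm C]
  · by_cases hij : i < j
    swap
    · rw [ind_of_not hij, zero_mul, zero_mul]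
    refine mul_le_mul_of_nonneg_left ?_ (ind_nonneg _)
    have h3 : ∑ k ∈ (Finset.univ.erase i).erase j, outIntf R κ π (c i) (c j) (c k) =
        ∑ y : Fin n → β, ind (emp n (trip (c i) (c j) y) = π) * totIntf R κ c i j y := by
      unfold outIntf totIntf
      rw [Finset.sum_comm]
      exact Finset.sum_congr rfl fun y _ => (Finset.mul_sum _ _ _).symm
    rw [h3, outCount, ← Finset.sum_sub_distrib, Finset.mul_sum]
    exact Finset.sum_le_sum fun y _ => le_term hn hη hκε hκη hW hc hxy hy hij.ne

lemma ens_badSum_le (hn : 0 < n) (hR : 0 ≤ R) (hT : (typeClass n Q).Nonempty)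
    (hMb : (Mof R n : ℝ) * (polyF2 α α n * Real.exp (-(n * ρ))) ≤ 1 / 2) (κ : ℝ)
    (π : (α × α) × β → ℝ) :
    ens (typeClass n Q) (okR ρ) (Mof R n) (badSum R κ π) ≤
      16 * (polyF2 α β n * Real.exp (-(n * κ))) *
        ((Mof R n : ℝ) ^ 2 * (typeClass n π).card / (typeClass n Q).card ^ 2) := by
  set M := Mof R n with hMdef
  set T := typeClass n Q with hTdef
  have hM0 : (0 : ℝ) < M := (Real.exp_pos _).trans_le (exp_le_Mof R n)
  have hTc : (0 : ℝ) < T.card := by exact_mod_cast hT.card_pos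
  have hpp := polyF2_pos α β n
  have hsum : ∑ x ∈ T, ∑ z ∈ T, ∑ u ∈ T, outIntf R κ π x z u ≤
      (typeClass n π).card * (polyF2 α β n * T.card * Real.exp (-(n * (R + κ)))) := by
    have h1 : ∀ y : Fin n → β, ∑ u ∈ T, intf R κ u y ≤
        polyF2 α β n * T.card * Real.exp (-(n * (R + κ))) := by
      intro y
      refine le_trans (le_of_eq ?_) (mul_le_mul_of_nonneg_right (sum_exp_mutInf_le hn hT y)
        (Real.exp_pos _).le)
      rw [Finset.sum_mul]
      refine Finset.sum_congr rfl fun u _ => ?_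
      rw [intf, ← Real.exp_add]
      congr 1
      ring
    rw [← sum_ind_trip, Finset.sum_mul]
    refine le_trans (Finset.sum_le_sum fun x _ => ?_) (Finset.sum_le_sum_of_subset_of_nonneg
      (Finset.subset_univ _) fun _ _ _ => mul_nonneg (Finset.sum_nonneg fun _ _ =>
        Finset.sum_nonneg fun _ _ => ind_nonneg _) (by positivity))
    rw [Finset.sum_mul]
    refine le_trans (Finset.sum_le_sum fun z _ => ?_) (Finset.sum_le_sum_of_subset_of_nonneg
      (Finset.subset_univ _) fun _ _ _ => mul_nonneg (Finset.sum_nonneg fun _ _ =>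
        ind_nonneg _) (by positivity))
    rw [Finset.sum_mul]
    unfold outIntf
    rw [Finset.sum_comm]
    refine Finset.sum_le_sum fun y _ => ?_
    rw [← Finset.mul_sum]
    exact mul_le_mul_of_nonneg_left (h1 y) (ind_nonneg _)
  set τ := (2 / (T.card : ℝ)) ^ 3 *
    ((typeClass n π).card * (polyF2 α β n * T.card * Real.exp (-(n * (R + κ))))) with hτ
  have hτ0 : 0 ≤ τ := by positivity
  have hE : ens T (okR ρ) M (badSum R κ π) ≤ M * (M * (M * τ)) := by
    unfold badSum
    rw [ens_sum]
    refine le_trans (Finset.sum_le_sum (g := fun _ => M * (M * τ)) fun j _ => ?_)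
      (by simp)
    rw [ens_sum]
    refine le_trans (Finset.sum_le_sum (g := fun _ => M * τ) fun i _ => ?_) (by simp)
    rw [ens_const_mul]
    by_cases hij : i < j
    swap
    · rw [ind_of_not hij, zero_mul]
      positivity
    rw [ind_of hij, one_mul, ens_sum]
    refine le_trans (Finset.sum_le_sum (g := fun _ => τ) fun k hk => ?_) ?_
    · have hkj := Finset.ne_of_mem_erase hk
      have hki := Finset.ne_of_mem_erase (Finset.mem_of_mem_erase hk)
      have h := ens_triple_le hT (card_not_okR_le (ρ := ρ) hn hT)
        (mul_nonneg (polyF2_pos α α n).le (Real.exp_pos _).le) hMb (by norm_num)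
        le_rfl hij.ne hki.symm hkj.symm (outIntf_nonneg (R := R) κ π)
      have h2 : (1 + 2 * (1 / 2) : ℝ) = 2 := by norm_num
      rw [h2] at h
      exact h.trans (mul_le_mul_of_nonneg_left hsum (by positivity))
    · rw [Finset.sum_const, nsmul_eq_mul]
      refine mul_le_mul_of_nonneg_right ?_ hτ0
      exact_mod_cast (Finset.card_le_univ _).trans (by simp)
  calc _ ≤ M * (M * (M * τ)) := hE
    _ ≤ M * (M * (2 * Real.exp (n * R) * τ)) := by
        gcongr
        exact Mof_le hR n
    _ = _ := by
        have h3 : Real.exp (-(n * (R + κ))) = Real.exp (-(n * κ)) / Real.exp (n * R) := by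
          rw [← Real.exp_sub]
          congr 1
          ring
        rw [hτ, h3]
        have := Real.exp_pos (n * R)
        field_simp
        ring

end LowerProb

section LowerTail

variable {α β : Type} [Fintype α] [Fintype β]
variable {g : (α × β → ℝ) → ℝ} {Q : α → ℝ} {R ρ : ℝ} {W : α → β → ℝ}

set_option maxHeartbeats 1000000 in
lemma eventually_pr_Pe_lt_le (hg : Continuous g) (hQ : IsDist Q) (hW : IsChannel W)
    (hR : 0 < R) (hρ : R < ρ) (hρ2 : ρ < 2 * R) {η ζ : ℝ} (hη : 0 < η) (hζ : 0 < ζ) :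
    ∀ᶠ n : ℕ in atTop, (typeClass n Q).Nonempty →
      pr (typeClass n Q) (okR ρ) (Mof R n) (fun c =>
        Pe n W g c < Real.exp (-(n * (eL g Q R W ρ + η)))) ≤ ζ := by
  have hη4 : 0 < η / 4 := by positivity
  obtain ⟨a, ε, hε, hgood⟩ := exists_good_trip (R := R) hg hQ hW (hR.trans hρ) hη4
  set κ := min ε (η / 4) with hκdef
  have hκ : 0 < κ := lt_min hε hη4
  set θ := min (1 / 2) (ζ / 400) with hθdef
  have hθ : 0 < θ := lt_min (by norm_num) (by positivity)
  have hθ1 : θ ≤ 1 / 2 := min_le_left _ _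
  have hθ2 : θ ≤ ζ / 400 := min_le_right _ _
  have hgap : 0 < (2 * R - ρ) / 2 := by linarith
  filter_upwards [hgood, eventually_gt_atTop 0,
    eventually_Mof_mul_le (α := α) hR.le hρ hθ,
    eventually_const_mul_polyF_le ((α × α) × β) 48 (by norm_num) hη4,
    eventually_const_mul_polyF_le (α × α) 32 (by norm_num) hgap,
    eventually_exp_neg_le hgap 1 (ζ := ζ / 8) (by positivity),
    eventually_exp_neg_le hR 512 (ζ := min 256 (ζ / 8)) (by positivity),
    eventually_polyF2_le α β (half_pos hκ),
    eventually_exp_neg_le (half_pos hκ) 256 (ζ := ζ / 4) (by positivity)]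
    with n hgood hn hMb hp3 hp2 he1 he2 hpp he3 hT
  obtain ⟨x₀, hx₀, z₀, hz₀, y₀, hxy, hok, hE, hy⟩ := hgood hT
  obtain ⟨K, hK1, hK2, hKl⟩ := exists_degree hn hx₀ hz₀
  have hn0 : (0 : ℝ) ≤ n := by positivity
  have hTc : (0 : ℝ) < (typeClass n Q).card := by exact_mod_cast hT.card_pos
  have hp := polyF_pos (A := α × α) (n := n)
  have hK0 : 0 < K := by
    have h1 : 0 < polyF (α × α) n * K := (mul_pos (Real.exp_pos _) hTc).trans_le hKl
    exact pos_of_mul_pos_right h1 hp.le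
  have hM := exp_le_Mof R n
  have hM0 : (0 : ℝ) < Mof R n := (Real.exp_pos _).trans_le hM
  have hMinv : 512 / (Mof R n : ℝ) ≤ min 256 (ζ / 8) := by
    refine le_trans ?_ he2
    rw [Real.exp_neg, ← div_eq_mul_inv]
    exact div_le_div_of_nonneg_left (by norm_num) (Real.exp_pos _) hM
  have hM2 : 2 ≤ Mof R n := by
    have h1 := hMinv.trans (min_le_left _ _)
    rw [div_le_iff₀ hM0] at h1
    have h2 : (2 : ℝ) ≤ Mof R n := by linarith
    exact_mod_cast h2
  set π := emp n (trip x₀ z₀ y₀) with hπ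
  set J : ℝ := ((typeClass n π).card : ℝ) with hJ
  have hJeq : J = (typeClass n Q).card * K * outCount π x₀ z₀ :=
    card_typeClass_trip hn y₀ hx₀ hz₀ hK1
  have hJ0 : 0 < J := by
    rw [hJ]
    exact_mod_cast Finset.card_pos.2 ⟨_, self_mem_typeClass (trip x₀ z₀ y₀)⟩
  have hO0 : 0 ≤ outCount π x₀ z₀ := Finset.sum_nonneg fun _ _ => ind_nonneg _
  set s : (Fin n → α) → (Fin n → α) → Prop := fun x z => emp2 n x z = emp2 n x₀ z₀ with hs
  set Θ : ℝ := (Mof R n : ℝ) ^ 2 * J / (typeClass n Q).card ^ 2 with hΘ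
  have hΘ0 : 0 < Θ := by positivity
  have hsplit := pr_mono (T := typeClass n Q) (ok := okR ρ) (M := Mof R n)
    (p := fun c => Pe n W g c < Real.exp (-(n * (eL g Q R W ρ + η))))
    (q := fun c => pairCount s c < K / (typeClass n Q).card * (Mof R n : ℝ) ^ 2 / 8 ∨
      Θ / 16 ≤ badSum R κ π c) (by
      intro c hc hPe
      by_contra hcon
      push Not at hcon
      obtain ⟨h1, h2⟩ := hcon
      refine absurd hPe (not_lt.2 ?_)
      have hlow := le_Pe (R := R) (g := g) (a := a) (z₀ := z₀) hn hη4.le (min_le_left ε (η / 4))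
        (min_le_right ε (η / 4)) hW (mem_of_wt_ne_zero hc) hxy hy
      refine le_trans ?_ hlow
      have h3 : Θ / 16 ≤ outCount π x₀ z₀ * pairCount s c - badSum R κ π c := by
        have h4 := mul_le_mul_of_nonneg_left h1 hO0
        have h5 : outCount π x₀ z₀ *
            (K / (typeClass n Q).card * (Mof R n : ℝ) ^ 2 / 8) = Θ / 8 := by
          rw [hΘ, hJeq]
          field_simp
        linarith
      have hcardT : ((typeClass n Q).card : ℝ) ≤ Real.exp (n * ent Q) := by
        have := card_typeClass_le hn x₀
        rwa [mem_typeClass.1 hx₀] at this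
      have hJl : Real.exp (n * ent π) / polyF ((α × α) × β) n ≤ J := by
        rw [div_le_iff₀' polyF_pos]
        exact le_card_typeClass hn (trip x₀ z₀ y₀)
      have hp3' := polyF_pos (A := (α × α) × β) (n := n)
      set C := Real.exp (n * (2 * ent Q - ent π - R - eEa g Q R W a π - 2 * (η / 4))) with hC
      calc Real.exp (-(n * (eL g Q R W ρ + η)))
          ≤ Real.exp (-(n * (eEa g Q R W a π + 2 * (η / 4)))) / Real.exp (n * (η / 4)) := by
            rw [← Real.exp_sub]
            refine Real.exp_le_exp.2 ?_
            have := mul_le_mul_of_nonneg_left hE hn0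
            nlinarith
        _ ≤ Real.exp (-(n * (eEa g Q R W a π + 2 * (η / 4)))) /
              (48 * polyF ((α × α) × β) n) :=
            div_le_div_of_nonneg_left (by positivity) (by positivity) hp3
        _ = Real.exp (n * R) * (C / 3 * (Real.exp (n * ent π) / polyF ((α × α) × β) n /
              Real.exp (n * ent Q) ^ 2 / 16)) := by
            have h6 : Real.exp (-(n * (eEa g Q R W a π + 2 * (η / 4)))) =
                Real.exp (n * R) * C * Real.exp (n * ent π) / Real.exp (n * ent Q) ^ 2 := by
              rw [hC, sq, ← Real.exp_add, ← Real.exp_add, ← Real.exp_add, ← Real.exp_sub]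
              congr 1
              ring
            rw [h6]
            field_simp
            ring
        _ ≤ Mof R n * (C / 3 * (J / (typeClass n Q).card ^ 2 / 16)) := by
            gcongr
        _ = (Mof R n : ℝ)⁻¹ * (C / 3 * (Θ / 16)) := by
            rw [hΘ]
            field_simp
        _ ≤ _ := by
            refine mul_le_mul_of_nonneg_left (mul_le_mul_of_nonneg_left h3 ?_) ?_ <;> positivity)
  refine hsplit.trans ((pr_or_le _ _).trans ?_)
  have hb0 : 0 ≤ polyF2 α α n * Real.exp (-(n * ρ)) :=
    mul_nonneg (polyF2_pos α α n).le (Real.exp_pos _).le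
  have hpc := pr_pairCount_lt_le (s := s) hT (card_not_okR_le (ρ := ρ) hn hT) hb0 hθ.le hθ1
    hK1 hK2 okR_symm (by
      intro x z hxz
      rw [okR, hxz]
      exact hok) hMb hM2 hK0
  have hKM : 32 / (K / (typeClass n Q).card * (Mof R n : ℝ) ^ 2) ≤ ζ / 8 := by
    have h1 : Real.exp (-(n * ρ)) / polyF (α × α) n ≤ K / (typeClass n Q).card := by
      rw [div_le_div_iff₀ hp hTc]
      have h2 : Real.exp (-(n * ρ)) ≤ Real.exp (-(n * mutInf (emp2 n x₀ z₀))) :=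
        Real.exp_le_exp.2 (neg_le_neg (mul_le_mul_of_nonneg_left hok.le hn0))
      nlinarith [mul_le_mul_of_nonneg_right h2 hTc.le]
    calc 32 / (K / (typeClass n Q).card * (Mof R n : ℝ) ^ 2)
        ≤ 32 / (Real.exp (-(n * ρ)) / polyF (α × α) n * Real.exp (n * R) ^ 2) := by
          gcongr
      _ = 32 * polyF (α × α) n * Real.exp (-(n * (2 * R - ρ))) := by
          have h3 : Real.exp (-(n * (2 * R - ρ))) =
              1 / (Real.exp (-(n * ρ)) * Real.exp (n * R) ^ 2) := by
            rw [sq, ← Real.exp_add, ← Real.exp_add, one_div, ← Real.exp_neg]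
            congr 1
            ring
          rw [h3]
          field_simp
      _ ≤ Real.exp (n * ((2 * R - ρ) / 2)) * Real.exp (-(n * (2 * R - ρ))) :=
          mul_le_mul_of_nonneg_right hp2 (Real.exp_pos _).le
      _ = 1 * Real.exp (-(n * ((2 * R - ρ) / 2))) := by
          rw [← Real.exp_add, one_mul]
          congr 1
          ring
      _ ≤ ζ / 8 := he1
  have hbad := pr_le_of_le (T := typeClass n Q) (ok := okR ρ) (M := Mof R n)
    (f := badSum R κ π) (badSum_nonneg κ π) (a := Θ / 16) (by positivity)
    (p := fun c => Θ / 16 ≤ badSum R κ π c) (fun c _ h => h)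
  have hbE := ens_badSum_le hn hR.le hT (hMb.trans hθ1) κ π
  have hbad' : pr (typeClass n Q) (okR ρ) (Mof R n) (fun c => Θ / 16 ≤ badSum R κ π c) ≤
      ζ / 4 := by
    calc _ ≤ (Θ / 16)⁻¹ * (16 * (polyF2 α β n * Real.exp (-(n * κ))) * Θ) :=
          hbad.trans (mul_le_mul_of_nonneg_left hbE (by positivity))
      _ = 256 * (polyF2 α β n * Real.exp (-(n * κ))) := by
          field_simp
          ring
      _ ≤ 256 * (Real.exp (n * (κ / 2)) * Real.exp (-(n * κ))) := by gcongr
      _ = 256 * Real.exp (-(n * (κ / 2))) := by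
          rw [← Real.exp_add]
          congr 2
          ring
      _ ≤ ζ / 4 := he3
  have := hMinv.trans (min_le_right _ _)
  linarith

end LowerTail

section ErrorBounds

variable {α β : Type} [Fintype α] [Fintype β] {n : ℕ}
variable {g : (α × β → ℝ) → ℝ} {Q : α → ℝ} {R ρ : ℝ} {W : α → β → ℝ}

omit [Fintype α] in
lemma sum_Wn (hW : IsChannel W) (x : Fin n → α) : ∑ y : Fin n → β, Wn n W x y = 1 := by
  have h := Finset.prod_univ_sum (fun _ : Fin n => (Finset.univ : Finset β))
    (fun i b => W (x i) b)
  rw [Fintype.piFinset_univ] at h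
  unfold Wn
  rw [← h]
  exact Finset.prod_eq_one fun i _ => (hW (x i)).2

lemma Pe_le_one (hW : IsChannel W) {M : ℕ} (c : Fin M → Fin n → α) : Pe n W g c ≤ 1 := by
  have h1 : ∀ m : Fin M, (∑ m' ∈ Finset.univ.erase m, ∑ y : Fin n → β,
      Wn n W (c m) y * Real.exp ((n : ℝ) * g (emp2 n (c m') y)) /
        ∑ m'' : Fin M, Real.exp ((n : ℝ) * g (emp2 n (c m'') y))) ≤ 1 := by
    intro m
    rw [Finset.sum_comm, ← sum_Wn (n := n) hW (c m)]
    refine Finset.sum_le_sum fun y _ => ?_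
    rw [← Finset.sum_div, ← Finset.mul_sum, mul_div_assoc]
    refine mul_le_of_le_one_right (Wn_nonneg hW _ _) (div_le_one_of_le₀ ?_ ?_)
    · exact Finset.sum_le_sum_of_subset_of_nonneg (Finset.erase_subset _ _)
        fun _ _ _ => (Real.exp_pos _).le
    · exact Finset.sum_nonneg fun _ _ => (Real.exp_pos _).le
  have h2 := Finset.sum_le_sum fun m (_ : m ∈ Finset.univ) => h1 m
  rw [Finset.sum_const, Finset.card_univ, Fintype.card_fin, nsmul_eq_mul, mul_one] at h2
  exact (mul_le_mul_of_nonneg_left h2 (by positivity)).trans inv_mul_le_one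

lemma half_exp_le_Pe (hW : IsChannel W) {G : ℝ}
    (hG : ∀ P ∈ Set.Icc (0 : α × β → ℝ) 1, |g P| ≤ G) {M : ℕ} (hM : 2 ≤ M)
    (c : Fin M → Fin n → α) : Real.exp (-(n * (2 * G))) / 2 ≤ Pe n W g c := by
  have hM0 : (2 : ℝ) ≤ M := by exact_mod_cast hM
  have hn0 : (0 : ℝ) ≤ n := by positivity
  have hden : ∀ y : Fin n → β,
      ∑ m'' : Fin M, Real.exp ((n : ℝ) * g (emp2 n (c m'') y)) ≤ M * Real.exp (n * G) := by
    intro y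
    calc _ ≤ ∑ _m : Fin M, Real.exp (n * G) := by
          refine Finset.sum_le_sum fun m _ => Real.exp_le_exp.2 ?_
          exact mul_le_mul_of_nonneg_left (abs_le.1 (hG _ (emp2_mem_Icc _ _))).2 hn0
      _ = M * Real.exp (n * G) := by simp
  have hterm : ∀ m m' : Fin M, Real.exp (-(n * (2 * G))) / M ≤ ∑ y : Fin n → β,
      Wn n W (c m) y * Real.exp ((n : ℝ) * g (emp2 n (c m') y)) /
        ∑ m'' : Fin M, Real.exp ((n : ℝ) * g (emp2 n (c m'') y)) := by
    intro m m'
    rw [← one_mul (Real.exp (-(n * (2 * G))) / M), ← sum_Wn (n := n) hW (c m), Finset.sum_mul]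
    refine Finset.sum_le_sum fun y _ => ?_
    rw [mul_div_assoc]
    refine mul_le_mul_of_nonneg_left ?_ (Wn_nonneg hW _ _)
    have h1 : Real.exp (-(n * (2 * G))) / M = Real.exp (-(n * G)) / (M * Real.exp (n * G)) := by
      rw [mul_comm (M : ℝ), ← div_div, ← Real.exp_sub]
      congr 2
      ring
    rw [h1]
    refine div_le_div₀ (Real.exp_pos _).le (Real.exp_le_exp.2 ?_)
      (Finset.sum_pos (fun _ _ => Real.exp_pos _) ⟨m, Finset.mem_univ m⟩) (hden y)
    have h2 := mul_le_mul_of_nonneg_left (abs_le.1 (hG _ (emp2_mem_Icc (c m') y))).1 hn0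
    linarith
  have hsum : (M : ℝ) * ((M - 1) * (Real.exp (-(n * (2 * G))) / M)) ≤
      ∑ m : Fin M, ∑ m' ∈ Finset.univ.erase m, ∑ y : Fin n → β,
        Wn n W (c m) y * Real.exp ((n : ℝ) * g (emp2 n (c m') y)) /
          ∑ m'' : Fin M, Real.exp ((n : ℝ) * g (emp2 n (c m'') y)) := by
    calc _ = ∑ m : Fin M, ∑ _m' ∈ Finset.univ.erase m, Real.exp (-(n * (2 * G))) / M := by
          have h3 : ((M - 1 : ℕ) : ℝ) = M - 1 := by
            rw [Nat.cast_sub (by omega)]; simp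
          simp [Finset.card_erase_of_mem, h3]
      _ ≤ _ := Finset.sum_le_sum fun m _ => Finset.sum_le_sum fun m' _ => hterm m m'
  refine le_trans ?_ (mul_le_mul_of_nonneg_left hsum (by positivity))
  have hMpos : (0 : ℝ) < M := by linarith
  rw [inv_mul_cancel_left₀ hMpos.ne', mul_div_assoc', div_le_div_iff₀ two_pos hMpos]
  nlinarith [Real.exp_pos (-(n * (2 * G)))]

lemma exists_abs_le_of_continuous {C : Type} [Fintype C] {φ : (C → ℝ) → ℝ} (hφ : Continuous φ) :
    ∃ G, ∀ P ∈ Set.Icc (0 : C → ℝ) 1, |φ P| ≤ G := by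
  obtain ⟨G, hG⟩ := (isCompact_Icc (a := (0 : C → ℝ)) (b := 1)).exists_bound_of_continuousOn
    hφ.continuousOn
  exact ⟨G, fun P hP => by simpa using hG P hP⟩

lemma abs_log_Pe_le (hn : 0 < n) (hW : IsChannel W) {G : ℝ}
    (hG : ∀ P ∈ Set.Icc (0 : α × β → ℝ) 1, |g P| ≤ G) {M : ℕ} (hM : 2 ≤ M)
    (c : Fin M → Fin n → α) : |Real.log (Pe n W g c) / n| ≤ 2 * G + 1 := by
  have h1 := half_exp_le_Pe (n := n) hW hG hM c
  have h2 := Pe_le_one (n := n) (g := g) hW c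
  have h0 : 0 < Real.exp (-(n * (2 * G))) / 2 := by positivity
  have hn1 : (1 : ℝ) ≤ n := by exact_mod_cast hn
  have h3 := Real.log_nonpos (h0.le.trans h1) h2
  have h4 := Real.log_le_log h0 h1
  rw [Real.log_div (Real.exp_pos _).ne' two_ne_zero, Real.log_exp] at h4
  have h5 := Real.log_two_lt_d9
  rw [abs_div, abs_of_nonpos h3, Nat.abs_cast, div_le_iff₀ (by linarith)]
  nlinarith

end ErrorBounds

section Link

variable {α β : Type} [Fintype α] [Fintype β] {n : ℕ}
variable {g : (α × β → ℝ) → ℝ} {Q : α → ℝ} {R ρ : ℝ} {W : α → β → ℝ}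

lemma rgvProb_eq_wt {M : ℕ} (c : Fin M → Fin n → α) :
    rgvProb n Q (fun P : α × α → ℝ => -mutInf P) (-ρ) c = wt (typeClass n Q) (okR ρ) c := by
  have h : ∀ i, feasible n Q (fun P : α × α → ℝ => -mutInf P) (-ρ) c i =
      (typeClass n Q).filter fun z => ∀ j, j < i → okR ρ z (c j) := by
    intro i
    ext z
    rw [feasible, Finset.mem_filter, Finset.mem_filter]
    simp only [okR, neg_lt_neg_iff]
  unfold rgvProb wt
  refine Finset.prod_congr rfl fun i _ => ?_
  rw [h i]
  congr!

lemma expect_eq_ens (M : ℕ) (f : (Fin M → Fin n → α) → ℝ) :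
    expect n Q (fun P : α × α → ℝ => -mutInf P) (-ρ) M f =
      ens (typeClass n Q) (okR ρ) M f := by
  simp only [expect, ens, rgvProb_eq_wt]

lemma prob_eq_pr (M : ℕ) (S : (Fin M → Fin n → α) → Prop) :
    prob n Q (fun P : α × α → ℝ => -mutInf P) (-ρ) M S = pr (typeClass n Q) (okR ρ) M S := by
  unfold prob pr ens
  refine Finset.sum_congr rfl fun c _ => ?_
  rw [rgvProb_eq_wt]
  by_cases h : S c <;> simp [h]

lemma typeClass_nonempty {D : ℕ} (hD : 0 < D) (hQ : IsDist Q) (hQD : IsTypeDist D Q) (t : ℕ) :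
    (typeClass (nseq D t) Q).Nonempty := by
  choose k hk using hQD
  have hcard : Fintype.card (Σ a, Fin (k a * (t + 1))) = nseq D t := by
    have h1 : ((∑ a, k a : ℕ) : ℝ) = D := by
      push_cast
      simp only [← hk]
      rw [← Finset.sum_mul, hQ.2, one_mul]
    have h2 : ∑ a, k a = D := by exact_mod_cast h1
    rw [Fintype.card_sigma]
    simp only [Fintype.card_fin]
    rw [← Finset.sum_mul, h2, nseq]
  have e := (Fintype.equivFinOfCardEq hcard).symm
  refine ⟨fun i => (e i).1, mem_typeClass.2 ?_⟩
  ext a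
  have h3 : (Finset.univ.filter fun i => (e i).1 = a).card = k a * (t + 1) := by
    have h4 := card_sigma_filter (fun a => k a * (t + 1)) (fun a : α => a) a
    rw [Finset.sum_filter, Finset.sum_ite_eq' Finset.univ a] at h4
    simp only [Finset.mem_univ, if_true] at h4
    rw [← h4]
    refine Finset.card_bij (fun i _ => e i) ?_ (fun _ _ _ _ h => e.injective h) ?_
    · intro i hi
      simpa using hi
    · intro s hs
      exact ⟨e.symm s, by simpa using hs, by simp⟩
  have hD0 : (D : ℝ) ≠ 0 := by exact_mod_cast hD.ne'
  have ht : ((t : ℝ) + 1) ≠ 0 := by positivity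
  unfold emp
  rw [h3, nseq]
  push_cast
  rw [← hk a]
  field_simp

lemma tendsto_nseq {D : ℕ} (hD : 0 < D) : Tendsto (nseq D) atTop atTop :=
  tendsto_atTop_mono (fun t => (Nat.le_succ t).trans (Nat.le_mul_of_pos_left _ hD)) tendsto_id

end Link

section Convergence

variable {α β : Type} [Fintype α] [Fintype β] {n : ℕ}
variable {g : (α × β → ℝ) → ℝ} {Q : α → ℝ} {R ρ : ℝ} {W : α → β → ℝ}

/-- The error probability of `c` deviates from `exp (-n L)` by an exponential factor of rate
more than `η`. -/
def deviates (W : α → β → ℝ) (g : (α × β → ℝ) → ℝ) (L η : ℝ) {M : ℕ}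
    (c : Fin M → Fin n → α) : Prop :=
  Pe n W g c < Real.exp (-((n : ℝ) * (L + η))) ∨ Real.exp (-((n : ℝ) * (L - η))) < Pe n W g c

lemma eventually_pr_deviates_le (hg : Continuous g) (hQ : IsDist Q) (hW : IsChannel W)
    (hR : 0 < R) (hρ : R < ρ) (hρ2 : ρ < 2 * R) {η ζ : ℝ} (hη : 0 < η) (hζ : 0 < ζ) :
    ∀ᶠ n : ℕ in atTop, (typeClass n Q).Nonempty →
      pr (typeClass n Q) (okR ρ) (Mof R n) (deviates W g (eL g Q R W ρ) η) ≤ ζ := by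
  filter_upwards [eventually_pr_Pe_lt_le hg hQ hW hR hρ hρ2 hη (half_pos hζ),
    eventually_pr_lt_Pe_le hg hQ hW hR hρ hη (half_pos hζ)] with n h1 h2 hT
  have h3 := (pr_or_le (T := typeClass n Q) (ok := okR ρ) (M := Mof R n) _ _).trans
    (add_le_add (h1 hT) (h2 hT))
  rw [add_halves] at h3
  exact h3

lemma abs_log_Pe_sub_le (hn : 0 < n) {L η : ℝ} {M : ℕ} {c : Fin M → Fin n → α}
    (h : ¬ deviates W g L η c) : |-(Real.log (Pe n W g c) / n) - L| ≤ η := by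
  unfold deviates at h
  push Not at h
  obtain ⟨h1, h2⟩ := h
  have hn0 : (0 : ℝ) < n := by exact_mod_cast hn
  have h3 := (Real.le_log_iff_exp_le ((Real.exp_pos _).trans_le h1)).2 h1
  have h4 := (Real.log_le_iff_le_exp ((Real.exp_pos _).trans_le h1)).2 h2
  have h5 : -(L + η) ≤ Real.log (Pe n W g c) / n := by
    rw [le_div_iff₀ hn0]; linarith
  have h6 : Real.log (Pe n W g c) / n ≤ -(L - η) := by
    rw [div_le_iff₀ hn0]; linarith
  rw [abs_le]
  constructor <;> linarith

lemma abs_ens_sub_le {A : Type} [Fintype A] {T : Finset A} {ok : A → A → Prop} {M : ℕ}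
    (h1 : ens T ok M (fun _ => 1) = 1) {f : (Fin M → A) → ℝ} {p : (Fin M → A) → Prop}
    {L B η : ℝ} (hη : 0 ≤ η) (hB : ∀ c, |f c - L| ≤ B) (hp : ∀ c, ¬ p c → |f c - L| ≤ η) :
    |ens T ok M f - L| ≤ η + B * pr T ok M p := by
  have hc : ∀ a : ℝ, ens T ok M (fun _ => a) = a := fun a => by
    have := ens_const_mul (T := T) (ok := ok) (M := M) a (fun _ => 1)
    simpa [h1] using this
  have hbd : ∀ c, |f c - L| ≤ η + B * (if p c then 1 else 0) := fun c => by
    by_cases h : p c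
    · simpa [h] using (hB c).trans (le_add_of_nonneg_left hη)
    · simpa [h] using hp c h
  have heq : ens T ok M (fun c => η + B * (if p c then 1 else 0)) = η + B * pr T ok M p := by
    rw [ens_add, hc, ens_const_mul, pr]
  have hsub : ens T ok M (fun c => f c - L) = ens T ok M f - L := by
    rw [ens_sub, hc]
  rw [← hsub, ← heq, abs_le]
  constructor
  · have h2 := ens_mono (T := T) (ok := ok) (M := M) fun c => (abs_le.1 (hbd c)).1
    have h3 := ens_const_mul (T := T) (ok := ok) (M := M) (-1)
      (fun c => η + B * (if p c then 1 else 0))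
    simp only [neg_one_mul] at h3
    rwa [h3] at h2
  · exact ens_mono fun c => (abs_le.1 (hbd c)).2

lemma eventually_abs_Expnt_sub_le (hg : Continuous g) (hQ : IsDist Q) (hW : IsChannel W)
    (hR : 0 < R) (hρ : R < ρ) (hρ2 : ρ < 2 * R) {ε : ℝ} (hε : 0 < ε) :
    ∀ᶠ n : ℕ in atTop, (typeClass n Q).Nonempty →
      |Expnt n Q (fun P : α × α → ℝ => -mutInf P) (-ρ) W g R - eL g Q R W ρ| < ε := by
  obtain ⟨G, hG⟩ := exists_abs_le_of_continuous hg
  set L := eL g Q R W ρ with hL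
  set B := |2 * G + 1| + |L| with hB
  have hB0 : 0 ≤ B := by positivity
  filter_upwards [eventually_pr_deviates_le hg hQ hW hR hρ hρ2 (η := ε / 2) (half_pos hε)
      (ζ := ε / (4 * (B + 1))) (by positivity),
    eventually_Mof_mul_le (α := α) hR.le hρ (ζ := 1 / 2) (by norm_num),
    eventually_gt_atTop 0] with n hpr hMb hn hT
  have hn0 : (0 : ℝ) < n := by exact_mod_cast hn
  have hM2 : 2 ≤ Mof R n := by
    have h1 : (1 : ℝ) < Mof R n :=
      (Real.one_lt_exp_iff.2 (mul_pos hn0 hR)).trans_le (exp_le_Mof R n)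
    exact_mod_cast h1
  have hone := ens_one (M := Mof R n) hT (card_not_okR_le (ρ := ρ) hn hT)
    (mul_nonneg (polyF2_pos α α n).le (Real.exp_pos _).le) hMb
  have hE : Expnt n Q (fun P : α × α → ℝ => -mutInf P) (-ρ) W g R =
      ens (typeClass n Q) (okR ρ) (Mof R n) (fun c => -(Real.log (Pe n W g c) / n)) := by
    have h := ens_const_mul (T := typeClass n Q) (ok := okR ρ) (M := Mof R n) (-(n : ℝ)⁻¹)
      (fun c => Real.log (Pe n W g c))
    rw [Expnt, expect_eq_ens]
    calc _ = -(n : ℝ)⁻¹ * ens (typeClass n Q) (okR ρ) (Mof R n)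
          (fun c => Real.log (Pe n W g c)) := by ring
      _ = _ := by
        rw [← h]
        congr 1
        ext c
        ring
  have hmain := abs_ens_sub_le hone (f := fun c => -(Real.log (Pe n W g c) / n)) (L := L)
    (B := B) (p := deviates W g L (ε / 2)) (half_pos hε).le
    (fun c => by
      refine (abs_sub _ _).trans (add_le_add ?_ le_rfl)
      rw [abs_neg]
      exact (abs_log_Pe_le hn hW hG hM2 c).trans (le_abs_self _))
    (fun c hc => abs_log_Pe_sub_le hn hc)
  rw [hE]
  have h5 : B * pr (typeClass n Q) (okR ρ) (Mof R n) (deviates W g L (ε / 2)) ≤ ε / 4 := by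
    refine (mul_le_mul_of_nonneg_left (hpr hT) hB0).trans ?_
    rw [mul_div_assoc', div_le_div_iff₀ (by positivity) (by norm_num)]
    nlinarith
  linarith

end Convergence

end RGV

open RGV in
/-- For `d(P) = −I_P(X;X')` and `Δ = −(R+2δ)` with `δ > 0` sufficiently
small, the error exponent of the RGV random code converges in probability to the typical
error exponent. -/
theorem statement8 {α β : Type} [Fintype α] [Nonempty α] [Fintype β] [Nonempty β]
    (Q : α → ℝ) (D : ℕ) (hD : 0 < D) (hQ : IsDist Q) (hQD : IsTypeDist D Q)
    (W : α → β → ℝ) (hW : IsChannel W)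
    (g : (α × β → ℝ) → ℝ) (hg : Continuous g)
    (R : ℝ) (hR : 0 < R) :
    ∃ δ₀ : ℝ, 0 < δ₀ ∧ ∀ δ : ℝ, 0 < δ → δ < δ₀ →
      ∃ L : ℝ,
        Filter.Tendsto
          (fun t : ℕ =>
            Expnt (nseq D t) Q (fun P : α × α → ℝ => -mutInf P) (-(R + 2 * δ)) W g R)
          Filter.atTop (nhds L) ∧
        ∀ η : ℝ, 0 < η →
          Filter.Tendsto
            (fun t : ℕ =>
              prob (nseq D t) Q (fun P : α × α → ℝ => -mutInf P) (-(R + 2 * δ))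
                (Mof R (nseq D t))
                (fun c =>
                  Pe (nseq D t) W g c < Real.exp (-((nseq D t : ℝ) * (L + η))) ∨
                    Real.exp (-((nseq D t : ℝ) * (L - η))) < Pe (nseq D t) W g c))
            Filter.atTop (nhds 0) := by
  refine ⟨R / 4, by positivity, fun δ hδ hδ₀ => ⟨eL g Q R W (R + 2 * δ), ?_, fun η hη => ?_⟩⟩
  · rw [Metric.tendsto_atTop']
    intro ε hε
    have h := (tendsto_nseq hD).eventually (eventually_abs_Expnt_sub_le hg hQ hW hR
      (ρ := R + 2 * δ) (by linarith) (by linarith) hε)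
    obtain ⟨N, hN⟩ := eventually_atTop.1 h
    exact ⟨N, fun t ht => hN t ht.le (typeClass_nonempty hD hQ hQD t)⟩
  · rw [Metric.tendsto_atTop']
    intro ε hε
    have h := (tendsto_nseq hD).eventually (eventually_pr_deviates_le hg hQ hW hR
      (ρ := R + 2 * δ) (by linarith) (by linarith) hη (half_pos hε))
    obtain ⟨N, hN⟩ := eventually_atTop.1 h
    refine ⟨N, fun t ht => ?_⟩
    rw [prob_eq_pr, Real.dist_0_eq_abs, abs_of_nonneg (pr_nonneg _)]
    exact (hN t ht.le (typeClass_nonempty hD hQ hQD t)).trans_lt (half_lt_self hε)
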